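/- arXiv:1604.08166 — 2 statements merged into one kernel-verified Lean document; each statement's English description precedes it below -/
import Mathlib

section
/- On the space of Barański diagonal IFSes with a fixed alphabet E (parameterized by the contraction ratios and translations of the defining similarities, with the natural topology), the functions Φ ↦ HD(Λ_Φ) and Φ ↦ DynD(Φ) are continuous. -/
open MeasureTheory Filter Set Metric
open scoped Classical Topology ENNReal NNReal

namespace SelfAffineSponge

/-- A diagonal IFS on `[0,1]^d`: for each coordinate `i ∈ D = Fin d` a finite alphabet
`A i` indexing affine maps `x ↦ slope i a * x + off i a` of `[0,1]`, together with a
set `E ⊆ ∏ i, A i` of allowed tuples of symbols. -/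
structure DiagIFS (d : ℕ) (A : Fin d → Type) [∀ i, Fintype (A i)] where
  slope : ∀ i : Fin d, A i → ℝ
  off : ∀ i : Fin d, A i → ℝ
  E : Finset (∀ i, A i)

variable {d : ℕ} {A : Fin d → Type} [∀ i, Fintype (A i)]

namespace DiagIFS

/-- the base similarity `φ_{i,a}` in coordinate `i` -/
def base (Φ : DiagIFS d A) (i : Fin d) (a : A i) (x : ℝ) : ℝ :=
  Φ.slope i a * x + Φ.off i a

/-- the data defines an honest diagonal IFS: `E` is nonempty and each base map is a
contracting similarity of `[0,1]` -/
def Valid (Φ : DiagIFS d A) : Prop :=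
  Φ.E.Nonempty ∧ (∀ i a, Φ.slope i a ≠ 0) ∧ (∀ i a, |Φ.slope i a| < 1) ∧
    ∀ i a, ∀ x ∈ Set.Icc (0:ℝ) 1, Φ.base i a x ∈ Set.Icc (0:ℝ) 1

/-- the alphabet `E` of the IFS, as a type -/
abbrev Symb (Φ : DiagIFS d A) : Type _ := {a : ∀ i, A i // a ∈ Φ.E}

instance (Φ : DiagIFS d A) : MeasurableSpace Φ.Symb := ⊤
instance (Φ : DiagIFS d A) : TopologicalSpace Φ.Symb := ⊥

/-- the affine contraction `φ_a` of `[0,1]^d` associated to a tuple of symbols -/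
def affMap (Φ : DiagIFS d A) (a : ∀ i, A i) (x : Fin d → ℝ) : Fin d → ℝ :=
  fun i => Φ.base i (a i) (x i)

/-- the coding map `π(ω) = lim_n φ_{ω_0}∘⋯∘φ_{ω_{n-1}}(0)`, written in closed form -/
noncomputable def coding (Φ : DiagIFS d A) (ω : ℕ → Φ.Symb) : Fin d → ℝ :=
  fun i => ∑' n : ℕ, (∏ k ∈ Finset.range n, Φ.slope i ((ω k).1 i)) * Φ.off i ((ω n).1 i)

/-- the limit set `Λ_Φ = π(E^ℕ)` (the self-affine sponge) -/
def limitSet (Φ : DiagIFS d A) : Set (Fin d → ℝ) :=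
  Set.range Φ.coding

theorem coding_mem (Φ : DiagIFS d A) (ω : ℕ → Φ.Symb) : Φ.coding ω ∈ Φ.limitSet :=
  ⟨ω, rfl⟩

/-- the `i`-th Lyapunov exponent `χ_i(p) = -∫ log|φ'_{a,i}| dp(a)` of a finite measure
`p` on `E` (given by its density) -/
noncomputable def chi (Φ : DiagIFS d A) (i : Fin d) (p : Φ.Symb → ℝ) : ℝ :=
  -∑ a : Φ.Symb, p a * Real.log |Φ.slope i (a.1 i)|

/-- the mass `p([a]_I)` of the cylinder `[a]_I = {b ∈ E : b_i = a_i ∀ i ∈ I}` -/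
noncomputable def cylMass (Φ : DiagIFS d A) (I : Finset (Fin d)) (p : Φ.Symb → ℝ)
    (a : Φ.Symb) : ℝ :=
  ∑ b : Φ.Symb, if ∀ i ∈ I, b.1 i = a.1 i then p b else 0

/-- the entropy `h(I; p) = -∫ log p([a]_I) dp(a)` -/
noncomputable def entropy (Φ : DiagIFS d A) (I : Finset (Fin d)) (p : Φ.Symb → ℝ) : ℝ :=
  -∑ a : Φ.Symb, p a * Real.log (Φ.cylMass I p a)

/-- the conditional entropy `h(I' | I; p) = h(I';p) - h(I;p)` -/
noncomputable def condEntropy (Φ : DiagIFS d A) (I I' : Finset (Fin d))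
    (p : Φ.Symb → ℝ) : ℝ :=
  Φ.entropy I' p - Φ.entropy I p

/-- a coordinate set `I ⊆ D` is good if the projected IFS `Φ_I` satisfies the open set
condition: the boxes `φ_{I,a}((0,1)^I)`, indexed by distinct projections of elements of
`E`, are pairwise disjoint (equivalently, some coordinate has disjoint intervals). -/
def GoodIdx (Φ : DiagIFS d A) (I : Finset (Fin d)) : Prop :=
  ∀ a ∈ Φ.E, ∀ b ∈ Φ.E, (∃ i ∈ I, a i ≠ b i) →
    ∃ i ∈ I, Disjoint (Φ.base i (a i) '' Set.Ioo (0:ℝ) 1)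
      (Φ.base i (b i) '' Set.Ioo (0:ℝ) 1)

/-- Barański condition: each base IFS satisfies the open set condition w.r.t. `(0,1)` -/
def Baranski (Φ : DiagIFS d A) : Prop :=
  ∀ i : Fin d, ∀ a b : A i, a ≠ b →
    Disjoint (Φ.base i a '' Set.Ioo (0:ℝ) 1) (Φ.base i b '' Set.Ioo (0:ℝ) 1)

/-- strong Barański condition: each base IFS satisfies the strong separation condition
w.r.t. `[0,1]` -/
def StronglyBaranski (Φ : DiagIFS d A) : Prop :=
  ∀ i : Fin d, ∀ a b : A i, a ≠ b →
    Disjoint (Φ.base i a '' Set.Icc (0:ℝ) 1) (Φ.base i b '' Set.Icc (0:ℝ) 1)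

/-- coordinate ordering condition: some permutation `σ` of the coordinates has
`|φ'_{a,σ(1)}| > ⋯ > |φ'_{a,σ(d)}|` for all `a ∈ E` -/
def CoordOrdering (Φ : DiagIFS d A) : Prop :=
  ∃ σ : Equiv.Perm (Fin d), ∀ a ∈ Φ.E, ∀ i j : Fin d, i < j →
    |Φ.slope (σ j) (a (σ j))| < |Φ.slope (σ i) (a (σ i))|

end DiagIFS

/-- a probability vector (probability measure on a finite set, via its density) -/
def IsProbVec {α : Type*} [Fintype α] (p : α → ℝ) : Prop :=
  (∀ a, 0 ≤ p a) ∧ ∑ a, p a = 1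

/-- a measure `p` on `E` is good if `I(p,x) = {i : χ_i(p) ≤ x}` is good for all `x > 0` -/
def DiagIFS.GoodVec (Φ : DiagIFS d A) (p : Φ.Symb → ℝ) : Prop :=
  ∀ x > 0, Φ.GoodIdx (Finset.univ.filter fun i => Φ.chi i p ≤ x)

/-- a cycle on `E`: a continuous exponentially `λ`-periodic map `(0,∞) → P`,
where `λ = 1` means constant -/
structure Cycle (Φ : DiagIFS d A) where
  lam : ℝ
  one_le_lam : 1 ≤ lam
  r : ℝ → Φ.Symb → ℝ
  prob : ∀ b > 0, IsProbVec (r b)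
  cont : ContinuousOn r (Set.Ioi 0)
  periodic : ∀ b > 0, r (lam * b) = r b
  const_of_lam_eq_one : lam = 1 → ∀ b > 0, ∀ b' > 0, r b = r b'

/-- the number `B_i`, determined by `B = ∫_0^{B_i} χ_i(r_b) db` (written via `sInf`;
for a cycle the function `x ↦ ∫_0^x χ_i(r_b) db` is continuous and strictly
increasing, so the infimum is the unique solution) -/
noncomputable def Bcoord (Φ : DiagIFS d A) (r : ℝ → Φ.Symb → ℝ) (B : ℝ) (i : Fin d) : ℝ :=
  sInf {x : ℝ | 0 ≤ x ∧ B ≤ ∫ b in Set.Ioc (0:ℝ) x, Φ.chi i (r b)}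

/-- `δ(r, B) = B⁻¹ ∫_0^∞ h({i : b ≤ B_i}; r_b) db` -/
noncomputable def deltaRB (Φ : DiagIFS d A) (r : ℝ → Φ.Symb → ℝ) (B : ℝ) : ℝ :=
  B⁻¹ * ∫ b in Set.Ioi (0:ℝ),
    Φ.entropy (Finset.univ.filter fun i => b ≤ Bcoord Φ r B i) (r b)

/-- `δ(r) = inf_{B ∈ [1,λ]} δ(r,B)` -/
noncomputable def Cycle.delta {Φ : DiagIFS d A} (c : Cycle Φ) : ℝ :=
  sInf (deltaRB Φ c.r '' Set.Icc 1 c.lam)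

/-- `δ(p) = ∫_0^∞ h({i : b ≤ 1/χ_i(p)}; p) db` -/
noncomputable def deltaP (Φ : DiagIFS d A) (p : Φ.Symb → ℝ) : ℝ :=
  ∫ b in Set.Ioi (0:ℝ),
    Φ.entropy (Finset.univ.filter fun i => b ≤ (Φ.chi i p)⁻¹) p

/-- the normalized average `R̂_B = B⁻¹ ∫_0^B r_b db` of a cycle -/
noncomputable def cycleAvg {Φ : DiagIFS d A} (c : Cycle Φ) (B : ℝ) : Φ.Symb → ℝ :=
  fun a => B⁻¹ * ∫ b in Set.Ioc (0:ℝ) B, c.r b a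

/-- a cycle is good if all its normalized averages `R̂_B` are good -/
def Cycle.Good {Φ : DiagIFS d A} (c : Cycle Φ) : Prop :=
  ∀ B > 0, Φ.GoodVec (cycleAvg c B)

/-- a cycle is nondegenerate if `{b > 0 : r_b(a) > 0 ∀ a ∈ E_r}` is dense in `(0,∞)` -/
def Cycle.Nondeg {Φ : DiagIFS d A} (c : Cycle Φ) : Prop :=
  Set.Ioi (0:ℝ) ⊆
    closure {b : ℝ | 0 < b ∧ ∀ a : Φ.Symb, (∃ b' > 0, 0 < c.r b' a) → 0 < c.r b a}

/-- the lower pointwise dimension `d̲(x,μ) = liminf_{ρ→0} log μ(B(x,ρ))/log ρ` -/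
noncomputable def lowerPtDim {X : Type*} [PseudoMetricSpace X] [MeasurableSpace X]
    (μ : Measure X) (x : X) : ℝ≥0∞ :=
  Filter.liminf
    (fun ρ : ℝ => ENNReal.ofReal (Real.log (μ (Metric.ball x ρ)).toReal / Real.log ρ))
    (𝓝[>] (0:ℝ))

/-- the Hausdorff dimension of a measure: the essential supremum of its lower
pointwise dimension -/
noncomputable def measDim {X : Type*} [PseudoMetricSpace X] [MeasurableSpace X]
    (μ : Measure X) : ℝ≥0∞ :=
  essSup (lowerPtDim μ) μ

/-- the shift map on `E^ℕ` -/
def shift {α : Type*} (ω : ℕ → α) : ℕ → α := fun n => ω (n + 1)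

/-- the dynamical dimension: the supremum of `HD(π_*μ)` over shift-invariant
probability measures `μ` on `E^ℕ` -/
noncomputable def DiagIFS.dynDim (Φ : DiagIFS d A) : ℝ≥0∞ :=
  sSup {x : ℝ≥0∞ | ∃ μ : Measure (ℕ → Φ.Symb), IsProbabilityMeasure μ ∧
    Measure.map shift μ = μ ∧ x = measDim (Measure.map Φ.coding μ)}

/-- `μ` is the product measure on `E^ℕ` whose `k`-th factor has density `p k`
(this property characterizes `μ` uniquely) -/
def IsProductMeasure (Φ : DiagIFS d A) (p : ℕ → Φ.Symb → ℝ)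
    (μ : Measure (ℕ → Φ.Symb)) : Prop :=
  IsProbabilityMeasure μ ∧
    ∀ (n : ℕ) (w : ℕ → Φ.Symb),
      (μ {ω | ∀ k < n, ω k = w k}).toReal = ∏ k ∈ Finset.range n, p k (w k)

/-- the set of Hausdorff dimensions of Bernoulli measures `ν_p = π_*[p^ℕ]` -/
noncomputable def bernoulliDims (Φ : DiagIFS d A) : Set ℝ≥0∞ :=
  {x | ∃ p : Φ.Symb → ℝ, IsProbVec p ∧ ∃ μ : Measure (ℕ → Φ.Symb),
    IsProductMeasure Φ (fun _ => p) μ ∧ x = measDim (Measure.map Φ.coding μ)}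

/-- the set of Hausdorff dimensions of pseudo-Bernoulli measures
`ν_r = π_*[∏_n r_n]` -/
noncomputable def pseudoBernoulliDims (Φ : DiagIFS d A) : Set ℝ≥0∞ :=
  {x | ∃ c : Cycle Φ, ∃ μ : Measure (ℕ → Φ.Symb),
    IsProductMeasure Φ (fun n => c.r ((n : ℝ) + 1)) μ ∧
      x = measDim (Measure.map Φ.coding μ)}


/-- Balls of radius `ρ` seen through `f` are covered, up to a bounded multiplicity `N`, by the
fibres of a labelling of `Ω` whose images under `g` have diameter at most `ρ ^ t`. -/
def ScaleComparison {Ω Y Z : Type*} [PseudoMetricSpace Y] [PseudoMetricSpace Z] (L : Type*)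
    (f : Ω → Y) (g : Ω → Z) (t : ℝ) : Prop :=
  ∃ N : ℕ, ∀ ρ ∈ Ioo (0:ℝ) 1, ∃ ℓ : Ω → L,
    (∀ ω τ, ℓ ω = ℓ τ → dist (g ω) (g τ) ≤ ρ ^ t) ∧
    ∀ (y : Y) (S : Finset L), (∀ l ∈ S, ∃ ω, ℓ ω = l ∧ f ω ∈ ball y ρ) → S.card ≤ N

theorem tsum_le_of_card_le {L : Type*} {N : ℕ} {c : ℝ≥0∞} {u : L → ℝ≥0∞}
    (hN : ∀ S : Finset L, (∀ l ∈ S, u l ≠ 0) → S.card ≤ N) (hc : ∀ l, u l ≤ c) :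
    ∑' l, u l ≤ N * c := by
  rw [ENNReal.tsum_eq_iSup_sum]
  refine iSup_le fun S => ?_
  rw [← Finset.sum_filter_ne_zero]
  calc ∑ l ∈ S.filter (fun l => u l ≠ 0), u l
      ≤ (S.filter fun l => u l ≠ 0).card • c := Finset.sum_le_card_nsmul _ _ _ fun l _ => hc l
    _ ≤ N * c := by
      rw [nsmul_eq_mul]
      gcongr
      exact hN _ fun l hl => (Finset.mem_filter.1 hl).2

theorem tsum_measure_le_of_card_le {L Ω : Type*} [Countable L] [MeasurableSpace Ω]
    (μ : Measure Ω) {N : ℕ} {Q : L → Set Ω} (hQ : ∀ l, MeasurableSet (Q l))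
    (hN : ∀ (x : Ω) (S : Finset L), (∀ l ∈ S, x ∈ Q l) → S.card ≤ N) :
    ∑' l, μ (Q l) ≤ N * μ univ := by
  calc ∑' l, μ (Q l) = ∑' l, ∫⁻ x, (Q l).indicator 1 x ∂μ := by
        simp_rw [lintegral_indicator_one (hQ _)]
    _ = ∫⁻ x, ∑' l, (Q l).indicator 1 x ∂μ :=
        (lintegral_tsum fun l => (measurable_one.indicator (hQ l)).aemeasurable).symm
    _ ≤ ∫⁻ _, N ∂μ := by
        refine lintegral_mono fun x => ?_
        have := tsum_le_of_card_le (N := N) (c := 1)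
          (u := fun l => (Q l).indicator (1 : Ω → ℝ≥0∞) x)
          (fun S hS => hN x S fun l hl => Set.mem_of_indicator_ne_zero (hS l hl))
          (fun l => Set.indicator_le_self' (fun _ _ => zero_le) x)
        simpa using this
    _ = N * μ univ := by simp

theorem exists_ball_cover_of_hausdorffMeasure_eq_zero {Y : Type*} [MetricSpace Y]
    [MeasurableSpace Y] [BorelSpace Y] {S : Set Y} {s : ℝ} (hs : 0 < s)
    (h : Measure.hausdorffMeasure s S = 0) {η : ℝ≥0∞} (hη : 0 < η) :
    ∃ (U : ℕ → Set Y) (ρ : ℕ → ℝ), S ⊆ ⋃ n, U n ∧ (∀ n, ρ n ∈ Ioo (0:ℝ) 1) ∧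
      (∀ n, ENNReal.ofReal (ρ n) ≤ η) ∧ (∀ n, ∀ y ∈ U n, U n ⊆ ball y (ρ n)) ∧
      ∑' n, ENNReal.ofReal (ρ n) ^ s ≤ η := by
  obtain ⟨R, hR0, hR⟩ := exists_between (lt_min hη zero_lt_one)
  obtain ⟨r, hr0, hrR⟩ := exists_between hR0
  obtain ⟨δ, hδ0, hδ⟩ := ENNReal.exists_pos_sum_of_countable' (ENNReal.half_pos hη.ne').ne' ℕ
  rw [Measure.hausdorffMeasure_apply] at h
  have h1 := ENNReal.iSup_eq_zero.1 (ENNReal.iSup_eq_zero.1 h r) hr0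
  have h2 := (h1.symm ▸ ENNReal.half_pos hη.ne' :
    (⨅ (t : ℕ → Set Y) (_ : S ⊆ ⋃ n, t n) (_ : ∀ n, ediam (t n) ≤ r),
          ∑' n, ⨆ _ : (t n).Nonempty, ediam (t n) ^ s) < η / 2)
  simp only [iInf_lt_iff] at h2
  obtain ⟨U, hU, hUr, hUs⟩ := h2
  have hsup (n : ℕ) : (⨆ _ : (U n).Nonempty, ediam (U n) ^ s) = ediam (U n) ^ s := by
    rcases (U n).eq_empty_or_nonempty with h0 | h0
    · simp [h0, hs]
    · simp [h0]
  simp_rw [hsup] at hUs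
  have key (n : ℕ) : ∃ x : ℝ≥0∞, ediam (U n) < x ∧ x < R ∧ x ^ s < ediam (U n) ^ s + δ n := by
    have hlt : ediam (U n) < R := (hUr n).trans_lt hrR
    have hfin : ediam (U n) ≠ ∞ := (hlt.trans_le le_top).ne
    have hc : ∀ᶠ x in 𝓝 (ediam (U n)), x ^ s < ediam (U n) ^ s + δ n :=
      (ENNReal.continuous_rpow_const.tendsto _).eventually
        (gt_mem_nhds (ENNReal.lt_add_right (ENNReal.rpow_ne_top_of_nonneg hs.le hfin)
          (hδ0 n).ne'))
    have : (𝓝[>] (ediam (U n))).NeBot := nhdsGT_neBot_of_exists_gt ⟨R, hlt⟩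
    obtain ⟨x, hx, hx1, hx2⟩ :=
      ((hc.filter_mono nhdsWithin_le_nhds).and (Ioo_mem_nhdsGT hlt)).exists
    exact ⟨x, hx1, hx2, hx⟩
  choose x hx1 hx2 hx3 using key
  have hR1 : R < 1 := hR.trans_le (min_le_right _ _)
  have hxt (n : ℕ) : x n ≠ ∞ := ((hx2 n).trans_le le_top).ne
  have hx0 (n : ℕ) : 0 < x n := bot_le.trans_lt (hx1 n)
  refine ⟨U, fun n => (x n).toReal, hU, fun n => ⟨ENNReal.toReal_pos (hx0 n).ne' (hxt n), ?_⟩,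
    fun n => ?_, fun n y hy z hz => ?_, ?_⟩
  · exact (ENNReal.toReal_lt_toReal (hxt n) ENNReal.one_ne_top).2 ((hx2 n).trans hR1)
  · rw [ENNReal.ofReal_toReal (hxt n)]
    exact ((hx2 n).trans (hR.trans_le (min_le_left _ _))).le
  · rw [mem_ball, dist_edist]
    exact (ENNReal.toReal_lt_toReal (edist_ne_top _ _) (hxt n)).2
      ((edist_le_ediam_of_mem hz hy).trans_lt (hx1 n))
  · simp_rw [ENNReal.ofReal_toReal (hxt _)]
    calc ∑' n, x n ^ s ≤ ∑' n, (ediam (U n) ^ s + δ n) := ENNReal.tsum_le_tsum fun n => (hx3 n).le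
      _ = ∑' n, ediam (U n) ^ s + ∑' n, δ n := ENNReal.tsum_add
      _ ≤ η / 2 + η / 2 := add_le_add hUs.le hδ.le
      _ = η := ENNReal.add_halves η

theorem ScaleComparison.mul_dimH_range_le {Ω Y Z L : Type*} [MetricSpace Y] [MetricSpace Z]
    [Countable L] {f : Ω → Y} {g : Ω → Z} {t : ℝ≥0} (ht : 0 < t)
    (h : ScaleComparison L f g t) : t * dimH (range g) ≤ dimH (range f) := by
  borelize Y Z
  obtain ⟨N, hN⟩ := h
  refine le_of_forall_gt_imp_ge_of_dense fun c hc => ?_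
  obtain ⟨s, hs1, hs2⟩ := ENNReal.lt_iff_exists_nnreal_btwn.1 hc
  have h0 := hausdorffMeasure_of_dimH_lt hs1
  have hs : 0 < s := ENNReal.coe_pos.1 (bot_le.trans_lt hs1)
  suffices Measure.hausdorffMeasure ((s / t : ℝ≥0) : ℝ) (range g) = 0 by
    have h1 := dimH_le_of_hausdorffMeasure_ne_top (s := range g) (this ▸ ENNReal.zero_ne_top)
    calc t * dimH (range g) ≤ t * (s / t : ℝ≥0) := by gcongr
      _ = s := by rw [← ENNReal.coe_mul, mul_div_cancel₀ _ ht.ne']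
      _ ≤ c := hs2.le
  have hη (j : ℕ) : (0 : ℝ≥0∞) < ((j : ℝ≥0∞) + 1)⁻¹ := by simp
  choose U ρ hU hρ hρη hball hsum using fun j : ℕ =>
    exists_ball_cover_of_hausdorffMeasure_eq_zero (NNReal.coe_pos.2 hs) h0 (hη j)
  choose ℓ hℓ hcard using fun j n => hN (ρ j n) (hρ j n)
  have hlim : Tendsto (fun j : ℕ => ((j : ℝ≥0∞) + 1)⁻¹) atTop (𝓝 0) := by
    have := (tendsto_add_atTop_iff_nat 1).2 ENNReal.tendsto_inv_nat_nhds_zero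
    simpa using this
  let V : ℕ → ℕ × L → Set Z := fun j p => g '' (f ⁻¹' U j p.1 ∩ ℓ j p.1 ⁻¹' {p.2})
  have hdiam (j : ℕ) (p : ℕ × L) :
      ediam (V j p) ≤ ENNReal.ofReal (ρ j p.1) ^ (t : ℝ) := by
    refine ediam_le ?_
    rintro _ ⟨ω, ⟨-, hω⟩, rfl⟩ _ ⟨τ, ⟨-, hτ⟩, rfl⟩
    rw [ENNReal.ofReal_rpow_of_pos (hρ j p.1).1, edist_dist]
    exact ENNReal.ofReal_le_ofReal
      (hℓ j p.1 ω τ ((mem_singleton_iff.1 hω).trans (mem_singleton_iff.1 hτ).symm))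
  have hst : (0 : ℝ) < ((s / t : ℝ≥0) : ℝ) := NNReal.coe_pos.2 (div_pos hs ht)
  have hV (j : ℕ) : ∑' p, ediam (V j p) ^ ((s / t : ℝ≥0) : ℝ) ≤ N * ((j : ℝ≥0∞) + 1)⁻¹ := by
    rw [ENNReal.tsum_prod']
    calc ∑' n, ∑' l, ediam (V j (n, l)) ^ ((s / t : ℝ≥0) : ℝ)
        ≤ ∑' n, N * ENNReal.ofReal (ρ j n) ^ (s : ℝ) := by
          refine ENNReal.tsum_le_tsum fun n => tsum_le_of_card_le (fun S hS => ?_) fun l => ?_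
          · rcases (U j n).eq_empty_or_nonempty with h0 | ⟨y, hy⟩
            · have : S = ∅ := Finset.eq_empty_of_forall_notMem fun l hl => hS l hl (by
                simpa [V, h0] using hst)
              simp [this]
            · refine hcard j n y S fun l hl => ?_
              by_contra hne
              push Not at hne
              refine hS l hl ?_
              have : V j (n, l) = ∅ := by
                simp only [V, image_eq_empty]
                refine eq_empty_of_forall_notMem fun ω hω => ?_
                exact hne ω hω.2 (hball j n y hy hω.1)
              simpa [this] using hst
          · calc ediam (V j (n, l)) ^ ((s / t : ℝ≥0) : ℝ)
                ≤ (ENNReal.ofReal (ρ j n) ^ (t : ℝ)) ^ ((s / t : ℝ≥0) : ℝ) :=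
                  ENNReal.rpow_le_rpow (hdiam j (n, l)) hst.le
              _ = ENNReal.ofReal (ρ j n) ^ (s : ℝ) := by
                  rw [← ENNReal.rpow_mul, ← NNReal.coe_mul, mul_div_cancel₀ _ ht.ne']
      _ = N * ∑' n, ENNReal.ofReal (ρ j n) ^ (s : ℝ) := ENNReal.tsum_mul_left
      _ ≤ N * ((j : ℝ≥0∞) + 1)⁻¹ := by gcongr; exact hsum j
  refine le_antisymm ?_ bot_le
  refine (Measure.hausdorffMeasure_le_liminf_tsum (l := atTop) _ _
    (fun j : ℕ => ((j : ℝ≥0∞) + 1)⁻¹ ^ (t : ℝ)) ?_ V ?_ ?_).trans ?_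
  · have := (ENNReal.continuous_rpow_const (y := (t : ℝ))).tendsto 0
    rw [ENNReal.zero_rpow_of_pos (NNReal.coe_pos.2 ht)] at this
    exact this.comp hlim
  · exact Eventually.of_forall fun j p =>
      (hdiam j p).trans (ENNReal.rpow_le_rpow (hρη j p.1) t.coe_nonneg)
  · refine Eventually.of_forall fun j => ?_
    rintro _ ⟨ω, rfl⟩
    obtain ⟨n, hn⟩ := mem_iUnion.1 (hU j ⟨ω, rfl⟩)
    exact mem_iUnion.2 ⟨(n, ℓ j n ω), ω, ⟨hn, rfl⟩, rfl⟩
  · refine (liminf_le_liminf (Eventually.of_forall hV)).trans_eq ?_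
    have : Tendsto (fun j : ℕ => (N : ℝ≥0∞) * ((j : ℝ≥0∞) + 1)⁻¹) atTop (𝓝 (N * 0)) :=
      ENNReal.Tendsto.const_mul hlim (Or.inr (ENNReal.natCast_ne_top N))
    rw [this.liminf_eq, mul_zero]

/-- The lower pointwise dimension computed along the dyadic radii `2⁻ᵏ` only. -/
noncomputable def dyadicPtDim {X : Type*} [PseudoMetricSpace X] [MeasurableSpace X]
    (μ : Measure X) (x : X) : ℝ≥0∞ :=
  liminf (fun k : ℕ => ENNReal.ofReal
    (Real.log (μ (ball x ((1/2 : ℝ) ^ k))).toReal / Real.log ((1/2 : ℝ) ^ k))) atTop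

theorem lowerPtDim_le_dyadicPtDim {X : Type*} [PseudoMetricSpace X] [MeasurableSpace X]
    (μ : Measure X) (x : X) : lowerPtDim μ x ≤ dyadicPtDim μ x := by
  have h : Tendsto (fun k : ℕ => (1/2 : ℝ) ^ k) atTop (𝓝[>] 0) :=
    tendsto_pow_atTop_nhdsWithin_zero_of_lt_one (by norm_num) (by norm_num)
  exact liminf_le_liminf_of_le h

theorem measurable_dyadicPtDim {X : Type*} [PseudoMetricSpace X] [SecondCountableTopology X]
    [MeasurableSpace X] [OpensMeasurableSpace X] (μ : Measure X) [SFinite μ] :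
    Measurable (dyadicPtDim μ) := by
  have hball (r : ℝ) : Measurable fun x => μ (ball x r) :=
    measurable_measure_prodMk_left
      (measurableSet_lt (measurable_snd.dist measurable_fst) measurable_const)
  exact Measurable.liminf fun k => ENNReal.measurable_ofReal.comp
    ((Real.measurable_log.comp (hball _).ennreal_toReal).div_const _)

theorem tendsto_dyadic_comparison (t c : ℝ) :
    Tendsto (fun k : ℕ => t * (k * Real.log 2 * c - 2 * Real.log (k + 2)) /
      ((k + 2) * Real.log 2)) atTop (𝓝 (t * c)) := by
  have h1 : Tendsto (fun k : ℕ => (k : ℝ) / (k + 2)) atTop (𝓝 1) :=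
    tendsto_natCast_div_add_atTop 2
  have h2 : Tendsto (fun k : ℕ => Real.log (k + 2) / ((k : ℝ) + 2)) atTop (𝓝 0) :=
    (Real.isLittleO_log_id_atTop.tendsto_div_nhds_zero).comp
      (tendsto_atTop_add_const_right _ 2 tendsto_natCast_atTop_atTop)
  have hl : Real.log 2 ≠ 0 := (Real.log_pos one_lt_two).ne'
  have h3 := ((h1.mul_const c).sub (h2.const_mul (2 / Real.log 2))).const_mul t
  simp only [one_mul, mul_zero, sub_zero] at h3
  refine h3.congr fun k => ?_
  have : (k : ℝ) + 2 ≠ 0 := by positivity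
  field_simp

theorem eventually_le_log_div_log {t : ℝ} (ht : 0 < t) {F : ℝ → ℝ} {G : ℕ → ℝ}
    (hmono : Monotone F) (hpos : ∀ ρ > 0, 0 < F ρ) (hF1 : ∀ ρ, F ρ ≤ 1)
    (hFG : ∀ᶠ k : ℕ in atTop, F ((1/2 : ℝ) ^ ((k + 1 : ℝ) / t)) ≤ (k + 2 : ℝ) ^ 2 * G k)
    {c : ℝ} (hc : ∀ᶠ k : ℕ in atTop, c < Real.log (G k) / Real.log ((1/2 : ℝ) ^ k))
    {c' : ℝ} (hc' : c' < t * c) :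
    ∀ᶠ ρ in 𝓝[>] (0:ℝ), c' ≤ Real.log (F ρ) / Real.log ρ := by
  have hl : 0 < Real.log 2 := Real.log_pos one_lt_two
  have hx : Tendsto (fun ρ : ℝ => t * (-Real.log ρ) / Real.log 2) (𝓝[>] 0) atTop :=
    ((tendsto_neg_atBot_atTop.comp Real.tendsto_log_nhdsGT_zero).const_mul_atTop ht).atTop_div_const
      hl
  have hκ : Tendsto (fun ρ : ℝ => ⌊t * (-Real.log ρ) / Real.log 2⌋₊ - 1) (𝓝[>] 0) atTop :=
    (tendsto_sub_atTop_nat 1).comp (tendsto_nat_floor_atTop.comp hx)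
  have hev := (hFG.and (hc.and ((tendsto_dyadic_comparison t c).eventually
    (lt_mem_nhds hc')))).and (eventually_ge_atTop 1)
  filter_upwards [hκ.eventually hev, hx.eventually_ge_atTop 1,
    Ioo_mem_nhdsGT (zero_lt_one' ℝ)] with ρ hρ hx1 hρ01
  obtain ⟨⟨h1, h2, h3⟩, hk1⟩ := hρ
  set x := t * (-Real.log ρ) / Real.log 2 with hxdef
  have hfl : 1 ≤ ⌊x⌋₊ := (Nat.one_le_floor_iff x).2 hx1
  obtain ⟨k, hk⟩ : ∃ k, ⌊x⌋₊ = k + 1 := ⟨⌊x⌋₊ - 1, by omega⟩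
  rw [hk, Nat.add_sub_cancel] at h1 h2 h3 hk1
  have hkx : (k : ℝ) + 1 ≤ x := by
    have := Nat.floor_le (zero_le_one.trans hx1)
    rw [hk] at this
    exact_mod_cast this
  have hxk : x < k + 2 := by
    have := Nat.lt_floor_add_one x
    rw [hk] at this
    push_cast at this
    linarith
  have hL : 0 < -Real.log ρ := neg_pos.2 (Real.log_neg hρ01.1 hρ01.2)
  have hxL : x * Real.log 2 = t * (-Real.log ρ) := div_mul_cancel₀ _ hl.ne'
  have hlogF : Real.log (F ρ) ≤ 0 := Real.log_nonpos (hpos ρ hρ01.1).le (hF1 ρ)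
  rw [← neg_div_neg_eq, le_div_iff₀ hL]
  rcases le_or_gt c' 0 with hneg | hposc
  · nlinarith
  have hr : ρ ≤ (1/2 : ℝ) ^ ((k + 1 : ℝ) / t) := by
    rw [← Real.log_le_log_iff hρ01.1 (by positivity), Real.log_rpow (by norm_num), one_div,
      Real.log_inv, div_mul_eq_mul_div, le_div_iff₀ ht]
    nlinarith
  have hGpos : 0 < G k := by
    have := (hpos _ (by positivity : (0:ℝ) < (1/2 : ℝ) ^ ((k + 1 : ℝ) / t))).trans_le h1
    exact pos_of_mul_pos_right this (by positivity)
  have hFlog : Real.log (F ρ) ≤ 2 * Real.log (k + 2) + Real.log (G k) := by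
    have hk2 : (k : ℝ) + 2 ≠ 0 := by positivity
    have := Real.log_le_log (hpos ρ hρ01.1) ((hmono hr).trans h1)
    rwa [Real.log_mul (by positivity) hGpos.ne', Real.log_pow, Nat.cast_ofNat] at this
  have hk0 : (1 : ℝ) ≤ k := by exact_mod_cast hk1
  have hGlog : Real.log (G k) < -(k * Real.log 2 * c) := by
    rw [one_div, inv_pow, Real.log_inv, Real.log_pow, lt_div_iff_of_neg (by nlinarith)] at h2
    linarith
  rw [lt_div_iff₀ (by positivity)] at h3
  have h4 : c' * (t * (-Real.log ρ)) ≤ c' * ((k + 2) * Real.log 2) := by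
    rw [← hxL]
    gcongr
  have h5 : t * (c' * -Real.log ρ) ≤ t * (-Real.log (F ρ)) := by
    have : t * (k * Real.log 2 * c - 2 * Real.log (k + 2)) ≤ t * (-Real.log (F ρ)) := by
      gcongr
      linarith
    linarith
  exact le_of_mul_le_mul_left h5 ht

theorem ScaleComparison.ae_eventually_measure_le {Ω Y Z L : Type*} [PseudoMetricSpace Y]
    [MeasurableSpace Y] [OpensMeasurableSpace Y] [PseudoMetricSpace Z] [Countable L]
    [MeasurableSpace Ω] (μ : Measure Ω) [IsFiniteMeasure μ] {f : Ω → Y} {g : Ω → Z}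
    (hf : Measurable f) {t : ℝ} (ht : 0 < t) (h : ScaleComparison L f g t) :
    ∀ᵐ ω ∂μ, ∀ᶠ k : ℕ in atTop,
      ENNReal.ofReal (((k + 2 : ℝ) ^ 2)⁻¹) *
        μ (f ⁻¹' ball (f ω) ((1/2 : ℝ) ^ ((k + 1 : ℝ) / t))) ≤
      μ (g ⁻¹' ball (g ω) ((1/2 : ℝ) ^ k)) := by
  obtain ⟨N, hN⟩ := h
  set r : ℕ → ℝ := fun k => (1/2 : ℝ) ^ ((k + 1 : ℝ) / t) with hr
  have hr01 (k : ℕ) : r k ∈ Ioo (0:ℝ) 1 :=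
    ⟨by positivity, Real.rpow_lt_one (by norm_num) (by norm_num) (by positivity)⟩
  have hrt (k : ℕ) : r k ^ t < (1/2 : ℝ) ^ k := by
    have h1 : r k ^ t = (1/2 : ℝ) ^ (k + 1) := by
      rw [hr, ← Real.rpow_mul (by norm_num), div_mul_cancel₀ _ ht.ne']
      exact_mod_cast Real.rpow_natCast (1/2 : ℝ) (k + 1)
    rw [h1]
    exact pow_lt_pow_right_of_lt_one₀ (by norm_num) (by norm_num) k.lt_succ_self
  choose ℓ hℓ hcard using fun k => hN (r k) (hr01 k)
  set ε : ℕ → ℝ≥0∞ := fun k => ENNReal.ofReal (((k + 2 : ℝ) ^ 2)⁻¹) with hε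
  let bad : ℕ → Set Ω := fun k =>
    {ω | μ (ℓ k ⁻¹' {ℓ k ω}) ≤ ε k * μ (f ⁻¹' ball (f ω) (r k))}
  have hbad (k : ℕ) : μ (bad k) ≤ ε k * (N * μ univ) := by
    let Q : L → Set Ω := fun l =>
      if h : ∃ ω ∈ bad k, ℓ k ω = l then f ⁻¹' ball (f h.choose) (r k) else ∅
    have hQ (l : L) : MeasurableSet (Q l) := by
      by_cases h : ∃ ω ∈ bad k, ℓ k ω = l
      · simp only [Q, dif_pos h]
        exact hf measurableSet_ball
      · simp only [Q, dif_neg h]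
        exact MeasurableSet.empty
    have hsub : bad k ⊆ ⋃ l, bad k ∩ ℓ k ⁻¹' {l} := fun ω hω =>
      mem_iUnion.2 ⟨ℓ k ω, hω, rfl⟩
    have hle (l : L) : μ (bad k ∩ ℓ k ⁻¹' {l}) ≤ ε k * μ (Q l) := by
      by_cases h : ∃ ω ∈ bad k, ℓ k ω = l
      · simp only [Q, dif_pos h]
        obtain ⟨h1, h2⟩ := h.choose_spec
        refine (measure_mono inter_subset_right).trans ?_
        have h3 : μ (ℓ k ⁻¹' {ℓ k h.choose}) ≤ _ := h1
        rwa [h2] at h3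
      · have : bad k ∩ ℓ k ⁻¹' {l} = ∅ :=
          eq_empty_of_forall_notMem fun ω hω => h ⟨ω, hω.1, hω.2⟩
        simp [this]
    calc μ (bad k) ≤ ∑' l, μ (bad k ∩ ℓ k ⁻¹' {l}) :=
          (measure_mono hsub).trans (measure_iUnion_le _)
      _ ≤ ∑' l, ε k * μ (Q l) := ENNReal.tsum_le_tsum hle
      _ = ε k * ∑' l, μ (Q l) := ENNReal.tsum_mul_left
      _ ≤ ε k * (N * μ univ) := by
        gcongr
        refine tsum_measure_le_of_card_le μ hQ fun x S hS => hcard k (f x) S fun l hl => ?_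
        have hx := hS l hl
        by_cases h : ∃ ω ∈ bad k, ℓ k ω = l
        · simp only [Q, dif_pos h] at hx
          exact ⟨h.choose, h.choose_spec.2, mem_ball_comm.1 hx⟩
        · simp [Q, dif_neg h] at hx
  have hsum : ∑' k, μ (bad k) ≠ ∞ := by
    refine ne_top_of_le_ne_top ?_ (ENNReal.tsum_le_tsum hbad)
    rw [ENNReal.tsum_mul_right]
    refine ENNReal.mul_ne_top (Summable.tsum_ofReal_ne_top ?_)
      (ENNReal.mul_ne_top (ENNReal.natCast_ne_top N) (measure_ne_top μ _))
    have := (summable_nat_add_iff 2).2 (Real.summable_nat_pow_inv.2 one_lt_two)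
    simpa using this
  filter_upwards [ae_eventually_notMem hsum] with ω hω
  filter_upwards [hω] with k hk
  refine (not_le.1 hk).le.trans (measure_mono fun τ hτ => ?_)
  exact (hℓ k τ ω hτ).trans_lt (hrt k)

theorem ScaleComparison.ae_mul_dyadicPtDim_le {Ω Y Z L : Type*} [PseudoMetricSpace Y]
    [SecondCountableTopology Y] [MeasurableSpace Y] [OpensMeasurableSpace Y]
    [PseudoMetricSpace Z] [MeasurableSpace Z] [OpensMeasurableSpace Z] [Countable L]
    [MeasurableSpace Ω] (μ : Measure Ω) [IsProbabilityMeasure μ] {f : Ω → Y} {g : Ω → Z}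
    (hf : Measurable f) (hg : Measurable g) {t : ℝ≥0} (ht : 0 < t)
    (h : ScaleComparison L f g t) :
    ∀ᵐ ω ∂μ, t * dyadicPtDim (μ.map g) (g ω) ≤ lowerPtDim (μ.map f) (f ω) := by
  have ht' : (0 : ℝ) < t := NNReal.coe_pos.2 ht
  have : IsProbabilityMeasure (μ.map f) := Measure.isProbabilityMeasure_map hf.aemeasurable
  have : IsProbabilityMeasure (μ.map g) := Measure.isProbabilityMeasure_map hg.aemeasurable
  filter_upwards [h.ae_eventually_measure_le μ hf ht',
    ae_of_ae_map hf.aemeasurable (Measure.support_mem_ae (μ := μ.map f))] with ω hω hsupp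
  rw [dyadicPtDim, lowerPtDim]
  set D := liminf (fun k : ℕ => ENNReal.ofReal
    (Real.log (μ.map g (ball (g ω) ((1/2 : ℝ) ^ k))).toReal / Real.log ((1/2 : ℝ) ^ k))) atTop
    with hD
  rcases eq_or_ne D 0 with h0 | h0
  · simp [h0]
  have hpos (ρ : ℝ) (hρ : ρ > 0) : 0 < (μ.map f (ball (f ω) ρ)).toReal :=
    ENNReal.toReal_pos ((Measure.mem_support_iff_forall _).1 hsupp _ (ball_mem_nhds _ hρ)).ne'
      (measure_ne_top _ _)
  have key (c : ℝ≥0) (hc : (c : ℝ≥0∞) < D) (c' : ℝ) (hc' : c' < t * c) :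
      ENNReal.ofReal c' ≤ liminf (fun ρ : ℝ => ENNReal.ofReal
        (Real.log (μ.map f (ball (f ω) ρ)).toReal / Real.log ρ)) (𝓝[>] 0) := by
    refine le_liminf_of_le (by isBoundedDefault) ?_
    refine (eventually_le_log_div_log ht'
      (F := fun ρ => (μ.map f (ball (f ω) ρ)).toReal)
      (G := fun k => (μ.map g (ball (g ω) ((1/2 : ℝ) ^ k))).toReal)
      (fun a b hab => ?_) hpos (fun ρ => ?_) ?_ (c := c) ?_ hc').mono
      fun ρ hρ => ENNReal.ofReal_le_ofReal hρ
    · exact ENNReal.toReal_mono (measure_ne_top _ _) (measure_mono (ball_subset_ball hab))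
    · exact measureReal_le_one
    · filter_upwards [hω] with k hk
      rw [← Measure.map_apply hf measurableSet_ball, ← Measure.map_apply hg measurableSet_ball] at hk
      have := ENNReal.toReal_mono (measure_ne_top _ _) hk
      rw [ENNReal.toReal_mul, ENNReal.toReal_ofReal (by positivity),
        inv_mul_le_iff₀ (by positivity)] at this
      exact this
    · filter_upwards [eventually_lt_of_lt_liminf hc] with k hk
      by_contra! hle
      exact hk.not_ge ((ENNReal.ofReal_le_ofReal hle).trans_eq (ENNReal.ofReal_coe_nnreal))
  have key2 (c : ℝ≥0) (hc : (c : ℝ≥0∞) < D) : (t : ℝ≥0∞) * c ≤ liminf (fun ρ : ℝ =>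
      ENNReal.ofReal (Real.log (μ.map f (ball (f ω) ρ)).toReal / Real.log ρ)) (𝓝[>] 0) := by
    refine le_of_forall_lt_imp_le_of_dense fun a ha => ?_
    lift a to ℝ≥0 using (ha.trans_le le_top).ne
    rw [← ENNReal.ofReal_coe_nnreal]
    exact key c hc a (by exact_mod_cast ha)
  have ht0 : (t : ℝ≥0∞) ≠ 0 := by exact_mod_cast ht.ne'
  rw [mul_comm, ← ENNReal.le_div_iff_mul_le (Or.inl ht0) (Or.inl ENNReal.coe_ne_top)]
  refine le_of_forall_lt_imp_le_of_dense fun a ha => ?_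
  lift a to ℝ≥0 using (ha.trans_le le_top).ne
  rw [ENNReal.le_div_iff_mul_le (Or.inl ht0) (Or.inl ENNReal.coe_ne_top), mul_comm]
  exact key2 a ha

theorem ScaleComparison.mul_measDim_map_le {Ω Y Z L : Type*} [PseudoMetricSpace Y]
    [SecondCountableTopology Y] [MeasurableSpace Y] [OpensMeasurableSpace Y]
    [PseudoMetricSpace Z] [SecondCountableTopology Z] [MeasurableSpace Z]
    [OpensMeasurableSpace Z] [Countable L]
    [MeasurableSpace Ω] (μ : Measure Ω) [IsProbabilityMeasure μ] {f : Ω → Y} {g : Ω → Z}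
    (hf : Measurable f) (hg : Measurable g) {t : ℝ≥0} (ht : 0 < t)
    (h : ScaleComparison L f g t) :
    t * measDim (μ.map g) ≤ measDim (μ.map f) := by
  have ht0 : (t : ℝ≥0∞) ≠ 0 := by exact_mod_cast ht.ne'
  have : IsProbabilityMeasure (μ.map g) := Measure.isProbabilityMeasure_map hg.aemeasurable
  rw [mul_comm, ← ENNReal.le_div_iff_mul_le (Or.inl ht0) (Or.inl ENNReal.coe_ne_top)]
  refine essSup_le_of_ae_le _ ?_
  have h1 : ∀ᵐ z ∂μ.map g, dyadicPtDim (μ.map g) z ≤ measDim (μ.map f) / t := by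
    rw [ae_map_iff hg.aemeasurable
      (measurableSet_le (measurable_dyadicPtDim _) measurable_const)]
    filter_upwards [h.ae_mul_dyadicPtDim_le μ hf hg ht,
      ae_of_ae_map hf.aemeasurable (ENNReal.ae_le_essSup (lowerPtDim (μ.map f)))] with ω h1 h2
    rw [ENNReal.le_div_iff_mul_le (Or.inl ht0) (Or.inl ENNReal.coe_ne_top), mul_comm]
    exact h1.trans h2
  filter_upwards [h1] with z hz using (lowerPtDim_le_dyadicPtDim _ z).trans hz

section OneDimensional

variable {B : Type*} {s o : B → ℝ}

/-- A family of contracting similarities `x ↦ s b * x + o b` of `[0,1]`. -/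
structure IsContractingSystem (s o : B → ℝ) : Prop where
  ne_zero : ∀ b, s b ≠ 0
  abs_lt_one : ∀ b, |s b| < 1
  maps : ∀ b, ∀ x ∈ Icc (0:ℝ) 1, s b * x + o b ∈ Icc (0:ℝ) 1

/-- The composition of the similarities along a finite word. -/
def wordMap (s o : B → ℝ) : List B → ℝ → ℝ
  | [], x => x
  | b :: w, x => s b * wordMap s o w x + o b

/-- The contraction ratio of `wordMap s o w`. -/
def wordRatio (s : B → ℝ) (w : List B) : ℝ := (w.map fun b => |s b|).prod

/-- The word formed by the first `n` letters of a sequence. -/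
def prefixWord (n : ℕ) (x : ℕ → B) : List B := (List.range n).map x

/-- The point coded by a sequence of letters. -/
noncomputable def seqPoint (s o : B → ℝ) (x : ℕ → B) : ℝ :=
  ∑' n : ℕ, (∏ k ∈ Finset.range n, s (x k)) * o (x n)

/-- A word is stopped at scale `ρ` if its ratio is at most `ρ` while all its proper prefixes have
ratio larger than `ρ`. -/
def IsStopped (s : B → ℝ) (ρ : ℝ) (w : List B) : Prop :=
  wordRatio s w ≤ ρ ∧ ∀ u, u <+: w → u ≠ w → ρ < wordRatio s u

theorem wordRatio_append (u v : List B) :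
    wordRatio s (u ++ v) = wordRatio s u * wordRatio s v := by
  simp [wordRatio]

theorem wordRatio_cons (b : B) (v : List B) :
    wordRatio s (b :: v) = |s b| * wordRatio s v := by
  simp [wordRatio]

theorem wordRatio_nonneg (w : List B) : 0 ≤ wordRatio s w := by
  induction w with
  | nil => simp [wordRatio]
  | cons b w ih => rw [wordRatio_cons]; positivity

theorem wordRatio_le_rpow {s' : B → ℝ} {t : ℝ} (h : ∀ b, |s' b| ≤ |s b| ^ t) (w : List B) :
    wordRatio s' w ≤ wordRatio s w ^ t := by
  induction w with
  | nil => simp [wordRatio]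
  | cons b w ih =>
    rw [wordRatio_cons, wordRatio_cons, Real.mul_rpow (abs_nonneg _) (wordRatio_nonneg w)]
    exact mul_le_mul (h b) ih (wordRatio_nonneg w) (by positivity)

theorem length_prefixWord (n : ℕ) (x : ℕ → B) : (prefixWord n x).length = n := by
  simp [prefixWord]

theorem prefixWord_zero (x : ℕ → B) : prefixWord 0 x = [] := rfl

theorem prefixWord_succ (n : ℕ) (x : ℕ → B) :
    prefixWord (n + 1) x = prefixWord n x ++ [x n] := by
  simp [prefixWord, List.range_succ]

theorem prefixWord_succ' (n : ℕ) (x : ℕ → B) :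
    prefixWord (n + 1) x = x 0 :: prefixWord n (fun k => x (k + 1)) := by
  simp [prefixWord, List.range_succ_eq_map, Function.comp_def]

theorem eq_prefixWord_of_prefix {n : ℕ} {x : ℕ → B} {u : List B} (h : u <+: prefixWord n x) :
    ∃ k ≤ n, u = prefixWord k x := by
  have hlen := h.length_le
  rw [length_prefixWord] at hlen
  refine ⟨u.length, hlen, ?_⟩
  have := List.prefix_iff_eq_take.1 h
  rwa [prefixWord, ← List.map_take, List.take_range, min_eq_left hlen] at this

theorem wordMap_sub (w : List B) (x y : ℝ) :
    |wordMap s o w x - wordMap s o w y| = wordRatio s w * |x - y| := by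
  induction w with
  | nil => simp [wordMap, wordRatio]
  | cons b w ih =>
    rw [wordRatio_cons, mul_assoc, ← ih, ← abs_mul, wordMap, wordMap]
    congr 1
    ring

theorem exists_wordMap_eq (w : List B) :
    ∃ σ c : ℝ, |σ| = wordRatio s w ∧ ∀ x, wordMap s o w x = σ * x + c := by
  induction w with
  | nil => exact ⟨1, 0, by simp [wordRatio], fun x => by simp [wordMap]⟩
  | cons b w ih =>
    obtain ⟨σ, c, h1, h2⟩ := ih
    refine ⟨s b * σ, s b * c + o b, by rw [abs_mul, h1, wordRatio_cons], fun x => ?_⟩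
    rw [wordMap, h2]
    ring

open scoped Pointwise in
theorem volume_wordMap_image (w : List B) :
    volume (wordMap s o w '' Ioo 0 1) = ENNReal.ofReal (wordRatio s w) := by
  obtain ⟨σ, c, h1, h2⟩ := exists_wordMap_eq (s := s) (o := o) w
  have : wordMap s o w '' Ioo 0 1 = (fun y => y + c) '' (σ • Ioo (0:ℝ) 1) := by
    rw [← image_smul, image_image]
    exact image_congr fun x _ => by simp [h2]
  rw [this, image_add_right, measure_preimage_add_right, Measure.addHaar_smul]
  simp [h1]

theorem IsStopped.mul_le_wordRatio {m ρ : ℝ} (hρ : ρ < 1)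
    (hm : 0 ≤ m) (hs : ∀ b, m ≤ |s b|) {w : List B} (hw : IsStopped s ρ w) :
    m * ρ ≤ wordRatio s w := by
  rcases List.eq_nil_or_concat w with rfl | ⟨u, b, rfl⟩
  · exact absurd hw.1 (by simpa [wordRatio] using hρ)
  · have := hw.2 u (by simp) (by simp)
    rw [List.concat_eq_append, wordRatio_append, mul_comm]
    refine mul_le_mul this.le ?_ hm (wordRatio_nonneg u)
    simpa [wordRatio] using hs b

namespace IsContractingSystem

theorem off_mem (h : IsContractingSystem s o) (b : B) : o b ∈ Icc (0:ℝ) 1 := by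
  simpa using h.maps b 0 (by simp)

theorem wordRatio_pos (h : IsContractingSystem s o) (w : List B) : 0 < wordRatio s w := by
  induction w with
  | nil => simp [wordRatio]
  | cons b w ih => rw [wordRatio_cons]; exact mul_pos (abs_pos.2 (h.ne_zero b)) ih

theorem maps_Ioo (h : IsContractingSystem s o)
    (b : B) {x : ℝ} (hx : x ∈ Ioo (0:ℝ) 1) : s b * x + o b ∈ Ioo (0:ℝ) 1 := by
  have h0 := h.off_mem b
  have h1 := h.maps b 1 (by simp)
  obtain ⟨hx0, hx1⟩ := hx
  simp only [mem_Icc, mul_one] at h0 h1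
  rcases (h.ne_zero b).lt_or_gt with hs | hs
  · constructor <;> nlinarith [mul_pos_of_neg_of_neg hs (sub_neg.2 hx1)]
  · constructor <;> nlinarith [mul_pos hs hx0, mul_pos hs (sub_pos.2 hx1)]

theorem wordMap_mem_Ioo (h : IsContractingSystem s o) (w : List B) {x : ℝ} (hx : x ∈ Ioo (0:ℝ) 1) :
    wordMap s o w x ∈ Ioo (0:ℝ) 1 := by
  induction w with
  | nil => exact hx
  | cons b w ih => exact h.maps_Ioo b ih

theorem injective_wordMap (h : IsContractingSystem s o)
    (w : List B) : Function.Injective (wordMap s o w) := by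
  intro x y hxy
  have := wordMap_sub (s := s) (o := o) w x y
  rw [hxy, sub_self, abs_zero, eq_comm, mul_eq_zero] at this
  exact sub_eq_zero.1 (abs_eq_zero.1 (this.resolve_left (h.wordRatio_pos w).ne'))

theorem disjoint_wordMap_image (h : IsContractingSystem s o)
    (hdisj : ∀ a b : B, a ≠ b →
      Disjoint ((fun x => s a * x + o a) '' Ioo 0 1) ((fun x => s b * x + o b) '' Ioo 0 1))
    {u v : List B} (huv : ¬ u <+: v) (hvu : ¬ v <+: u) :
    Disjoint (wordMap s o u '' Ioo 0 1) (wordMap s o v '' Ioo 0 1) := by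
  induction u generalizing v with
  | nil => exact absurd List.nil_prefix huv
  | cons a u ih =>
    cases v with
    | nil => exact absurd List.nil_prefix hvu
    | cons b v =>
      have himage (c : B) (w : List B) :
          wordMap s o (c :: w) '' Ioo 0 1 =
            (fun x => s c * x + o c) '' (wordMap s o w '' Ioo 0 1) := by
        rw [image_image]; rfl
      rw [himage, himage]
      by_cases hab : a = b
      · subst hab
        rw [List.prefix_cons_inj] at huv hvu
        exact (disjoint_image_iff (h.injective_wordMap [a])).2 (ih huv hvu)
      · refine (hdisj a b hab).mono (image_mono ?_) (image_mono ?_) <;>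
        · rintro _ ⟨x, hx, rfl⟩
          exact h.wordMap_mem_Ioo _ hx

theorem exists_ratio_bounds (h : IsContractingSystem s o) [Finite B] :
    ∃ m M : ℝ, 0 < m ∧ 0 ≤ M ∧ M < 1 ∧ ∀ b, m ≤ |s b| ∧ |s b| ≤ M := by
  rcases isEmpty_or_nonempty B with hB | hB
  · exact ⟨1, 0, one_pos, le_rfl, one_pos, fun b => hB.elim b⟩
  · obtain ⟨a, ha⟩ := Finite.exists_min fun b => |s b|
    obtain ⟨c, hc⟩ := Finite.exists_max fun b => |s b|
    exact ⟨|s a|, |s c|, abs_pos.2 (h.ne_zero a), abs_nonneg _, h.abs_lt_one c,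
      fun b => ⟨ha b, hc b⟩⟩

theorem summable (h : IsContractingSystem s o) [Finite B] (x : ℕ → B) :
    Summable fun n : ℕ => (∏ k ∈ Finset.range n, s (x k)) * o (x n) := by
  obtain ⟨m, M, -, hM0, hM1, hM⟩ := h.exists_ratio_bounds
  refine Summable.of_norm_bounded (summable_geometric_of_lt_one hM0 hM1) fun n => ?_
  rw [norm_mul, ← mul_one (M ^ n)]
  refine mul_le_mul ?_ ?_ (norm_nonneg _) (by positivity)
  · rw [Real.norm_eq_abs, Finset.abs_prod]
    calc ∏ k ∈ Finset.range n, |s (x k)| ≤ ∏ _k ∈ Finset.range n, M :=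
          Finset.prod_le_prod (fun _ _ => abs_nonneg _) fun k _ => (hM (x k)).2
      _ = M ^ n := by simp
  · rw [Real.norm_eq_abs, abs_of_nonneg (h.off_mem _).1]
    exact (h.off_mem _).2

theorem seqPoint_eq (h : IsContractingSystem s o) [Finite B] (x : ℕ → B) :
    seqPoint s o x = s (x 0) * seqPoint s o (fun n => x (n + 1)) + o (x 0) := by
  rw [seqPoint, (h.summable x).tsum_eq_zero_add, add_comm]
  congr 1
  · rw [seqPoint, ← tsum_mul_left]
    refine tsum_congr fun n => ?_
    rw [Finset.prod_range_succ']
    ring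
  · simp

theorem seqPoint_mem (h : IsContractingSystem s o)
    [Finite B] (x : ℕ → B) : seqPoint s o x ∈ Icc (0:ℝ) 1 := by
  refine isClosed_Icc.mem_of_tendsto (h.summable x).hasSum.tendsto_sum_nat
    (Eventually.of_forall fun n => ?_)
  induction n generalizing x with
  | zero => simp
  | succ n ih =>
    have := h.maps (x 0) _ (ih fun k => x (k + 1))
    rw [Finset.sum_range_succ']
    convert this using 1
    rw [Finset.mul_sum]
    congr 1
    · refine Finset.sum_congr rfl fun k _ => ?_
      rw [Finset.prod_range_succ']
      ring
    · simp

theorem seqPoint_eq_wordMap (h : IsContractingSystem s o) [Finite B] (n : ℕ) (x : ℕ → B) :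
    seqPoint s o x = wordMap s o (prefixWord n x) (seqPoint s o fun k => x (k + n)) := by
  induction n generalizing x with
  | zero => simp [prefixWord_zero, wordMap]
  | succ n ih =>
    rw [prefixWord_succ', wordMap, h.seqPoint_eq, ih]
    rfl

theorem abs_seqPoint_sub_le (h : IsContractingSystem s o) [Finite B] {n : ℕ} {x y : ℕ → B}
    (hxy : prefixWord n x = prefixWord n y) :
    |seqPoint s o x - seqPoint s o y| ≤ wordRatio s (prefixWord n x) := by
  rw [h.seqPoint_eq_wordMap n x, h.seqPoint_eq_wordMap n y, ← hxy, wordMap_sub]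
  refine mul_le_of_le_one_right (wordRatio_nonneg _) ?_
  have h1 := h.seqPoint_mem fun k => x (k + n)
  have h2 := h.seqPoint_mem fun k => y (k + n)
  exact abs_sub_le_iff.2 ⟨by linarith [h1.2, h2.1], by linarith [h1.1, h2.2]⟩

theorem exists_isStopped (h : IsContractingSystem s o) [Finite B] {ρ : ℝ} (hρ : 0 < ρ) (x : ℕ → B) :
    ∃ n, IsStopped s ρ (prefixWord n x) := by
  obtain ⟨m, M, -, hM0, hM1, hM⟩ := h.exists_ratio_bounds
  have hle (n : ℕ) : wordRatio s (prefixWord n x) ≤ M ^ n := by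
    induction n with
    | zero => simp [prefixWord_zero, wordRatio]
    | succ n ih =>
      rw [prefixWord_succ, wordRatio_append, pow_succ]
      refine mul_le_mul ih ?_ (wordRatio_nonneg _) (by positivity)
      simpa [wordRatio] using (hM (x n)).2
  obtain ⟨n, hn⟩ := exists_pow_lt_of_lt_one hρ hM1
  have hex : ∃ n, wordRatio s (prefixWord n x) ≤ ρ := ⟨n, (hle n).trans hn.le⟩
  refine ⟨Nat.find hex, Nat.find_spec hex, fun u hu hne => ?_⟩
  obtain ⟨k, hk, rfl⟩ := eq_prefixWord_of_prefix hu
  exact not_le.1 (Nat.find_min hex (hk.lt_of_ne fun hk' => hne (by rw [hk'])))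

theorem exists_card_isStopped_le (h : IsContractingSystem s o) [Finite B]
    (hdisj : ∀ a b : B, a ≠ b →
      Disjoint ((fun x => s a * x + o a) '' Ioo 0 1) ((fun x => s b * x + o b) '' Ioo 0 1)) :
    ∃ N : ℕ, ∀ ρ ∈ Ioo (0:ℝ) 1, ∀ (y : ℝ) (S : Finset (List B)),
      (∀ w ∈ S, IsStopped s ρ w ∧ ∃ z ∈ Icc (0:ℝ) 1, wordMap s o w z ∈ ball y ρ) →
        S.card ≤ N := by
  obtain ⟨m, M, hm0, -, -, hm⟩ := h.exists_ratio_bounds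
  refine ⟨⌊4 / m⌋₊, fun ρ hρ y S hS => Nat.le_floor ?_⟩
  have hpair : (S : Set (List B)).PairwiseDisjoint fun w => wordMap s o w '' Ioo 0 1 := by
    intro u hu v hv huv
    refine h.disjoint_wordMap_image hdisj (fun hp => ?_) (fun hp => ?_)
    · exact ((hS v hv).1.2 u hp huv).not_ge (hS u hu).1.1
    · exact ((hS u hu).1.2 v hp huv.symm).not_ge (hS v hv).1.1
  have hmeas (w : List B) : MeasurableSet (wordMap s o w '' Ioo 0 1) := by
    obtain ⟨σ, c, -, h2⟩ := exists_wordMap_eq (s := s) (o := o) w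
    refine measurableSet_Ioo.image_of_continuousOn_injOn (Continuous.continuousOn ?_)
      (h.injective_wordMap w).injOn
    rw [funext h2]
    fun_prop
  have hsub : ⋃ w ∈ S, wordMap s o w '' Ioo 0 1 ⊆ Icc (y - 2 * ρ) (y + 2 * ρ) := by
    refine iUnion₂_subset fun w hw => ?_
    rintro _ ⟨x, hx, rfl⟩
    obtain ⟨hst, z, hz, hzy⟩ := hS w hw
    have h1 : |wordMap s o w x - wordMap s o w z| ≤ ρ := by
      rw [wordMap_sub]
      refine (mul_le_of_le_one_right (wordRatio_nonneg _) ?_).trans hst.1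
      exact abs_sub_le_iff.2 ⟨by linarith [hx.2, hz.1], by linarith [hx.1, hz.2]⟩
    rw [mem_ball, Real.dist_eq] at hzy
    rw [abs_le] at h1
    rw [abs_lt] at hzy
    constructor <;> linarith
  have hvol := measure_mono (μ := volume) hsub
  rw [measure_biUnion_finset hpair fun w _ => hmeas w, Real.volume_Icc] at hvol
  simp_rw [volume_wordMap_image] at hvol
  rw [← ENNReal.ofReal_sum_of_nonneg fun w _ => wordRatio_nonneg w,
    ENNReal.ofReal_le_ofReal_iff (by linarith [hρ.1])] at hvol
  have hlow : S.card • (m * ρ) ≤ ∑ w ∈ S, wordRatio s w :=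
    Finset.card_nsmul_le_sum _ _ _ fun w hw =>
      (hS w hw).1.mul_le_wordRatio hρ.2 hm0.le fun b => (hm b).1
  rw [nsmul_eq_mul] at hlow
  rw [le_div_iff₀ hm0]
  refine le_of_mul_le_mul_right ?_ hρ.1
  linarith

end IsContractingSystem

end OneDimensional

namespace DiagIFS

variable {Φ : DiagIFS d A}

theorem Valid.isContractingSystem (h : Φ.Valid) (i : Fin d) :
    IsContractingSystem (Φ.slope i) (Φ.off i) :=
  ⟨h.2.1 i, h.2.2.1 i, h.2.2.2 i⟩

theorem Valid.measurable_coding (h : Φ.Valid) : Measurable Φ.coding := by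
  refine measurable_pi_iff.2 fun i => ?_
  have hcoord (g : A i → ℝ) (k : ℕ) : Measurable fun ω : ℕ → Φ.Symb => g ((ω k).1 i) :=
    (measurable_from_top (f := fun a : Φ.Symb => g (a.1 i))).comp (measurable_pi_apply k)
  have hpartial (n : ℕ) : Measurable fun ω : ℕ → Φ.Symb => ∑ m ∈ Finset.range n,
      (∏ k ∈ Finset.range m, Φ.slope i ((ω k).1 i)) * Φ.off i ((ω m).1 i) := by
    refine Finset.measurable_fun_sum _ fun m _ => ?_
    exact (Finset.measurable_fun_prod _ fun k _ => hcoord _ k).mul (hcoord _ m)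
  refine measurable_of_tendsto_metrizable hpartial (tendsto_pi_nhds.2 fun ω => ?_)
  exact ((h.isContractingSystem i).summable fun k => (ω k).1 i).hasSum.tendsto_sum_nat

theorem scaleComparison {E : Finset (∀ i, A i)} {s o s' o' : ∀ i, A i → ℝ} {t : ℝ}
    (hΦ : (mk s o E).Valid) (hB : (mk s o E).Baranski) (hΦ' : (mk s' o' E).Valid) (ht : 0 ≤ t)
    (hs : ∀ i a, |s' i a| ≤ |s i a| ^ t) :
    ScaleComparison (∀ i, List (A i)) (mk s o E).coding (mk s' o' E).coding t := by
  choose N hN using fun i => (hΦ.isContractingSystem i).exists_card_isStopped_le (hB i)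
  refine ⟨∏ i, N i, fun ρ hρ => ?_⟩
  choose n hn using fun (ω : ℕ → {a // a ∈ E}) i =>
    (hΦ.isContractingSystem i).exists_isStopped hρ.1 fun k => (ω k).1 i
  refine ⟨fun ω i => prefixWord (n ω i) fun k => (ω k).1 i, fun ω τ hωτ => ?_, fun y S hS => ?_⟩
  · refine (dist_pi_le_iff (Real.rpow_nonneg hρ.1.le t)).2 fun i => ?_
    have hi := congrFun hωτ i
    have hlen : n ω i = n τ i := by
      simpa only [length_prefixWord] using congrArg List.length hi
    dsimp only at hi
    rw [← hlen] at hi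
    calc dist ((mk s' o' E).coding ω i) ((mk s' o' E).coding τ i)
        ≤ wordRatio (s' i) (prefixWord (n ω i) fun k => (ω k).1 i) :=
          (hΦ'.isContractingSystem i).abs_seqPoint_sub_le hi
      _ ≤ wordRatio (s i) (prefixWord (n ω i) fun k => (ω k).1 i) ^ t :=
          wordRatio_le_rpow (hs i) _
      _ ≤ ρ ^ t := Real.rpow_le_rpow (wordRatio_nonneg _) (hn ω i).1 ht
  · have hsub : S ⊆ Fintype.piFinset fun i => S.image fun w => w i := fun w hw =>
      Fintype.mem_piFinset.2 fun i => Finset.mem_image_of_mem _ hw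
    refine (Finset.card_le_card hsub).trans ?_
    rw [Fintype.card_piFinset]
    refine Finset.prod_le_prod' fun i _ => hN i ρ hρ (y i) _ fun w hw => ?_
    obtain ⟨v, hv, rfl⟩ := Finset.mem_image.1 hw
    obtain ⟨ω, rfl, hωy⟩ := hS v hv
    refine ⟨hn ω i, _, (hΦ.isContractingSystem i).seqPoint_mem fun k => (ω (k + n ω i)).1 i, ?_⟩
    rw [← (hΦ.isContractingSystem i).seqPoint_eq_wordMap (n ω i) fun k => (ω k).1 i]
    exact (dist_le_pi_dist _ _ i).trans_lt hωy

theorem mul_dimH_limitSet_le {E : Finset (∀ i, A i)} {s o s' o' : ∀ i, A i → ℝ} {t : ℝ≥0}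
    (hΦ : (mk s o E).Valid) (hB : (mk s o E).Baranski) (hΦ' : (mk s' o' E).Valid) (ht : 0 < t)
    (hs : ∀ i a, |s' i a| ≤ |s i a| ^ (t : ℝ)) :
    t * dimH (mk s' o' E).limitSet ≤ dimH (mk s o E).limitSet :=
  (scaleComparison hΦ hB hΦ' t.2 hs).mul_dimH_range_le ht

theorem mul_dynDim_le {E : Finset (∀ i, A i)} {s o s' o' : ∀ i, A i → ℝ} {t : ℝ≥0}
    (hΦ : (mk s o E).Valid) (hB : (mk s o E).Baranski) (hΦ' : (mk s' o' E).Valid) (ht : 0 < t)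
    (hs : ∀ i a, |s' i a| ≤ |s i a| ^ (t : ℝ)) :
    t * (mk s' o' E).dynDim ≤ (mk s o E).dynDim := by
  rw [dynDim, ENNReal.mul_sSup]
  refine iSup₂_le ?_
  rintro _ ⟨μ, hμ, hinv, rfl⟩
  let _ : MeasurableSpace {a // a ∈ E} := ⊤
  exact ((scaleComparison hΦ hB hΦ' t.2 hs).mul_measDim_map_le μ hΦ.measurable_coding
    hΦ'.measurable_coding ht).trans (le_sSup ⟨μ, hμ, hinv, rfl⟩)

end DiagIFS

theorem tendsto_of_forall_mul_le {X : Type*} {F : X → ℝ≥0∞} {l : Filter X} {c : ℝ≥0∞}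
    (h : ∀ t : ℝ≥0, 0 < t → t < 1 → ∀ᶠ x in l, t * F x ≤ c ∧ t * c ≤ F x) :
    Tendsto F l (𝓝 c) := by
  have hlim (b : ℝ≥0∞) : Tendsto (fun t : ℝ≥0 => (t : ℝ≥0∞) * b) (𝓝[<] 1) (𝓝 b) := by
    have h1 : Tendsto (fun t : ℝ≥0 => (t : ℝ≥0∞)) (𝓝[<] 1) (𝓝 1) :=
      (ENNReal.continuous_coe.tendsto 1).mono_left nhdsWithin_le_nhds
    simpa using ENNReal.Tendsto.mul_const (b := b) h1 (Or.inl one_ne_zero)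
  have : (𝓝[<] (1:ℝ≥0)).NeBot := nhdsLT_neBot_of_exists_lt ⟨0, one_pos⟩
  have hIoo : Ioo (0:ℝ≥0) 1 ∈ 𝓝[<] 1 := Ioo_mem_nhdsLT one_pos
  refine tendsto_order.2 ⟨fun b hb => ?_, fun b hb => ?_⟩
  · obtain ⟨t, hbt, ht0, ht1⟩ := (((hlim c).eventually (lt_mem_nhds hb)).and hIoo).exists
    exact (h t ht0 ht1).mono fun x hx => hbt.trans_le hx.2
  · obtain ⟨t, hbt, ht0, ht1⟩ := (((hlim b).eventually (lt_mem_nhds hb)).and hIoo).exists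
    exact (h t ht0 ht1).mono fun x hx => lt_of_mul_lt_mul_left' (hx.1.trans_lt hbt)

/-- A function of the parameters that is controlled by the power comparison of slopes is
continuous. -/
theorem continuousOn_of_forall_mul_le {F : (∀ i, A i → ℝ) × (∀ i, A i → ℝ) → ℝ≥0∞}
    {R : Set ((∀ i, A i → ℝ) × (∀ i, A i → ℝ))}
    (hR : ∀ q ∈ R, ∀ i a, q.1 i a ≠ 0 ∧ |q.1 i a| < 1)
    (hF : ∀ q ∈ R, ∀ q' ∈ R, ∀ t : ℝ≥0, 0 < t → (∀ i a, |q'.1 i a| ≤ |q.1 i a| ^ (t : ℝ)) →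
      t * F q' ≤ F q) :
    ContinuousOn F R := by
  intro p hp
  refine tendsto_of_forall_mul_le fun t ht0 ht1 => ?_
  have hlt (i : Fin d) (a : A i) : |p.1 i a| < |p.1 i a| ^ (t : ℝ) :=
    Real.self_lt_rpow_of_lt_one (abs_pos.2 (hR p hp i a).1) (hR p hp i a).2 (mod_cast ht1)
  have hcont (i : Fin d) (a : A i) : Continuous fun q : (∀ i, A i → ℝ) × (∀ i, A i → ℝ) =>
      |q.1 i a| := by fun_prop
  have hle : ∀ᶠ q in 𝓝[R] p, ∀ i a, |q.1 i a| ≤ |p.1 i a| ^ (t : ℝ) :=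
    eventually_all.2 fun i => eventually_all.2 fun a => nhdsWithin_le_nhds <|
      ((hcont i a).continuousAt.eventually (gt_mem_nhds (hlt i a))).mono fun q hq => hq.le
  have hge : ∀ᶠ q in 𝓝[R] p, ∀ i a, |p.1 i a| ≤ |q.1 i a| ^ (t : ℝ) :=
    eventually_all.2 fun i => eventually_all.2 fun a => nhdsWithin_le_nhds <|
      (((hcont i a).rpow_const fun _ => Or.inr t.2).continuousAt.eventually
        (lt_mem_nhds (hlt i a))).mono fun q hq => hq.le
  filter_upwards [hle, hge, self_mem_nhdsWithin] with q hq1 hq2 hq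
  exact ⟨hF p hp q hq t ht0 hq1, hF q hq p hp t ht0 hq2⟩

/-- On the space of Barański diagonal IFSes with a fixed alphabet (parameterized by
the slopes and translations of the defining similarities), the Hausdorff dimension
and the dynamical dimension are continuous functions of the IFS. -/
theorem dimH_dynDim_continuousOn {d : ℕ} {A : Fin d → Type} [∀ i, Fintype (A i)]
    (E : Finset (∀ i, A i)) :
    ContinuousOn
      (fun q : (∀ i, A i → ℝ) × (∀ i, A i → ℝ) =>
        dimH (DiagIFS.limitSet (DiagIFS.mk q.1 q.2 E)))
      {q | (DiagIFS.mk q.1 q.2 E).Valid ∧ (DiagIFS.mk q.1 q.2 E).Baranski} ∧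
    ContinuousOn
      (fun q : (∀ i, A i → ℝ) × (∀ i, A i → ℝ) =>
        DiagIFS.dynDim (DiagIFS.mk q.1 q.2 E))
      {q | (DiagIFS.mk q.1 q.2 E).Valid ∧ (DiagIFS.mk q.1 q.2 E).Baranski} := by
  have hR : ∀ q ∈ {q : (∀ i, A i → ℝ) × (∀ i, A i → ℝ) |
      (DiagIFS.mk q.1 q.2 E).Valid ∧ (DiagIFS.mk q.1 q.2 E).Baranski},
      ∀ i a, q.1 i a ≠ 0 ∧ |q.1 i a| < 1 :=
    fun q hq i a => ⟨hq.1.2.1 i a, hq.1.2.2.1 i a⟩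
  exact ⟨continuousOn_of_forall_mul_le hR fun q hq q' hq' t ht hs =>
      DiagIFS.mul_dimH_limitSet_le hq.1 hq.2 hq'.1 ht hs,
    continuousOn_of_forall_mul_le hR fun q hq q' hq' t ht hs =>
      DiagIFS.mul_dynDim_le hq.1 hq.2 hq'.1 ht hs⟩

end SelfAffineSponge
end

section
/- Let Λ_Φ be an arbitrary self-affine sponge. Then for every cycle r ∈ R, HD(ν_r) ≤ δ(r), with equality if r is good and nondegenerate. In particular, for every p ∈ P, HD(ν_p) ≤ δ(p), with equality if p is good. -/
open MeasureTheory Filter Set Metric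
open scoped Classical Topology ENNReal NNReal

namespace SelfAffineSponge

variable {d : ℕ} {A : Fin d → Type} [∀ i, Fintype (A i)]

section

open Asymptotics ProbabilityTheory

/-- A monotone sequence whose squares-indexed subsequence stays close to a sequence with bounded
increments stays close to it everywhere. -/
theorem isLittleO_of_squares {S M : ℕ → ℝ} {c : ℝ} (hS : Monotone S) (hM : Monotone M)
    (hMc : ∀ n, M (n + 1) ≤ M n + c)
    (h : ∀ ε > 0, ∀ᶠ k : ℕ in atTop, |S (k ^ 2) - M (k ^ 2)| ≤ ε * (k : ℝ) ^ 2) :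
    (fun n => S n - M n) =o[atTop] (fun n : ℕ => (n : ℝ)) := by
  have hMc' : ∀ n j : ℕ, M (n + j) ≤ M n + j * c := by
    intro n j
    induction j with
    | zero => simp
    | succ j ih => have := hMc (n + j); push_cast; rw [← add_assoc]; linarith
  have hc : 0 ≤ c := by
    have h1 := hMc 0
    have h2 := hM (Nat.zero_le (0 + 1))
    linarith
  rw [isLittleO_iff]
  intro ε hε
  have hsq : Tendsto Nat.sqrt atTop atTop :=
    tendsto_atTop.2 fun k => (eventually_ge_atTop (k * k)).mono fun n hn => Nat.le_sqrt.2 hn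
  obtain ⟨K, hK⟩ := exists_nat_ge (15 * c / ε)
  have h5 := h (ε / 5) (by positivity)
  have h6 := (tendsto_add_atTop_nat 1).eventually h5
  filter_upwards [hsq.eventually h5, hsq.eventually h6, hsq.eventually (eventually_ge_atTop (K + 1))]
    with n h1 h2 h3
  set k := Nat.sqrt n with hk
  have hk1 : k ^ 2 ≤ n := by rw [pow_two]; exact Nat.sqrt_le n
  have hk2 : n ≤ (k + 1) ^ 2 := by simpa using (Nat.lt_succ_sqrt' n).le
  have e : (k + 1) ^ 2 = k ^ 2 + (2 * k + 1) := by ring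
  have hM1 := hMc' (k ^ 2) (2 * k + 1)
  rw [← e] at hM1
  have a1 := hS hk1
  have a2 := hS hk2
  have b1 := hM hk1
  have b2 := hM hk2
  have hkK : (K : ℝ) + 1 ≤ k := by exact_mod_cast h3
  have hkn : (k : ℝ) ^ 2 ≤ n := by exact_mod_cast hk1
  have hck : 15 * c ≤ ε * k := by
    rw [div_le_iff₀ hε] at hK
    nlinarith
  have hK0 : (0 : ℝ) ≤ K := Nat.cast_nonneg K
  have hlin : ((2 * k + 1 : ℕ) : ℝ) * c ≤ ε / 5 * (k : ℝ) ^ 2 := by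
    push_cast
    nlinarith
  push_cast at h2
  rw [abs_le] at h1 h2
  rw [Real.norm_eq_abs, Real.norm_of_nonneg (Nat.cast_nonneg n), abs_le]
  have hk4 : ((k : ℝ) + 1) ^ 2 ≤ 4 * (k : ℝ) ^ 2 := by nlinarith
  have q1 : ε / 5 * ((k : ℝ) + 1) ^ 2 ≤ ε / 5 * (4 * (k : ℝ) ^ 2) := by gcongr
  have q2 : ε * (k : ℝ) ^ 2 ≤ ε * n := by gcongr
  constructor <;> nlinarith

/-- Strong law of large numbers for pairwise independent nonnegative random variables with bounded
second moments. -/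
theorem strongLaw_of_sq_bounded {Ω : Type*} [MeasurableSpace Ω] {μ : Measure Ω}
    [IsProbabilityMeasure μ] {X : ℕ → Ω → ℝ} {m : ℕ → ℝ} {C : ℝ}
    (hX : ∀ n, MemLp (X n) 2 μ) (hnn : ∀ n ω, 0 ≤ X n ω)
    (hind : Pairwise fun i j => IndepFun (X i) (X j) μ)
    (hm : ∀ n, ∫ ω, X n ω ∂μ = m n) (hC : ∀ n, ∫ ω, X n ω ^ 2 ∂μ ≤ C) :
    ∀ᵐ ω ∂μ, (fun n => ∑ k ∈ Finset.range n, X k ω - ∑ k ∈ Finset.range n, m k)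
      =o[atTop] (fun n : ℕ => (n : ℝ)) := by
  have hint : ∀ n, Integrable (X n) μ := fun n => (hX n).integrable (by norm_num)
  have hsqint : ∀ n, Integrable (fun ω => X n ω ^ 2) μ := fun n => (hX n).integrable_sq
  have hm0 : ∀ n, 0 ≤ m n := fun n => by rw [← hm]; exact integral_nonneg (hnn n)
  have hmC : ∀ n, m n ≤ 1 + C := by
    intro n
    rw [← hm]
    calc ∫ ω, X n ω ∂μ ≤ ∫ ω, (1 + X n ω ^ 2) ∂μ := by
          refine integral_mono (hint n) ((integrable_const _).add (hsqint n)) fun ω => ?_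
          simp only
          nlinarith [sq_nonneg (X n ω - 1)]
      _ = 1 + ∫ ω, X n ω ^ 2 ∂μ := by
          rw [integral_add (integrable_const _) (hsqint n)]; simp
      _ ≤ 1 + C := by linarith [hC n]
  have hC0 : 0 ≤ C := le_trans (integral_nonneg fun ω => sq_nonneg _) (hC 0)
  have hvar : ∀ n, Var[X n; μ] ≤ C := by
    intro n
    refine le_trans (variance_le_expectation_sq (hX n).aestronglyMeasurable) ?_
    simpa using hC n
  have hS : ∀ N : ℕ, MemLp (∑ k ∈ Finset.range N, X k) 2 μ := fun N =>
    memLp_finsetSum' _ fun k _ => hX k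
  have hSm : ∀ N : ℕ, ∫ ω, (∑ k ∈ Finset.range N, X k) ω ∂μ = ∑ k ∈ Finset.range N, m k := by
    intro N
    simp only [Finset.sum_apply]
    rw [integral_finsetSum _ fun k _ => hint k]
    exact Finset.sum_congr rfl fun k _ => hm k
  have hSv : ∀ N : ℕ, Var[∑ k ∈ Finset.range N, X k; μ] ≤ N * C := by
    intro N
    rw [IndepFun.variance_sum (fun k _ => hX k) (fun i _ j _ hij => hind hij)]
    calc ∑ i ∈ Finset.range N, Var[X i; μ] ≤ ∑ i ∈ Finset.range N, C :=
          Finset.sum_le_sum fun i _ => hvar i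
      _ = N * C := by simp
  have key : ∀ j : ℕ, ∀ᵐ ω ∂μ, ∀ᶠ k : ℕ in atTop,
      |∑ i ∈ Finset.range (k ^ 2), X i ω - ∑ i ∈ Finset.range (k ^ 2), m i|
        ≤ 1 / ((j : ℝ) + 1) * (k : ℝ) ^ 2 := by
    intro j
    set ε : ℝ := 1 / ((j : ℝ) + 1) with hεdef
    have hε : 0 < ε := by positivity
    have hsum : ∑' k : ℕ, μ {ω | ε * ((k + 1 : ℕ) : ℝ) ^ 2 ≤
        |(∑ i ∈ Finset.range ((k + 1) ^ 2), X i) ω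
          - μ[∑ i ∈ Finset.range ((k + 1) ^ 2), X i]|} ≠ ∞ := by
      have hs : Summable fun k : ℕ => C / ε ^ 2 * (1 / ((k + 1 : ℕ) : ℝ) ^ 2) :=
        Summable.mul_left _ ((summable_nat_add_iff 1).2 (Real.summable_one_div_nat_pow.2 one_lt_two))
      refine ne_top_of_le_ne_top hs.tsum_ofReal_ne_top (ENNReal.tsum_le_tsum fun k => ?_)
      have hk : (0 : ℝ) < ((k + 1 : ℕ) : ℝ) := by positivity
      refine (meas_ge_le_variance_div_sq (hS _) (by positivity)).trans ?_
      refine ENNReal.ofReal_le_ofReal ?_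
      rw [div_le_iff₀ (by positivity)]
      refine (hSv _).trans (le_of_eq ?_)
      push_cast at hk ⊢
      field_simp
    filter_upwards [ae_eventually_notMem hsum] with ω hω
    rw [← map_add_atTop_eq_nat 1, eventually_map]
    filter_upwards [hω] with k hk
    replace hk := not_le.1 hk
    rw [hSm, Finset.sum_apply] at hk
    exact hk.le
  filter_upwards [ae_all_iff.2 key] with ω hω
  refine isLittleO_of_squares (c := 1 + C) ?_ ?_ ?_ ?_
  · exact monotone_nat_of_le_succ fun n => by
      rw [Finset.sum_range_succ]; linarith [hnn n ω]
  · exact monotone_nat_of_le_succ fun n => by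
      rw [Finset.sum_range_succ]; linarith [hm0 n]
  · intro n
    rw [Finset.sum_range_succ]; linarith [hmC n]
  · intro ε hε
    obtain ⟨j, hj⟩ := exists_nat_one_div_lt hε
    filter_upwards [hω j] with k hk
    exact hk.trans (by gcongr)

theorem exists_abs_le_of_isLittleO {u : ℕ → ℝ} (h : u =o[atTop] (fun n : ℕ => (n : ℝ)))
    {ε : ℝ} (hε : 0 < ε) : ∃ C, 0 ≤ C ∧ ∀ n : ℕ, |u n| ≤ ε * n + C := by
  obtain ⟨N, hN⟩ := eventually_atTop.1 (isLittleO_iff.1 h hε)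
  refine ⟨∑ k ∈ Finset.range N, |u k|, Finset.sum_nonneg fun _ _ => abs_nonneg _, fun n => ?_⟩
  rcases le_or_gt N n with hn | hn
  · have := hN n hn
    rw [Real.norm_eq_abs, Real.norm_of_nonneg (Nat.cast_nonneg n)] at this
    have h0 : 0 ≤ ∑ k ∈ Finset.range N, |u k| := Finset.sum_nonneg fun _ _ => abs_nonneg _
    linarith
  · have := Finset.single_le_sum (f := fun k => |u k|) (fun k _ => abs_nonneg _)
      (Finset.mem_range.2 hn)
    have h0 : 0 ≤ ε * n := by positivity
    linarith

/-- A function on `(0,∞)` which is continuous and invariant under multiplication of the argument by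
some `lam > 1`. -/
def LogPeriodic (f : ℝ → ℝ) : Prop :=
  ContinuousOn f (Set.Ioi 0) ∧ ∃ lam : ℝ, 1 < lam ∧ ∀ b > 0, f (lam * b) = f b

namespace LogPeriodic

variable {f : ℝ → ℝ}

theorem continuous_exp (hf : LogPeriodic f) : Continuous fun u => f (Real.exp u) :=
  hf.1.comp_continuous Real.continuous_exp Real.exp_pos

theorem periodic_exp (hf : LogPeriodic f) :
    ∃ c > 0, Function.Periodic (fun u => f (Real.exp u)) c := by
  obtain ⟨lam, h1, hp⟩ := hf.2
  refine ⟨Real.log lam, Real.log_pos h1, fun u => ?_⟩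
  simp only
  rw [Real.exp_add, Real.exp_log (by linarith), mul_comm, hp _ (Real.exp_pos u)]

theorem isCompact_image (hf : LogPeriodic f) : IsCompact (f '' Set.Ioi 0) := by
  obtain ⟨c, hc, hp⟩ := hf.periodic_exp
  have := hp.compact_of_continuous hc.ne' hf.continuous_exp
  convert this using 1
  ext y
  constructor
  · rintro ⟨b, hb, rfl⟩
    exact ⟨Real.log b, by simp only; rw [Real.exp_log hb]⟩
  · rintro ⟨u, rfl⟩
    exact ⟨_, Real.exp_pos u, rfl⟩

theorem exists_abs_le (hf : LogPeriodic f) : ∃ M, 0 ≤ M ∧ ∀ b > 0, |f b| ≤ M := by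
  obtain ⟨M, hM⟩ := hf.isCompact_image.isBounded.exists_norm_le
  exact ⟨M, (norm_nonneg _).trans (hM _ ⟨1, Set.mem_Ioi.2 one_pos, rfl⟩), fun b hb => hM _ ⟨b, hb, rfl⟩⟩

theorem exists_pos_le (hf : LogPeriodic f) (hpos : ∀ b > 0, 0 < f b) :
    ∃ c > 0, ∀ b > 0, c ≤ f b := by
  obtain ⟨y, ⟨b, hb, rfl⟩, hy⟩ := hf.isCompact_image.exists_isLeast
    ⟨f 1, 1, Set.mem_Ioi.2 one_pos, rfl⟩
  exact ⟨f b, hpos b hb, fun b' hb' => hy ⟨b', hb', rfl⟩⟩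

theorem uniformContinuous_exp (hf : LogPeriodic f) {ε : ℝ} (hε : 0 < ε) :
    ∃ δ > 0, ∀ u v, |u - v| < δ → |f (Real.exp u) - f (Real.exp v)| < ε := by
  obtain ⟨c, hc, hp⟩ := hf.periodic_exp
  have huc := (isCompact_Icc (a := -c) (b := 2 * c)).uniformContinuousOn_of_continuous
    hf.continuous_exp.continuousOn
  obtain ⟨δ, hδ, h⟩ := Metric.uniformContinuousOn_iff.1 huc ε hε
  refine ⟨min δ c, lt_min hδ hc, fun u v huv => ?_⟩
  set n := toIcoDiv hc 0 u with hn
  have hu := toIcoMod_mem_Ico hc 0 u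
  rw [toIcoMod, ← hn, zero_add] at hu
  have hv := abs_lt.1 (huv.trans_le (min_le_right _ _))
  have := h (u - n • c) ⟨by linarith [hu.1], by linarith [hu.2]⟩ (v - n • c)
    ⟨by linarith [hu.1], by linarith [hu.2]⟩
    (by rw [Real.dist_eq]; rw [sub_sub_sub_cancel_right]; exact huv.trans_le (min_le_left _ _))
  simp only [Real.dist_eq] at this
  have e1 := hp.sub_zsmul_eq n (x := u)
  have e2 := hp.sub_zsmul_eq n (x := v)
  rwa [e1, e2] at this

theorem exists_slow (hf : LogPeriodic f) {ε : ℝ} (hε : 0 < ε) :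
    ∃ K > 0, ∀ x y, K ≤ x → x ≤ y → y ≤ x + 1 → |f x - f y| < ε := by
  obtain ⟨δ, hδ, h⟩ := hf.uniformContinuous_exp hε
  refine ⟨2 / δ, by positivity, fun x y hx hxy hy => ?_⟩
  have hx0 : 0 < x := lt_of_lt_of_le (by positivity) hx
  have hy0 : 0 < y := hx0.trans_le hxy
  have h1 := h (Real.log x) (Real.log y) ?_
  · rwa [Real.exp_log hx0, Real.exp_log hy0] at h1
  · have h2 : Real.log x ≤ Real.log y := Real.log_le_log hx0 hxy
    rw [abs_sub_comm, abs_of_nonneg (by linarith), ← Real.log_div hy0.ne' hx0.ne']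
    have h3 := Real.log_le_sub_one_of_pos (div_pos hy0 hx0)
    have h4 : y / x - 1 ≤ 1 / x := by
      rw [div_sub_one hx0.ne']; gcongr; linarith
    have h5 : 1 / x < δ := by
      rw [div_lt_iff₀ hx0]
      rw [div_le_iff₀ hδ] at hx
      linarith
    linarith

theorem integrableOn (hf : LogPeriodic f) (x : ℝ) : IntegrableOn f (Set.Ioc 0 x) := by
  obtain ⟨M, hM0, hM⟩ := hf.exists_abs_le
  refine Integrable.of_bound ?_ M ?_
  · exact (hf.1.mono fun b hb => hb.1).aestronglyMeasurable measurableSet_Ioc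
  · filter_upwards [ae_restrict_mem measurableSet_Ioc] with b hb
    exact hM b hb.1

theorem integral_Ioc_sub (hf : LogPeriodic f) {x y : ℝ} (hx : 0 ≤ x) (hxy : x ≤ y) :
    ∫ b in Set.Ioc x y, f b = (∫ b in Set.Ioc 0 y, f b) - ∫ b in Set.Ioc 0 x, f b := by
  rw [← Set.Ioc_union_Ioc_eq_Ioc hx hxy, setIntegral_union (Set.Ioc_disjoint_Ioc_of_le le_rfl)
    measurableSet_Ioc (hf.integrableOn x)
    ((hf.integrableOn y).mono_set (Set.Ioc_subset_Ioc_left hx))]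
  ring

theorem continuousOn_primitive (hf : LogPeriodic f) :
    ContinuousOn (fun x => ∫ b in Set.Ioc 0 x, f b) (Set.Ici 0) := by
  intro x hx
  have hi : IntegrableOn f (Set.Icc 0 (x + 1)) :=
    (integrableOn_Icc_iff_integrableOn_Ioc (by simp)).2 (hf.integrableOn (x + 1))
  have := intervalIntegral.continuousOn_primitive hi x ⟨hx, by linarith⟩
  refine this.mono_of_mem_nhdsWithin ?_
  rw [← Set.Ici_inter_Iic]
  exact inter_mem_nhdsWithin _ (Iic_mem_nhds (by linarith))

end LogPeriodic

theorem integral_Ioc_scale {f : ℝ → ℝ} {s : ℝ} (hs : 0 < s) (hp : ∀ b > 0, f (s * b) = f b)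
    {x : ℝ} (hx : 0 ≤ x) :
    ∫ b in Set.Ioc 0 (s * x), f b = s * ∫ b in Set.Ioc 0 x, f b := by
  have h1 : ∫ b in Set.Ioc 0 x, f b = ∫ b in Set.Ioc 0 x, f (s * b) :=
    setIntegral_congr_fun measurableSet_Ioc fun b hb => (hp b hb.1).symm
  rw [h1, ← intervalIntegral.integral_of_le hx,
    ← intervalIntegral.integral_of_le (by positivity : 0 ≤ s * x),
    intervalIntegral.integral_comp_mul_left _ hs.ne', mul_zero, smul_eq_mul]
  field_simp

namespace LogPeriodic

variable {f : ℝ → ℝ}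

/-- Riemann sums of a log-periodic function approximate its integral up to a sublinear error. -/
theorem isLittleO_sum_sub_integral (hf : LogPeriodic f) :
    (fun n : ℕ => ∑ k ∈ Finset.range n, f ((k : ℝ) + 1) - ∫ b in Set.Ioc (0 : ℝ) n, f b)
      =o[atTop] (fun n : ℕ => (n : ℝ)) := by
  have hstep : ∀ k : ℕ, ∫ b in Set.Ioc (k : ℝ) (k + 1), f b
      = (∫ b in Set.Ioc (0 : ℝ) ((k + 1 : ℕ) : ℝ), f b) - ∫ b in Set.Ioc (0 : ℝ) k, f b := by
    intro k
    rw [hf.integral_Ioc_sub (Nat.cast_nonneg k) (by linarith)]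
    push_cast
    rfl
  have hsum : ∀ n : ℕ, ∑ k ∈ Finset.range n, (f ((k : ℝ) + 1) - ∫ b in Set.Ioc (k : ℝ) (k + 1), f b)
      = ∑ k ∈ Finset.range n, f ((k : ℝ) + 1) - ∫ b in Set.Ioc (0 : ℝ) n, f b := by
    intro n
    rw [Finset.sum_sub_distrib]
    congr 1
    simp_rw [hstep]
    rw [Finset.sum_range_sub (fun n : ℕ => ∫ b in Set.Ioc (0 : ℝ) n, f b)]
    simp
  simp_rw [← hsum]
  refine isLittleO_sum_range_of_tendsto_zero ?_
  rw [Metric.tendsto_atTop]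
  intro ε hε
  obtain ⟨K, hK, h⟩ := hf.exists_slow (half_pos hε)
  obtain ⟨N, hN⟩ := exists_nat_ge K
  refine ⟨N, fun k hk => ?_⟩
  have hk' : K ≤ (k : ℝ) := hN.trans (by exact_mod_cast hk)
  rw [dist_zero_right, Real.norm_eq_abs]
  have hi : IntegrableOn f (Set.Ioc (k : ℝ) (k + 1)) :=
    (hf.integrableOn _).mono_set (Set.Ioc_subset_Ioc_left (Nat.cast_nonneg k))
  have e : f ((k : ℝ) + 1) - ∫ b in Set.Ioc (k : ℝ) (k + 1), f b
      = ∫ b in Set.Ioc (k : ℝ) (k + 1), (f ((k : ℝ) + 1) - f b) := by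
    rw [integral_sub (by simp) hi]
    simp
  rw [e, ← Real.norm_eq_abs]
  refine lt_of_le_of_lt (norm_setIntegral_le_of_norm_le_const (C := ε / 2) (by simp) ?_) ?_
  · intro b hb
    rw [Real.norm_eq_abs, abs_sub_comm]
    exact (h b (k + 1) (hk'.trans hb.1.le) hb.2 (by linarith [hb.1])).le
  · simp; linarith

/-- A nonnegative log-periodic function, positive on a dense set, has integral over the windows
`(t, (1+ε)t]` bounded below by a multiple of `t`. -/
theorem exists_window (hf : LogPeriodic f) (h0 : ∀ b > 0, 0 ≤ f b)
    (hd : Set.Ioi (0 : ℝ) ⊆ closure {b | 0 < b ∧ 0 < f b}) {ε : ℝ} (hε : 0 < ε) :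
    ∃ c > 0, ∀ t > 0, c * t ≤ ∫ b in Set.Ioc t ((1 + ε) * t), f b := by
  set F : ℝ → ℝ := fun x => ∫ b in Set.Ioc 0 x, f b with hF
  have hFc := hf.continuousOn_primitive
  obtain ⟨lam, hl, hp⟩ := hf.2
  have hG : LogPeriodic fun t => (F ((1 + ε) * t) - F t) / t := by
    refine ⟨?_, lam, hl, fun b hb => ?_⟩
    · refine ContinuousOn.div ?_ continuousOn_id fun t ht => (ne_of_gt ht)
      refine ContinuousOn.sub ?_ (hFc.mono Set.Ioi_subset_Ici_self)
      refine hFc.comp (by fun_prop) fun t ht => ?_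
      have : (0 : ℝ) < t := ht
      simp only [Set.mem_Ici]
      positivity
    · simp only [hF]
      rw [show (1 + ε) * (lam * b) = lam * ((1 + ε) * b) by ring,
        integral_Ioc_scale (by linarith) hp (by positivity : 0 ≤ (1 + ε) * b),
        integral_Ioc_scale (by linarith) hp hb.le, ← mul_sub]
      field_simp
  have hwin : ∀ t > 0, ∫ b in Set.Ioc t ((1 + ε) * t), f b = F ((1 + ε) * t) - F t := fun t ht =>
    hf.integral_Ioc_sub ht.le (by nlinarith)
  have hpos : ∀ t > 0, 0 < (F ((1 + ε) * t) - F t) / t := by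
    intro t ht
    refine div_pos ?_ ht
    rw [← hwin t ht]
    have htt : t < (1 + ε) * t := by nlinarith
    obtain ⟨b, hb, hb0, hfb⟩ := mem_closure_iff.1
      (hd (show (t + (1 + ε) * t) / 2 ∈ Set.Ioi 0 by simp only [Set.mem_Ioi]; positivity))
      (Set.Ioo t ((1 + ε) * t)) isOpen_Ioo ⟨by linarith, by linarith⟩
    have hcont : ContinuousOn f (Set.Icc t ((1 + ε) * t)) :=
      hf.1.mono fun x hx => lt_of_lt_of_le ht hx.1
    rw [← intervalIntegral.integral_of_le htt.le]
    exact intervalIntegral.integral_pos htt hcont (fun x hx => h0 x (ht.trans hx.1))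
      ⟨b, ⟨hb.1.le, hb.2.le⟩, hfb⟩
  obtain ⟨c, hc, h⟩ := hG.exists_pos_le hpos
  refine ⟨c, hc, fun t ht => ?_⟩
  rw [hwin t ht, ← le_div_iff₀ ht]
  exact h t ht

end LogPeriodic

instance (Φ : DiagIFS d A) : DiscreteMeasurableSpace Φ.Symb := ⟨fun _ => trivial⟩
instance (Φ : DiagIFS d A) : DiscreteTopology Φ.Symb := ⟨rfl⟩
instance (Φ : DiagIFS d A) : BorelSpace Φ.Symb := ⟨(borel_eq_top_of_discrete).symm⟩

namespace IsProductMeasure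

variable {Φ : DiagIFS d A} {p : ℕ → Φ.Symb → ℝ} {μ : Measure (ℕ → Φ.Symb)}

theorem measurableSet_box (n : ℕ) (T : ℕ → Finset Φ.Symb) :
    MeasurableSet {ω : ℕ → Φ.Symb | ∀ k < n, ω k ∈ T k} := by
  have : {ω : ℕ → Φ.Symb | ∀ k < n, ω k ∈ T k}
      = ⋂ k ∈ Finset.range n, (fun ω : ℕ → Φ.Symb => ω k) ⁻¹' (T k : Set Φ.Symb) := by
    ext ω; simp
  rw [this]
  exact Finset.measurableSet_biInter _ fun k _ => measurable_pi_apply k (MeasurableSet.of_discrete)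

theorem real_box [Nonempty Φ.Symb] (h : IsProductMeasure Φ p μ) (n : ℕ) (T : ℕ → Finset Φ.Symb) :
    μ.real {ω | ∀ k < n, ω k ∈ T k} = ∏ k ∈ Finset.range n, ∑ a ∈ T k, p k a := by
  have := h.1
  let ext : (Fin n → Φ.Symb) → ℕ → Φ.Symb := fun v k =>
    if hk : k < n then v ⟨k, hk⟩ else Classical.arbitrary _
  have hext : ∀ v (k : Fin n), ext v k = v k := fun v k => by simp [ext]
  have hcyl : ∀ v, {ω : ℕ → Φ.Symb | ∀ k < n, ω k = ext v k}
      = {ω | ∀ k < n, ω k ∈ ({ext v k} : Finset Φ.Symb)} := fun v => by simp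
  have hU : {ω : ℕ → Φ.Symb | ∀ k < n, ω k ∈ T k}
      = ⋃ v ∈ Fintype.piFinset (fun k : Fin n => T k), {ω | ∀ k < n, ω k = ext v k} := by
    ext ω
    simp only [Set.mem_ofPred_eq, Set.mem_iUnion, Fintype.mem_piFinset, exists_prop]
    constructor
    · intro hω
      exact ⟨fun k => ω k, fun k => hω k k.2, fun k hk => by simp [ext, hk]⟩
    · rintro ⟨v, hv, hω⟩ k hk
      rw [hω k hk, hext v ⟨k, hk⟩]
      exact hv ⟨k, hk⟩
  rw [hU, measureReal_biUnion_finset]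
  · rw [Finset.prod_range, Finset.prod_univ_sum]
    refine Finset.sum_congr rfl fun v _ => ?_
    have := h.2 n (ext v)
    rw [Finset.prod_range] at this
    rw [Measure.real, this]
    exact Finset.prod_congr rfl fun k _ => by rw [hext]
  · intro v _ v' _ hvv'
    refine Set.disjoint_left.2 fun ω h1 h2 => hvv' ?_
    funext k
    rw [← hext v, ← hext v', ← h1 k k.2, ← h2 k k.2]
  · intro v _
    rw [hcyl]
    exact measurableSet_box _ _

theorem real_iInter [Nonempty Φ.Symb] (h : IsProductMeasure Φ p μ) (hp : ∀ k, IsProbVec (p k))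
    (S : Finset ℕ) (T : ℕ → Finset Φ.Symb) :
    μ.real {ω | ∀ k ∈ S, ω k ∈ T k} = ∏ k ∈ S, ∑ a ∈ T k, p k a := by
  obtain ⟨N, hN⟩ := S.exists_nat_subset_range
  have e : {ω : ℕ → Φ.Symb | ∀ k ∈ S, ω k ∈ T k}
      = {ω | ∀ k < N, ω k ∈ if k ∈ S then T k else Finset.univ} := by
    ext ω
    constructor
    · intro hω k _
      split_ifs with hk
      · exact hω k hk
      · exact Finset.mem_univ _
    · intro hω k hk
      simpa [hk] using hω k (Finset.mem_range.1 (hN hk))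
  rw [e, h.real_box, ← Finset.prod_subset hN]
  · exact Finset.prod_congr rfl fun k hk => by simp [hk]
  · intro k _ hk
    simp only [hk, if_false]
    exact (hp k).2

theorem real_preimage [Nonempty Φ.Symb] (h : IsProductMeasure Φ p μ) (hp : ∀ k, IsProbVec (p k))
    (k : ℕ) (T : Finset Φ.Symb) : μ.real {ω | ω k ∈ T} = ∑ a ∈ T, p k a := by
  simpa using h.real_iInter hp {k} fun _ => T

theorem iIndepFun_eval [Nonempty Φ.Symb] (h : IsProductMeasure Φ p μ)
    (hp : ∀ k, IsProbVec (p k)) : iIndepFun (fun k (ω : ℕ → Φ.Symb) => ω k) μ := by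
  have := h.1
  rw [iIndepFun_iff_measure_inter_preimage_eq_mul]
  intro S s _
  let T : ℕ → Finset Φ.Symb := fun k => Finset.univ.filter (· ∈ s k)
  have e : (⋂ k ∈ S, (fun ω : ℕ → Φ.Symb => ω k) ⁻¹' s k) = {ω | ∀ k ∈ S, ω k ∈ T k} := by
    ext ω; simp [T]
  have e' : ∀ k, (fun ω : ℕ → Φ.Symb => ω k) ⁻¹' s k = {ω | ω k ∈ T k} := by
    intro k; ext ω; simp [T]
  rw [e, ← ofReal_measureReal (μ := μ) (s := {ω | ∀ k ∈ S, ω k ∈ T k}), h.real_iInter hp,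
    ENNReal.ofReal_prod_of_nonneg fun k _ => Finset.sum_nonneg fun a _ => (hp k).1 a]
  refine Finset.prod_congr rfl fun k _ => ?_
  rw [e', ← h.real_preimage hp, ofReal_measureReal]

theorem integral_eval [Nonempty Φ.Symb] (h : IsProductMeasure Φ p μ) (hp : ∀ k, IsProbVec (p k))
    (k : ℕ) (g : Φ.Symb → ℝ) : ∫ ω, g (ω k) ∂μ = ∑ a, p k a * g a := by
  have := h.1
  have hk : Measurable fun ω : ℕ → Φ.Symb => ω k := measurable_pi_apply k
  have : IsProbabilityMeasure (μ.map fun ω => ω k) := Measure.isProbabilityMeasure_map hk.aemeasurable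
  rw [← integral_map (φ := fun ω : ℕ → Φ.Symb => ω k) hk.aemeasurable
    (Measurable.of_discrete (f := g)).aestronglyMeasurable, integral_fintype Integrable.of_finite]
  refine Finset.sum_congr rfl fun a _ => ?_
  rw [map_measureReal_apply hk (measurableSet_singleton a), smul_eq_mul]
  congr 1
  change μ.real {ω | ω k = a} = _
  simpa using h.real_preimage hp k {a}

theorem ae_pos [Nonempty Φ.Symb] (h : IsProductMeasure Φ p μ) (hp : ∀ k, IsProbVec (p k)) :
    ∀ᵐ ω ∂μ, ∀ k, 0 < p k (ω k) := by
  have := h.1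
  rw [ae_all_iff]
  intro k
  have h0 := h.real_preimage hp k (Finset.univ.filter fun a => p k a = 0)
  rw [Finset.sum_eq_zero fun a ha => (Finset.mem_filter.1 ha).2, measureReal_eq_zero_iff] at h0
  rw [ae_iff]
  refine measure_mono_null (fun ω hω => ?_) h0
  simp only [Set.mem_ofPred_eq, Finset.mem_filter, Finset.mem_univ, true_and]
  exact le_antisymm (not_lt.1 hω) ((hp k).1 _)

theorem memLp_of_finite {k : ℕ} (g : Φ.Symb → ℝ) [IsFiniteMeasure μ] :
    MemLp (fun ω : ℕ → Φ.Symb => g (ω k)) 2 μ := by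
  refine MemLp.of_bound ?_ (∑ a, |g a|) (Eventually.of_forall fun ω => ?_)
  · exact ((Measurable.of_discrete (f := g)).comp (measurable_pi_apply k)).aestronglyMeasurable
  · exact Finset.single_le_sum (f := fun a => |g a|) (fun _ _ => abs_nonneg _) (Finset.mem_univ _)

/-- Law of large numbers for functions of the individual coordinates. -/
theorem strongLaw [Nonempty Φ.Symb] (h : IsProductMeasure Φ p μ) (hp : ∀ k, IsProbVec (p k))
    {g : ℕ → Φ.Symb → ℝ} (hg : ∀ k a, 0 ≤ g k a) {C : ℝ} (hC : ∀ k, ∑ a, p k a * g k a ^ 2 ≤ C) :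
    ∀ᵐ ω ∂μ, (fun n => ∑ k ∈ Finset.range n, g k (ω k)
        - ∑ k ∈ Finset.range n, ∑ a, p k a * g k a) =o[atTop] (fun n : ℕ => (n : ℝ)) := by
  have := h.1
  refine strongLaw_of_sq_bounded (X := fun k (ω : ℕ → Φ.Symb) => g k (ω k)) (C := C)
    (fun k => memLp_of_finite _) (fun k ω => hg k _) ?_ (fun k => h.integral_eval hp k _) ?_
  · intro i j hij
    exact ((h.iIndepFun_eval hp).indepFun hij).comp Measurable.of_discrete Measurable.of_discrete
  · intro k
    rw [h.integral_eval hp k fun a => g k a ^ 2]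
    exact hC k

/-- Law of large numbers for the occurrences of a two-letter word at even positions. -/
theorem strongLaw_pair [Nonempty Φ.Symb] (h : IsProductMeasure Φ p μ) (hp : ∀ k, IsProbVec (p k))
    (a x : Φ.Symb) :
    ∀ᵐ ω ∂μ, (fun n => ∑ j ∈ Finset.range n,
        (if ω (2 * j) = a ∧ ω (2 * j + 1) = x then (1 : ℝ) else 0)
        - ∑ j ∈ Finset.range n, p (2 * j) a * p (2 * j + 1) x)
          =o[atTop] (fun n : ℕ => (n : ℝ)) := by
  have := h.1
  let G : Φ.Symb × Φ.Symb → ℝ := fun z => if z.1 = a ∧ z.2 = x then 1 else 0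
  have hm : ∀ j, Measurable fun ω : ℕ → Φ.Symb => (ω (2 * j), ω (2 * j + 1)) := fun j =>
    (measurable_pi_apply _).prodMk (measurable_pi_apply _)
  have hG : Measurable G := Measurable.of_discrete
  have hG1 : ∀ z, ‖G z‖ ≤ 1 := fun z => by simp only [G]; split_ifs <;> simp
  have hL : ∀ j, MemLp (fun ω : ℕ → Φ.Symb => G (ω (2 * j), ω (2 * j + 1))) 2 μ := fun j =>
    MemLp.of_bound (hG.comp (hm j)).aestronglyMeasurable 1 (Eventually.of_forall fun ω => hG1 _)
  refine strongLaw_of_sq_bounded (X := fun j (ω : ℕ → Φ.Symb) => G (ω (2 * j), ω (2 * j + 1))) (C := 1)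
    hL (fun k ω => ?_) ?_ ?_ ?_
  · simp only [G]; split_ifs <;> simp
  · intro i j hij
    exact ((h.iIndepFun_eval hp).indepFun_prodMk_prodMk (fun k => measurable_pi_apply k)
      (2 * i) (2 * i + 1) (2 * j) (2 * j + 1) (by omega) (by omega) (by omega)
      (by omega)).comp hG hG
  · intro j
    have e : (fun ω : ℕ → Φ.Symb => G (ω (2 * j), ω (2 * j + 1)))
        = Set.indicator {ω | ∀ k ∈ ({2 * j, 2 * j + 1} : Finset ℕ),
          ω k ∈ ({if k = 2 * j then a else x} : Finset Φ.Symb)} 1 := by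
      funext ω
      simp [G, Set.indicator_apply]
    have hms : MeasurableSet {ω : ℕ → Φ.Symb | ∀ k ∈ ({2 * j, 2 * j + 1} : Finset ℕ),
          ω k ∈ ({if k = 2 * j then a else x} : Finset Φ.Symb)} := by
      have : {ω : ℕ → Φ.Symb | ∀ k ∈ ({2 * j, 2 * j + 1} : Finset ℕ),
          ω k ∈ ({if k = 2 * j then a else x} : Finset Φ.Symb)}
          = (fun ω : ℕ → Φ.Symb => (ω (2 * j), ω (2 * j + 1))) ⁻¹' {(a, x)} := by
        ext ω; simp
      rw [this]
      exact hm j (MeasurableSet.of_discrete)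
    rw [e, integral_indicator_one hms, h.real_iInter hp, Finset.prod_pair (by omega)]
    simp
  · intro j
    calc ∫ ω, G (ω (2 * j), ω (2 * j + 1)) ^ 2 ∂μ ≤ ∫ _, (1 : ℝ) ∂μ := by
          refine integral_mono (hL j).integrable_sq (integrable_const _) fun ω => ?_
          simp only [G]; split_ifs <;> simp
      _ = 1 := by simp

end IsProductMeasure

namespace DiagIFS

variable (Φ : DiagIFS d A) (I : Finset (Fin d))

theorem cylMass_eq_sum (p : Φ.Symb → ℝ) (a : Φ.Symb) :
    Φ.cylMass I p a = ∑ b ∈ Finset.univ.filter (fun b : Φ.Symb => ∀ i ∈ I, b.1 i = a.1 i), p b := by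
  rw [cylMass, Finset.sum_filter]

theorem le_cylMass {p : Φ.Symb → ℝ} (hp : IsProbVec p) (a : Φ.Symb) : p a ≤ Φ.cylMass I p a := by
  rw [cylMass_eq_sum]
  exact Finset.single_le_sum (fun b _ => hp.1 b) (by simp)

theorem cylMass_nonneg {p : Φ.Symb → ℝ} (hp : IsProbVec p) (a : Φ.Symb) : 0 ≤ Φ.cylMass I p a :=
  (hp.1 a).trans (Φ.le_cylMass I hp a)

theorem cylMass_le_one {p : Φ.Symb → ℝ} (hp : IsProbVec p) (a : Φ.Symb) :
    Φ.cylMass I p a ≤ 1 := by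
  rw [cylMass_eq_sum, ← hp.2]
  exact Finset.sum_le_sum_of_subset_of_nonneg (Finset.filter_subset _ _) fun b _ _ => hp.1 b

theorem neg_log_cylMass_nonneg {p : Φ.Symb → ℝ} (hp : IsProbVec p) (a : Φ.Symb) :
    0 ≤ -Real.log (Φ.cylMass I p a) :=
  neg_nonneg.2 (Real.log_nonpos (Φ.cylMass_nonneg I hp a) (Φ.cylMass_le_one I hp a))

theorem cylMass_empty {p : Φ.Symb → ℝ} (hp : IsProbVec p) (a : Φ.Symb) :
    Φ.cylMass ∅ p a = 1 := by
  simpa [cylMass] using hp.2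

theorem entropy_empty {p : Φ.Symb → ℝ} (hp : IsProbVec p) : Φ.entropy ∅ p = 0 := by
  simp [entropy, Φ.cylMass_empty hp]

theorem entropy_eq (p : Φ.Symb → ℝ) :
    Φ.entropy I p = ∑ a, p a * -Real.log (Φ.cylMass I p a) := by
  simp [entropy]

theorem entropy_nonneg {p : Φ.Symb → ℝ} (hp : IsProbVec p) : 0 ≤ Φ.entropy I p := by
  rw [entropy_eq]
  exact Finset.sum_nonneg fun a _ => mul_nonneg (hp.1 a) (Φ.neg_log_cylMass_nonneg I hp a)

theorem continuous_entropy : Continuous (Φ.entropy I) := by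
  let cls : Φ.Symb → Finset Φ.Symb := fun a =>
    Finset.univ.filter fun b : Φ.Symb => ∀ i ∈ I, b.1 i = a.1 i
  have e : Φ.entropy I = fun p => ∑ s ∈ Finset.univ.image cls, Real.negMulLog (∑ b ∈ s, p b) := by
    funext p
    rw [entropy, ← Finset.sum_fiberwise_of_maps_to (t := Finset.univ.image cls) (g := cls)
      (fun a _ => Finset.mem_image_of_mem _ (Finset.mem_univ a)), ← Finset.sum_neg_distrib]
    refine Finset.sum_congr rfl fun s hs => ?_
    obtain ⟨a₀, -, rfl⟩ := Finset.mem_image.1 hs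
    have h1 : Finset.univ.filter (fun a => cls a = cls a₀) = cls a₀ := by
      ext a
      simp only [Finset.mem_filter, Finset.mem_univ, true_and, cls]
      constructor
      · intro h
        have : a ∈ Finset.univ.filter fun b : Φ.Symb => ∀ i ∈ I, b.1 i = a.1 i := by simp
        rw [h] at this
        simpa using this
      · intro h
        ext b
        simp only [Finset.mem_filter, Finset.mem_univ, true_and]
        exact forall₂_congr fun i hi => by rw [h i hi]
    rw [Real.negMulLog, neg_mul, Finset.sum_mul]
    congr 1
    refine Finset.sum_congr h1 fun a ha => ?_
    rw [cylMass_eq_sum]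
    change p a * Real.log (∑ b ∈ cls a, p b) = _
    rw [← h1, Finset.mem_filter] at ha
    rw [ha.2]
  rw [e]
  exact continuous_finsetSum _ fun s _ => Real.continuous_negMulLog.comp (by fun_prop)

theorem continuous_chi (i : Fin d) : Continuous (Φ.chi i) := by
  unfold chi
  fun_prop

theorem mul_log_sq_le {x : ℝ} (h0 : 0 ≤ x) (h1 : x ≤ 1) : x * Real.log x ^ 2 ≤ 4 := by
  rcases h0.eq_or_lt with rfl | h0
  · simp
  have h := Real.abs_log_mul_self_lt (√x) (Real.sqrt_pos.2 h0) (by simpa using h1)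
  rw [Real.log_sqrt h0.le] at h
  have hs := Real.sq_sqrt h0.le
  have h2 := (sq_lt_one_iff_abs_lt_one _).2 h
  nlinarith

theorem sum_mul_neg_log_sq_le {p : Φ.Symb → ℝ} (hp : IsProbVec p) :
    ∑ a, p a * (-Real.log (Φ.cylMass I p a)) ^ 2 ≤ ∑ _a : Φ.Symb, 4 := by
  refine Finset.sum_le_sum fun a _ => ?_
  rw [neg_sq]
  calc p a * Real.log (Φ.cylMass I p a) ^ 2
      ≤ Φ.cylMass I p a * Real.log (Φ.cylMass I p a) ^ 2 := by
        gcongr; exact Φ.le_cylMass I hp a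
    _ ≤ 4 := mul_log_sq_le (Φ.cylMass_nonneg I hp a) (Φ.cylMass_le_one I hp a)

end DiagIFS

namespace DiagIFS

variable (Φ : DiagIFS d A)

/-- the logarithmic contraction rate `-log |φ'_{i,a}|` -/
noncomputable def rate (i : Fin d) (a : Φ.Symb) : ℝ := -Real.log |Φ.slope i (a.1 i)|

/-- the `n`-fold shift of a sequence -/
def tail {α : Type*} (n : ℕ) (ω : ℕ → α) : ℕ → α := fun k => ω (n + k)

namespace Valid

variable {Φ} (hV : Φ.Valid)
include hV

theorem nonempty_symb : Nonempty Φ.Symb := hV.1.to_subtype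

theorem abs_slope_eq (i : Fin d) (a : Φ.Symb) : |Φ.slope i (a.1 i)| = Real.exp (-Φ.rate i a) := by
  rw [rate, neg_neg, Real.exp_log (abs_pos.2 (hV.2.1 i _))]

theorem rate_pos (i : Fin d) (a : Φ.Symb) : 0 < Φ.rate i a :=
  neg_pos.2 (Real.log_neg (abs_pos.2 (hV.2.1 i _)) (hV.2.2.1 i _))

theorem exists_rate_bounds :
    ∃ κ > 0, ∃ K > 0, ∀ i (a : Φ.Symb), κ ≤ Φ.rate i a ∧ Φ.rate i a ≤ K := by
  let g : Fin d × Φ.Symb → ℝ := fun z => Φ.rate z.1 z.2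
  have hg : ∀ z, 0 < g z := fun z => hV.rate_pos z.1 z.2
  rcases isEmpty_or_nonempty (Fin d × Φ.Symb) with he | hne
  · exact ⟨1, one_pos, 1, one_pos, fun i a => (he.false (i, a)).elim⟩
  · obtain ⟨z, hz⟩ := Finite.exists_min g
    obtain ⟨z', hz'⟩ := Finite.exists_max g
    exact ⟨g z, hg z, g z', hg z', fun i a => ⟨hz (i, a), hz' (i, a)⟩⟩

theorem abs_prod_slope (i : Fin d) (ω : ℕ → Φ.Symb) (n : ℕ) :
    |∏ k ∈ Finset.range n, Φ.slope i ((ω k).1 i)|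
      = Real.exp (-∑ k ∈ Finset.range n, Φ.rate i (ω k)) := by
  rw [Finset.abs_prod, ← Finset.sum_neg_distrib, Real.exp_sum]
  exact Finset.prod_congr rfl fun k _ => hV.abs_slope_eq i _

theorem abs_off_le (i : Fin d) (a : A i) : |Φ.off i a| ≤ 1 := by
  have := hV.2.2.2 i a 0 (by simp)
  simp only [base, mul_zero, zero_add, Set.mem_Icc] at this
  rw [abs_le]
  constructor <;> linarith [this.1, this.2]

theorem exists_term_bound : ∃ q : ℝ, 0 ≤ q ∧ q < 1 ∧ ∀ i (ω : ℕ → Φ.Symb) n,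
    |(∏ k ∈ Finset.range n, Φ.slope i ((ω k).1 i)) * Φ.off i ((ω n).1 i)| ≤ q ^ n := by
  obtain ⟨κ, hκ, K, hK, hb⟩ := hV.exists_rate_bounds
  refine ⟨Real.exp (-κ), (Real.exp_pos _).le, by simpa using hκ, fun i ω n => ?_⟩
  rw [abs_mul, hV.abs_prod_slope]
  calc _ ≤ Real.exp (-∑ k ∈ Finset.range n, Φ.rate i (ω k)) * 1 := by
        gcongr; exact hV.abs_off_le _ _
    _ ≤ Real.exp (-∑ k ∈ Finset.range n, κ) := by
        rw [mul_one]; gcongr; exact (hb _ _).1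
    _ = _ := by simp [← Real.exp_nat_mul]

theorem summable_coding (i : Fin d) (ω : ℕ → Φ.Symb) : Summable fun n =>
    (∏ k ∈ Finset.range n, Φ.slope i ((ω k).1 i)) * Φ.off i ((ω n).1 i) := by
  obtain ⟨q, hq0, hq1, h⟩ := hV.exists_term_bound
  exact Summable.of_norm_bounded (summable_geometric_of_lt_one hq0 hq1) fun n => h i ω n

theorem coding_eq_base (i : Fin d) (ω : ℕ → Φ.Symb) :
    Φ.coding ω i = Φ.base i ((ω 0).1 i) (Φ.coding (tail 1 ω) i) := by
  rw [coding, (hV.summable_coding i ω).tsum_eq_zero_add, base, coding, ← tsum_mul_left, add_comm]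
  congr 1
  · refine tsum_congr fun n => ?_
    rw [Finset.prod_range_succ']
    simp only [tail, add_comm 1]
    ring
  · simp

theorem coding_tail (i : Fin d) (n : ℕ) (ω : ℕ → Φ.Symb) :
    Φ.coding (tail n ω) i = Φ.base i ((ω n).1 i) (Φ.coding (tail (n + 1) ω) i) := by
  rw [hV.coding_eq_base]
  have : tail 1 (tail n ω) = tail (n + 1) ω := by
    funext k; simp [tail, add_assoc]
  rw [this]
  simp [tail]

theorem coding_mem_Icc (i : Fin d) (ω : ℕ → Φ.Symb) : Φ.coding ω i ∈ Set.Icc (0 : ℝ) 1 := by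
  have key : ∀ n (ω : ℕ → Φ.Symb), ∑ m ∈ Finset.range n,
      (∏ k ∈ Finset.range m, Φ.slope i ((ω k).1 i)) * Φ.off i ((ω m).1 i) ∈ Set.Icc (0 : ℝ) 1 := by
    intro n
    induction n with
    | zero => intro ω; simp
    | succ n ih =>
      intro ω
      have := hV.2.2.2 i ((ω 0).1 i) _ (ih (tail 1 ω))
      convert this using 1
      rw [Finset.sum_range_succ', base, Finset.mul_sum]
      congr 1
      · refine Finset.sum_congr rfl fun m _ => ?_
        rw [Finset.prod_range_succ']
        simp only [tail, add_comm 1]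
        ring
      · simp
  exact isClosed_Icc.mem_of_tendsto (hV.summable_coding i ω).hasSum.tendsto_sum_nat
    (Eventually.of_forall fun n => key n ω)

theorem coding_sub_eq {i : Fin d} {ω τ : ℕ → Φ.Symb} {n : ℕ}
    (h : ∀ k < n, (ω k).1 i = (τ k).1 i) :
    Φ.coding ω i - Φ.coding τ i = (∏ k ∈ Finset.range n, Φ.slope i ((ω k).1 i))
      * (Φ.coding (tail n ω) i - Φ.coding (tail n τ) i) := by
  induction n with
  | zero =>
    have : ∀ ω : ℕ → Φ.Symb, tail 0 ω = ω := fun ω => by funext k; simp [tail]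
    simp [this]
  | succ n ih =>
    rw [ih fun k hk => h k (by omega), hV.coding_tail i n ω, hV.coding_tail i n τ,
      Finset.prod_range_succ, h n (by omega), base, base]
    ring

theorem continuous_coding : Continuous Φ.coding := by
  obtain ⟨q, hq0, hq1, h⟩ := hV.exists_term_bound
  refine continuous_pi fun i => ?_
  refine continuous_tsum (fun n => ?_) (summable_geometric_of_lt_one hq0 hq1) fun n ω => h i ω n
  have hc : ∀ (g : Φ.Symb → ℝ) (k : ℕ), Continuous fun ω : ℕ → Φ.Symb => g (ω k) := fun g k =>
    (continuous_of_discreteTopology (f := g)).comp (continuous_apply k)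
  refine Continuous.mul ?_ (hc (fun a => Φ.off i (a.1 i)) n)
  exact continuous_finsetProd _ fun k _ => hc (fun a => Φ.slope i (a.1 i)) k

end Valid

section Interval

/-- distance of a point of `[0,1]` to the endpoints -/
noncomputable def edgeDist (y : ℝ) : ℝ := min y (1 - y)

theorem edgeDist_nonneg {y : ℝ} (hy : y ∈ Set.Icc (0 : ℝ) 1) : 0 ≤ edgeDist y :=
  le_min hy.1 (by linarith [hy.2])

theorem mul_edgeDist_le {y c : ℝ} (hc : 0 ≤ c) : c * edgeDist y ≤ c * y ∧
    c * edgeDist y ≤ c * (1 - y) :=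
  ⟨mul_le_mul_of_nonneg_left (min_le_left _ _) hc, mul_le_mul_of_nonneg_left (min_le_right _ _) hc⟩

variable {Φ}

theorem Valid.edgeDist_base_ge (hV : Φ.Valid) (i : Fin d) (a : A i) {y : ℝ} :
    |Φ.slope i a| * edgeDist y ≤ edgeDist (Φ.base i a y) := by
  have h0 := hV.2.2.2 i a 0 (by simp)
  have h1 := hV.2.2.2 i a 1 (by simp)
  have hm := mul_edgeDist_le (y := y) (abs_nonneg (Φ.slope i a))
  simp only [base, Set.mem_Icc] at h0 h1 ⊢
  rcases abs_cases (Φ.slope i a) with ⟨h, h'⟩ | ⟨h, h'⟩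
  · rw [h] at hm ⊢
    exact le_min (by linarith) (by linarith)
  · rw [h] at hm ⊢
    exact le_min (by linarith) (by linarith)

theorem image_affine_Ioo {s o : ℝ} (hs : s ≠ 0) :
    (fun x => s * x + o) '' Set.Ioo (0 : ℝ) 1 = Set.Ioo (o + min s 0) (o + max s 0) := by
  ext v
  constructor
  · rintro ⟨x, ⟨h0, h1⟩, rfl⟩
    rcases lt_or_gt_of_ne hs with h | h
    · rw [min_eq_left h.le, max_eq_right h.le]
      constructor <;> simp only <;> nlinarith
    · rw [min_eq_right h.le, max_eq_left h.le]
      constructor <;> simp only <;> nlinarith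
  · rintro ⟨h0, h1⟩
    refine ⟨(v - o) / s, ?_, by field_simp; ring⟩
    rcases lt_or_gt_of_ne hs with h | h
    · rw [min_eq_left h.le] at h0
      rw [max_eq_right h.le] at h1
      exact ⟨div_pos_of_neg_of_neg (by linarith) h, by rw [div_lt_one_of_neg h]; linarith⟩
    · rw [min_eq_right h.le] at h0
      rw [max_eq_left h.le] at h1
      exact ⟨div_pos (by linarith) h, by rw [div_lt_one h]; linarith⟩

theorem Valid.le_or_le_of_disjoint (hV : Φ.Valid) {i : Fin d} {a b : A i}
    (h : Disjoint (Φ.base i a '' Set.Ioo (0:ℝ) 1) (Φ.base i b '' Set.Ioo (0:ℝ) 1)) :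
    (Φ.off i a + max (Φ.slope i a) 0 ≤ Φ.off i b + min (Φ.slope i b) 0) ∨
      (Φ.off i b + max (Φ.slope i b) 0 ≤ Φ.off i a + min (Φ.slope i a) 0) := by
  have ha := hV.2.1 i a
  have hb := hV.2.1 i b
  have e : ∀ c : A i, Φ.base i c = fun x => Φ.slope i c * x + Φ.off i c := fun c => rfl
  rw [e, e, image_affine_Ioo ha, image_affine_Ioo hb, Set.Ioo_disjoint_Ioo] at h
  have hlt : ∀ s : ℝ, s ≠ 0 → min s 0 < max s 0 := fun s hs => min_lt_max.2 hs
  have h1 := hlt _ ha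
  have h2 := hlt _ hb
  rcases min_le_iff.1 h with h | h <;> rcases le_max_iff.1 h with h | h
  · linarith
  · exact Or.inl h
  · exact Or.inr h
  · linarith

theorem edgeDist_le_base (i : Fin d) (a : A i) (y : ℝ) :
    Φ.off i a + min (Φ.slope i a) 0 + |Φ.slope i a| * edgeDist y ≤ Φ.base i a y ∧
      Φ.base i a y + |Φ.slope i a| * edgeDist y ≤ Φ.off i a + max (Φ.slope i a) 0 := by
  have hm := mul_edgeDist_le (y := y) (abs_nonneg (Φ.slope i a))
  simp only [base]
  rcases abs_cases (Φ.slope i a) with ⟨h, h'⟩ | ⟨h, h'⟩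
  · rw [h] at hm ⊢
    rw [min_eq_right h', max_eq_left h']
    constructor <;> linarith
  · rw [h] at hm ⊢
    rw [min_eq_left h'.le, max_eq_right h'.le]
    constructor <;> linarith

/-- Points in two boxes with disjoint interiors are separated by the distance of the first one to
the boundary of its box. -/
theorem Valid.separation (hV : Φ.Valid) {i : Fin d} {a b : A i}
    (h : Disjoint (Φ.base i a '' Set.Ioo (0:ℝ) 1) (Φ.base i b '' Set.Ioo (0:ℝ) 1))
    {y z : ℝ} (hz : z ∈ Set.Icc (0 : ℝ) 1) :
    |Φ.slope i a| * edgeDist y ≤ |Φ.base i a y - Φ.base i b z| := by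
  have h1 := edgeDist_le_base (Φ := Φ) i a y
  have h2 := edgeDist_le_base (Φ := Φ) i b z
  have h3 := mul_nonneg (abs_nonneg (Φ.slope i b)) (edgeDist_nonneg hz)
  rcases hV.le_or_le_of_disjoint h with h | h
  · exact le_trans (by linarith [h1.2, h2.1]) (neg_le_abs _)
  · exact le_trans (by linarith [h1.1, h2.2]) (le_abs_self _)

/-- Two symbols with disjoint intervals yield a two-letter word whose interval avoids the endpoints
of `[0,1]`. -/
theorem Valid.exists_word (hV : Φ.Valid) {i : Fin d} {a b : Φ.Symb}
    (h : Disjoint (Φ.base i (a.1 i) '' Set.Ioo (0:ℝ) 1) (Φ.base i (b.1 i) '' Set.Ioo (0:ℝ) 1)) :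
    ∃ u x : Φ.Symb, (u = a ∨ u = b) ∧ (x = a ∨ x = b) ∧ ∃ c > 0, ∀ z ∈ Set.Icc (0 : ℝ) 1,
      c ≤ edgeDist (Φ.base i (u.1 i) (Φ.base i (x.1 i) z)) := by
  wlog hle : Φ.off i (a.1 i) + max (Φ.slope i (a.1 i)) 0
      ≤ Φ.off i (b.1 i) + min (Φ.slope i (b.1 i)) 0 generalizing a b
  · obtain ⟨u, x, hu, hx, hc⟩ := this h.symm ((hV.le_or_le_of_disjoint h).resolve_left hle)
    exact ⟨u, x, hu.symm, hx.symm, hc⟩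
  have hza : ∀ (c : A i), ∀ z ∈ Set.Icc (0 : ℝ) 1, Φ.off i c + min (Φ.slope i c) 0 ≤ Φ.base i c z ∧
      Φ.base i c z ≤ Φ.off i c + max (Φ.slope i c) 0 := by
    intro c z hz
    have h1 := edgeDist_le_base (Φ := Φ) i c z
    have h3 := mul_nonneg (abs_nonneg (Φ.slope i c)) (edgeDist_nonneg hz)
    constructor <;> linarith [h1.1, h1.2]
  have hends : ∀ c : A i, 0 ≤ Φ.off i c + min (Φ.slope i c) 0 ∧
      Φ.off i c + max (Φ.slope i c) 0 ≤ 1 := by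
    intro c
    have h0 := hV.2.2.2 i c 0 (by simp)
    have h1 := hV.2.2.2 i c 1 (by simp)
    simp only [base, Set.mem_Icc] at h0 h1
    rcases min_cases (Φ.slope i c) 0 with h | h <;> rcases max_cases (Φ.slope i c) 0 with h' | h' <;>
      constructor <;> linarith
  have hlt : ∀ c : A i, min (Φ.slope i c) 0 < max (Φ.slope i c) 0 := fun c =>
    min_lt_max.2 (hV.2.1 i c)
  have ha := hends (a.1 i)
  have hb := hends (b.1 i)
  have hla := hlt (a.1 i)
  have hlb := hlt (b.1 i)
  rcases lt_or_gt_of_ne (hV.2.1 i (a.1 i)) with hs | hs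
  · refine ⟨a, a, Or.inl rfl, Or.inl rfl, min (-Φ.slope i (a.1 i) *
      (1 - (Φ.off i (a.1 i) + max (Φ.slope i (a.1 i)) 0)))
      (1 - (Φ.off i (a.1 i) + max (Φ.slope i (a.1 i)) 0)), ?_, fun z hz => ?_⟩
    · exact lt_min (mul_pos (by linarith) (by linarith)) (by linarith)
    · have h1 := hza (a.1 i) z hz
      have h2 := hza (a.1 i) _ (hV.2.2.2 i (a.1 i) z hz)
      refine min_le_min ?_ (by linarith)
      rw [min_eq_left hs.le] at ha
      rw [show Φ.base i (a.1 i) (Φ.base i (a.1 i) z) = Φ.slope i (a.1 i) * Φ.base i (a.1 i) z +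
        Φ.off i (a.1 i) from rfl]
      nlinarith
  · refine ⟨a, b, Or.inl rfl, Or.inr rfl, min (Φ.slope i (a.1 i) *
      (Φ.off i (b.1 i) + min (Φ.slope i (b.1 i)) 0))
      (1 - (Φ.off i (a.1 i) + max (Φ.slope i (a.1 i)) 0)), ?_, fun z hz => ?_⟩
    · exact lt_min (mul_pos (by linarith) (by linarith)) (by linarith)
    · have h1 := hza (b.1 i) z hz
      have h2 := hza (a.1 i) _ (hV.2.2.2 i (b.1 i) z hz)
      refine min_le_min ?_ (by linarith)
      rw [min_eq_right hs.le] at ha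
      rw [show Φ.base i (a.1 i) (Φ.base i (b.1 i) z) = Φ.slope i (a.1 i) * Φ.base i (b.1 i) z +
        Φ.off i (a.1 i) from rfl]
      nlinarith

end Interval

end DiagIFS

/-- The coordinates above a level form a fixed nonempty set exactly on a half-open interval of
levels. -/
theorem exists_thresholds {t : Fin d → ℝ} {T : ℝ} (h0 : ∀ i, 0 ≤ t i) (hT : ∀ i, t i ≤ T)
    {I : Finset (Fin d)} (hI : I.Nonempty) :
    ∃ α β : ℝ, 0 ≤ α ∧ α ≤ β ∧ β ≤ T ∧
      ∀ b > 0, (Finset.univ.filter (fun i => b ≤ t i) = I ↔ α < b ∧ b ≤ β) := by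
  have hne : (insert 0 (Iᶜ.image t)).Nonempty := Finset.insert_nonempty _ _
  have hβ0 : 0 ≤ I.inf' hI t := Finset.le_inf' _ _ fun i _ => h0 i
  refine ⟨min ((insert 0 (Iᶜ.image t)).max' hne) (I.inf' hI t), I.inf' hI t, ?_,
    min_le_right _ _, ?_, fun b hb => ?_⟩
  · exact le_min (Finset.le_max' _ _ (Finset.mem_insert_self _ _)) hβ0
  · obtain ⟨i, hi⟩ := hI
    exact (Finset.inf'_le _ hi).trans (hT i)
  · rw [min_lt_iff, Finset.max'_lt_iff, Finset.le_inf'_iff, Finset.inf'_lt_iff, Finset.ext_iff]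
    simp only [Finset.mem_filter, Finset.mem_univ, true_and, Finset.mem_insert, Finset.mem_image,
      Finset.mem_compl]
    constructor
    · intro h
      refine ⟨Or.inl ?_, fun i hi => (h i).2 hi⟩
      rintro y (rfl | ⟨i, hi, rfl⟩)
      · exact hb
      · exact not_le.1 fun h' => hi ((h i).1 h')
    · rintro ⟨h1 | ⟨i, hi, h1⟩, h2⟩ j
      · refine ⟨fun h => by_contra fun hj => ?_, h2 j⟩
        exact absurd (h1 _ (Or.inr ⟨j, hj, rfl⟩)) (not_lt.2 h)
      · exact absurd (h2 i hi) (not_le.2 h1)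

/-- Sums along a decreasing family of coordinate sets are close to the corresponding integral. -/
theorem abs_sum_sub_integral_le {f : Finset (Fin d) → ℝ → ℝ} {y : Finset (Fin d) → ℕ → ℝ}
    (hf : ∀ I, LogPeriodic (f I)) {M C ε T : ℝ} (hM : ∀ I, ∀ b > 0, |f I b| ≤ M)
    (hε : 0 ≤ ε) (hf0 : ∀ b > 0, f ∅ b = 0) (hy0 : ∀ k, y ∅ k = 0)
    (hy : ∀ I n, |∑ k ∈ Finset.range n, y I k - ∫ b in Set.Ioc (0 : ℝ) n, f I b| ≤ ε * n + C)
    {t : Fin d → ℝ} (h0 : ∀ i, 0 ≤ t i) (hT : ∀ i, t i ≤ T) {K : ℕ} (hK : T ≤ K) (hT0 : 0 ≤ T) :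
    |∑ k ∈ Finset.range K, y (Finset.univ.filter fun i => (k : ℝ) + 1 ≤ t i) k
      - ∫ b in Set.Ioi (0 : ℝ), f (Finset.univ.filter fun i => b ≤ t i) b|
      ≤ Fintype.card (Finset (Fin d)) * (2 * (ε * T + C + M)) := by
  have hM0 : 0 ≤ M := (abs_nonneg _).trans (hM ∅ 1 one_pos)
  have hC0 : 0 ≤ C := by simpa using hy ∅ 0
  have key : ∀ I : Finset (Fin d),
      IntegrableOn (fun b => if Finset.univ.filter (fun i => b ≤ t i) = I then f I b else 0)
        (Set.Ioi 0) ∧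
      |∑ k ∈ Finset.range K,
          (if Finset.univ.filter (fun i => (k : ℝ) + 1 ≤ t i) = I then y I k else 0)
        - ∫ b in Set.Ioi (0 : ℝ),
          (if Finset.univ.filter (fun i => b ≤ t i) = I then f I b else 0)|
        ≤ 2 * (ε * T + C + M) := by
    intro I
    rcases I.eq_empty_or_nonempty with rfl | hI
    · have e : Set.EqOn (fun b => if Finset.univ.filter (fun i => b ≤ t i) = ∅ then f ∅ b else 0)
          (fun _ => (0 : ℝ)) (Set.Ioi 0) := fun b hb => by simp [hf0 b hb]
      refine ⟨(integrableOn_congr_fun e measurableSet_Ioi).2 integrableOn_zero, ?_⟩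
      rw [setIntegral_congr_fun measurableSet_Ioi e]
      simp only [hy0, ite_self, Finset.sum_const_zero, integral_zero, sub_zero, abs_zero]
      positivity
    · obtain ⟨α, β, hα, hαβ, hβ, h⟩ := exists_thresholds h0 hT hI
      have hβ0 := hα.trans hαβ
      have e : Set.EqOn (fun b => if Finset.univ.filter (fun i => b ≤ t i) = I then f I b else 0)
          ((Set.Ioc α β).indicator (f I)) (Set.Ioi 0) := fun b hb => by
        simp only [Set.indicator_apply, Set.mem_Ioc, h b hb]
      have hint : IntegrableOn ((Set.Ioc α β).indicator (f I)) (Set.Ioi 0) := by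
        refine IntegrableOn.mono_set (t := Set.univ) ?_ (Set.subset_univ _)
        rw [integrableOn_univ, integrable_indicator_iff measurableSet_Ioc]
        exact ((hf I).integrableOn β).mono_set (Set.Ioc_subset_Ioc_left hα)
      refine ⟨(integrableOn_congr_fun e measurableSet_Ioi).2 hint, ?_⟩
      rw [setIntegral_congr_fun measurableSet_Ioi e, setIntegral_indicator measurableSet_Ioc,
        Set.inter_eq_right.2 (show Set.Ioc α β ⊆ Set.Ioi 0 from fun b hb => lt_of_le_of_lt hα hb.1),
        (hf I).integral_Ioc_sub hα hαβ]
      have hs : ∑ k ∈ Finset.range K,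
          (if Finset.univ.filter (fun i => (k : ℝ) + 1 ≤ t i) = I then y I k else 0)
          = ∑ k ∈ Finset.range ⌊β⌋₊, y I k - ∑ k ∈ Finset.range ⌊α⌋₊, y I k := by
        rw [← Finset.sum_Ico_eq_sub _ (Nat.floor_mono hαβ), ← Finset.sum_filter]
        congr 1
        ext k
        simp only [Finset.mem_filter, Finset.mem_range, Finset.mem_Ico]
        rw [h _ (by positivity)]
        have h1 : α < (k : ℝ) + 1 ↔ ⌊α⌋₊ ≤ k := by
          rw [← Nat.lt_succ_iff, Nat.floor_lt hα]; push_cast; rfl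
        have h2 : (k : ℝ) + 1 ≤ β ↔ k < ⌊β⌋₊ := by
          rw [← Nat.succ_le_iff, Nat.le_floor_iff hβ0]; push_cast; rfl
        rw [h1, h2]
        refine ⟨fun h => h.2, fun h' => ⟨?_, h'⟩⟩
        have : (⌊β⌋₊ : ℝ) ≤ K := (Nat.floor_le hβ0).trans (hβ.trans hK)
        exact lt_of_lt_of_le h'.2 (by exact_mod_cast this)
      have hfl : ∀ x, 0 ≤ x → x ≤ T →
          |∑ k ∈ Finset.range ⌊x⌋₊, y I k - ∫ b in Set.Ioc (0 : ℝ) x, f I b| ≤ ε * T + C + M := by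
        intro x hx hxT
        have h1 := hy I ⌊x⌋₊
        have h2 := (hf I).integral_Ioc_sub (Nat.cast_nonneg ⌊x⌋₊) (Nat.floor_le hx)
        have h3 : |∫ b in Set.Ioc (⌊x⌋₊ : ℝ) x, f I b| ≤ M := by
          have := norm_setIntegral_le_of_norm_le_const (μ := volume) (s := Set.Ioc (⌊x⌋₊ : ℝ) x)
            (f := f I) (C := M) (by simp) (fun b hb =>
              hM I b (lt_of_le_of_lt (Nat.cast_nonneg _) hb.1))
          rw [Real.norm_eq_abs, Real.volume_real_Ioc_of_le (Nat.floor_le hx)] at this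
          refine this.trans ?_
          nlinarith [Nat.lt_floor_add_one x, Nat.floor_le hx]
        have h4 : ε * (⌊x⌋₊ : ℝ) ≤ ε * T :=
          mul_le_mul_of_nonneg_left ((Nat.floor_le hx).trans hxT) hε
        rw [abs_le] at *
        constructor <;> linarith [h1.1, h1.2, h3.1, h3.2]
      have h1 := hfl β hβ0 hβ
      have h2 := hfl α hα (hαβ.trans hβ)
      rw [hs]
      rw [abs_le] at *
      constructor <;> linarith [h1.1, h1.2, h2.1, h2.2]
  have e1 : ∑ k ∈ Finset.range K, y (Finset.univ.filter fun i => (k : ℝ) + 1 ≤ t i) k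
      = ∑ I : Finset (Fin d), ∑ k ∈ Finset.range K,
          (if Finset.univ.filter (fun i => (k : ℝ) + 1 ≤ t i) = I then y I k else 0) := by
    rw [Finset.sum_comm]
    refine Finset.sum_congr rfl fun k _ => ?_
    simp
  have e2 : ∫ b in Set.Ioi (0 : ℝ), f (Finset.univ.filter fun i => b ≤ t i) b
      = ∑ I : Finset (Fin d), ∫ b in Set.Ioi (0 : ℝ),
          (if Finset.univ.filter (fun i => b ≤ t i) = I then f I b else 0) := by
    rw [← integral_finsetSum _ fun I _ => (key I).1]
    refine integral_congr_ae (Eventually.of_forall fun b => ?_)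
    simp
  rw [e1, e2, ← Finset.sum_sub_distrib]
  refine (Finset.abs_sum_le_sum_abs _ _).trans ((Finset.sum_le_sum fun I _ => (key I).2).trans ?_)
  simp [Finset.card_univ]

/-- A continuous path of probability vectors which is invariant under some dilation of `(0,∞)`. -/
structure IsCyclic (Φ : DiagIFS d A) (r : ℝ → Φ.Symb → ℝ) : Prop where
  prob : ∀ b > 0, IsProbVec (r b)
  cont : ContinuousOn r (Set.Ioi 0)
  periodic : ∃ lam, 1 < lam ∧ ∀ b > 0, r (lam * b) = r b

/-- the integrated Lyapunov exponent `∫_0^x χ_i(r_b) db` -/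
noncomputable def chiInt (Φ : DiagIFS d A) (r : ℝ → Φ.Symb → ℝ) (i : Fin d) (x : ℝ) : ℝ :=
  ∫ b in Set.Ioc (0:ℝ) x, Φ.chi i (r b)

theorem DiagIFS.chi_eq (Φ : DiagIFS d A) (i : Fin d) (p : Φ.Symb → ℝ) :
    Φ.chi i p = ∑ a, p a * Φ.rate i a := by
  simp [DiagIFS.chi, DiagIFS.rate]

theorem DiagIFS.chi_mem {Φ : DiagIFS d A} {κ K : ℝ}
    (hκ : ∀ i (a : Φ.Symb), κ ≤ Φ.rate i a ∧ Φ.rate i a ≤ K) (i : Fin d) {p : Φ.Symb → ℝ}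
    (hp : IsProbVec p) : κ ≤ Φ.chi i p ∧ Φ.chi i p ≤ K := by
  rw [Φ.chi_eq]
  constructor
  · calc κ = ∑ a, p a * κ := by rw [← Finset.sum_mul, hp.2, one_mul]
      _ ≤ _ := Finset.sum_le_sum fun a _ => mul_le_mul_of_nonneg_left (hκ i a).1 (hp.1 a)
  · calc _ ≤ ∑ a, p a * K :=
        Finset.sum_le_sum fun a _ => mul_le_mul_of_nonneg_left (hκ i a).2 (hp.1 a)
      _ = K := by rw [← Finset.sum_mul, hp.2, one_mul]

namespace IsCyclic

variable {Φ : DiagIFS d A} {r : ℝ → Φ.Symb → ℝ} (hr : IsCyclic Φ r)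
include hr

theorem logPeriodic {F : (Φ.Symb → ℝ) → ℝ} (hF : Continuous F) : LogPeriodic fun b => F (r b) := by
  obtain ⟨lam, h1, h2⟩ := hr.periodic
  exact ⟨hF.comp_continuousOn hr.cont, lam, h1, fun b hb => by simp only [h2 b hb]⟩

theorem logPeriodic_chi (i : Fin d) : LogPeriodic fun b => Φ.chi i (r b) :=
  hr.logPeriodic (Φ.continuous_chi i)

theorem logPeriodic_entropy (I : Finset (Fin d)) : LogPeriodic fun b => Φ.entropy I (r b) :=
  hr.logPeriodic (Φ.continuous_entropy I)

theorem chiInt_sub_mem {κ K : ℝ} (hκ : ∀ i (a : Φ.Symb), κ ≤ Φ.rate i a ∧ Φ.rate i a ≤ K)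
    (i : Fin d) {x y : ℝ} (hx : 0 ≤ x) (hxy : x ≤ y) :
    κ * (y - x) ≤ chiInt Φ r i y - chiInt Φ r i x ∧
      chiInt Φ r i y - chiInt Φ r i x ≤ K * (y - x) := by
  have hl := hr.logPeriodic_chi i
  have hint : IntegrableOn (fun b => Φ.chi i (r b)) (Set.Ioc x y) :=
    (hl.integrableOn y).mono_set (Set.Ioc_subset_Ioc_left hx)
  have e : ∀ c : ℝ, ∫ _ in Set.Ioc x y, c = c * (y - x) := fun c => by
    simp [Real.volume_real_Ioc_of_le hxy, mul_comm]
  have hfin : volume (Set.Ioc x y) ≠ ⊤ := by simp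
  rw [chiInt, chiInt, ← hl.integral_Ioc_sub hx hxy, ← e, ← e]
  have hb : ∀ b ∈ Set.Ioc x y, κ ≤ Φ.chi i (r b) ∧ Φ.chi i (r b) ≤ K := fun b hb =>
    DiagIFS.chi_mem hκ i (hr.prob b (lt_of_le_of_lt hx hb.1))
  exact ⟨setIntegral_mono_on (integrableOn_const hfin) hint measurableSet_Ioc
      fun b h => (hb b h).1,
    setIntegral_mono_on hint (integrableOn_const hfin) measurableSet_Ioc fun b h => (hb b h).2⟩

theorem chiInt_strictMonoOn (hV : Φ.Valid) (i : Fin d) :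
    StrictMonoOn (chiInt Φ r i) (Set.Ici 0) := by
  obtain ⟨κ, hκ0, K, -, hκ⟩ := hV.exists_rate_bounds
  intro x hx y hy hxy
  have := (hr.chiInt_sub_mem hκ i hx hxy.le).1
  nlinarith [mul_pos hκ0 (sub_pos.2 hxy)]

theorem Bcoord_spec {κ K : ℝ} (hκ0 : 0 < κ)
    (hκ : ∀ i (a : Φ.Symb), κ ≤ Φ.rate i a ∧ Φ.rate i a ≤ K) (hV : Φ.Valid) {B : ℝ} (hB : 0 < B)
    (i : Fin d) :
    0 < Bcoord Φ r B i ∧ Bcoord Φ r B i ≤ B / κ ∧ chiInt Φ r i (Bcoord Φ r B i) = B := by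
  have hB' : 0 < B / κ := div_pos hB hκ0
  have h0 : chiInt Φ r i 0 = 0 := by simp [chiInt]
  have h1 : B ≤ chiInt Φ r i (B / κ) := by
    have := (hr.chiInt_sub_mem hκ i le_rfl hB'.le).1
    rw [h0, sub_zero, sub_zero, mul_div_cancel₀ _ hκ0.ne'] at this
    exact this
  have hc : ContinuousOn (chiInt Φ r i) (Set.Icc 0 (B / κ)) :=
    ((hr.logPeriodic_chi i).continuousOn_primitive).mono Set.Icc_subset_Ici_self
  obtain ⟨x, hx, hxB⟩ := intermediate_value_Icc hB'.le hc ⟨by rw [h0]; exact hB.le, h1⟩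
  have he : {x : ℝ | 0 ≤ x ∧ B ≤ ∫ b in Set.Ioc (0:ℝ) x, Φ.chi i (r b)} = Set.Ici x := by
    ext y
    refine ⟨fun h => ?_, fun h => ⟨hx.1.trans h, ?_⟩⟩
    · exact ((hr.chiInt_strictMonoOn hV i).le_iff_le hx.1 h.1).1 (by rw [hxB]; exact h.2)
    · exact hxB ▸ ((hr.chiInt_strictMonoOn hV i).le_iff_le hx.1 (hx.1.trans h)).2 h
  have hx0 : Bcoord Φ r B i = x := by rw [Bcoord, he, csInf_Ici]
  rw [hx0]
  refine ⟨lt_of_le_of_ne hx.1 ?_, hx.2, hxB⟩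
  rintro rfl
  exact hB.ne (h0.symm.trans hxB)

theorem Bcoord_pos (hV : Φ.Valid) {B : ℝ} (hB : 0 < B) (i : Fin d) : 0 < Bcoord Φ r B i := by
  obtain ⟨κ, hκ0, K, -, hκ⟩ := hV.exists_rate_bounds
  exact (hr.Bcoord_spec hκ0 hκ hV hB i).1

theorem chiInt_Bcoord (hV : Φ.Valid) {B : ℝ} (hB : 0 < B) (i : Fin d) :
    chiInt Φ r i (Bcoord Φ r B i) = B := by
  obtain ⟨κ, hκ0, K, -, hκ⟩ := hV.exists_rate_bounds
  exact (hr.Bcoord_spec hκ0 hκ hV hB i).2.2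

theorem le_Bcoord_iff (hV : Φ.Valid) {B : ℝ} (hB : 0 < B) (i : Fin d) {b : ℝ} (hb : 0 ≤ b) :
    b ≤ Bcoord Φ r B i ↔ chiInt Φ r i b ≤ B := by
  rw [← (hr.chiInt_strictMonoOn hV i).le_iff_le hb (hr.Bcoord_pos hV hB i).le,
    hr.chiInt_Bcoord hV hB]

theorem Bcoord_mul (hV : Φ.Valid) {s : ℝ} (hs : 0 < s) (hp : ∀ b > 0, r (s * b) = r b) {B : ℝ}
    (hB : 0 < B) (i : Fin d) : Bcoord Φ r (s * B) i = s * Bcoord Φ r B i := by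
  have h1 := hr.Bcoord_pos hV hB i
  have h2 := hr.Bcoord_pos hV (mul_pos hs hB) i
  refine (hr.chiInt_strictMonoOn hV i).injOn h2.le (mul_pos hs h1).le ?_
  rw [hr.chiInt_Bcoord hV (mul_pos hs hB), chiInt,
    integral_Ioc_scale hs (fun b hb => by rw [hp b hb]) h1.le, ← chiInt, hr.chiInt_Bcoord hV hB]

theorem deltaRB_mul (hV : Φ.Valid) {s : ℝ} (hs : 0 < s) (hp : ∀ b > 0, r (s * b) = r b) {B : ℝ}
    (hB : 0 < B) : deltaRB Φ r (s * B) = deltaRB Φ r B := by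
  have h := integral_comp_mul_left_Ioi (fun b => Φ.entropy (Finset.univ.filter fun i =>
    b ≤ Bcoord Φ r (s * B) i) (r b)) 0 hs
  have h' : ∫ b in Set.Ioi (0 : ℝ), Φ.entropy (Finset.univ.filter fun i =>
      s * b ≤ Bcoord Φ r (s * B) i) (r (s * b)) = ∫ b in Set.Ioi (0 : ℝ),
      Φ.entropy (Finset.univ.filter fun i => b ≤ Bcoord Φ r B i) (r b) :=
    setIntegral_congr_fun measurableSet_Ioi fun b hb => by
      simp only [hp b hb, hr.Bcoord_mul hV hs hp hB, mul_le_mul_iff_right₀ hs]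
  rw [mul_zero, smul_eq_mul, h'] at h
  rw [deltaRB, deltaRB, h]
  field_simp

theorem deltaRB_nonneg {B : ℝ} (hB : 0 < B) : 0 ≤ deltaRB Φ r B :=
  mul_nonneg (inv_nonneg.2 hB.le)
    (setIntegral_nonneg measurableSet_Ioi fun b hb => Φ.entropy_nonneg _ (hr.prob b hb))

end IsCyclic

/-- The approximate cube of level `B` around `ω`: the sequences which agree with `ω` in coordinate
`i` up to time `B_i`. -/
def approxBox (Φ : DiagIFS d A) (r : ℝ → Φ.Symb → ℝ) (B : ℝ) (ω : ℕ → Φ.Symb) :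
    Set (ℕ → Φ.Symb) :=
  {τ | ∀ (k : ℕ) (i : Fin d), (k : ℝ) + 1 ≤ Bcoord Φ r B i → (τ k).1 i = (ω k).1 i}

section ApproxBox

variable {Φ : DiagIFS d A} {r : ℝ → Φ.Symb → ℝ} {μ : Measure (ℕ → Φ.Symb)}

theorem approxBox_eq {B : ℝ} {K : ℕ} (hK : ∀ i, Bcoord Φ r B i ≤ K) (ω : ℕ → Φ.Symb) :
    approxBox Φ r B ω = {τ | ∀ k < K, τ k ∈ Finset.univ.filter (fun b : Φ.Symb =>
      ∀ i ∈ Finset.univ.filter (fun i => (k : ℝ) + 1 ≤ Bcoord Φ r B i), b.1 i = (ω k).1 i)} := by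
  ext τ
  simp only [approxBox, Finset.mem_filter, Finset.mem_univ, true_and]
  refine ⟨fun h k _ i hi => h k i hi, fun h k i hi => h k ?_ i hi⟩
  have : (k : ℝ) + 1 ≤ K := hi.trans (hK i)
  exact_mod_cast this

variable (hr : IsCyclic Φ r) (hV : Φ.Valid)
  (h : IsProductMeasure Φ (fun n => r ((n : ℝ) + 1)) μ)
include hr hV h

omit h in
theorem IsCyclic.exists_Bcoord_le {B : ℝ} (hB : 0 < B) : ∃ K : ℕ, ∀ i, Bcoord Φ r B i ≤ K := by
  obtain ⟨κ, hκ0, K, -, hκ⟩ := hV.exists_rate_bounds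
  exact ⟨⌈B / κ⌉₊, fun i => (hr.Bcoord_spec hκ0 hκ hV hB i).2.1.trans (Nat.le_ceil _)⟩

omit hr in
theorem real_approxBox {B : ℝ} {K : ℕ} (hK : ∀ i, Bcoord Φ r B i ≤ K) (ω : ℕ → Φ.Symb) :
    μ.real (approxBox Φ r B ω) = ∏ k ∈ Finset.range K,
      Φ.cylMass (Finset.univ.filter fun i => (k : ℝ) + 1 ≤ Bcoord Φ r B i) (r ((k : ℝ) + 1))
        (ω k) := by
  have := hV.nonempty_symb
  rw [approxBox_eq hK, h.real_box]
  simp only [DiagIFS.cylMass_eq_sum]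

theorem real_approxBox_pos {B : ℝ} (hB : 0 < B) {ω : ℕ → Φ.Symb}
    (hω : ∀ k : ℕ, 0 < r ((k : ℝ) + 1) (ω k)) : 0 < μ.real (approxBox Φ r B ω) := by
  obtain ⟨K, hK⟩ := hr.exists_Bcoord_le hV hB
  rw [real_approxBox hV h hK]
  exact Finset.prod_pos fun k _ =>
    (hω k).trans_le (Φ.le_cylMass _ (hr.prob _ (by positivity)) _)

theorem ae_sum_sub_entropy : ∀ᵐ ω ∂μ, ∀ I : Finset (Fin d),
    (fun n : ℕ => ∑ k ∈ Finset.range n, -Real.log (Φ.cylMass I (r ((k : ℝ) + 1)) (ω k))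
      - ∫ b in Set.Ioc (0 : ℝ) n, Φ.entropy I (r b)) =o[atTop] (fun n : ℕ => (n : ℝ)) := by
  have := hV.nonempty_symb
  have hp : ∀ k : ℕ, IsProbVec (r ((k : ℝ) + 1)) := fun k => hr.prob _ (by positivity)
  rw [ae_all_iff]
  intro I
  filter_upwards [h.strongLaw hp (g := fun k a => -Real.log (Φ.cylMass I (r ((k : ℝ) + 1)) a))
    (fun k a => Φ.neg_log_cylMass_nonneg I (hp k) a)
    (fun k => Φ.sum_mul_neg_log_sq_le I (hp k))] with ω hω
  simp only [← Φ.entropy_eq] at hω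
  refine (hω.add (hr.logPeriodic_entropy I).isLittleO_sum_sub_integral).congr_left fun n => ?_
  ring

theorem ae_sum_rate_sub_chiInt : ∀ᵐ ω ∂μ, ∀ i : Fin d,
    (fun n : ℕ => ∑ k ∈ Finset.range n, Φ.rate i (ω k) - chiInt Φ r i n)
      =o[atTop] (fun n : ℕ => (n : ℝ)) := by
  have := hV.nonempty_symb
  have hp : ∀ k : ℕ, IsProbVec (r ((k : ℝ) + 1)) := fun k => hr.prob _ (by positivity)
  obtain ⟨κ, hκ0, K, hK0, hκ⟩ := hV.exists_rate_bounds
  rw [ae_all_iff]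
  intro i
  filter_upwards [h.strongLaw hp (g := fun _ a => Φ.rate i a) (C := K ^ 2)
    (fun k a => (hV.rate_pos i a).le) (fun k => by
      calc ∑ a, r ((k : ℝ) + 1) a * Φ.rate i a ^ 2 ≤ ∑ a, r ((k : ℝ) + 1) a * K ^ 2 :=
            Finset.sum_le_sum fun a _ => mul_le_mul_of_nonneg_left
              (pow_le_pow_left₀ (hV.rate_pos i a).le (hκ i a).2 2) ((hp k).1 a)
        _ = K ^ 2 := by rw [← Finset.sum_mul, (hp k).2, one_mul])] with ω hω
  simp only [← Φ.chi_eq] at hω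
  refine (hω.add (hr.logPeriodic_chi i).isLittleO_sum_sub_integral).congr_left fun n => ?_
  rw [chiInt]
  ring

/-- Almost surely, the measure of the approximate cube of level `B` is governed by `δ(r,B)`. -/
theorem ae_log_real_approxBox : ∀ᵐ ω ∂μ, ∀ ε > 0, ∀ᶠ B in atTop,
    |-Real.log (μ.real (approxBox Φ r B ω)) - B * deltaRB Φ r B| ≤ ε * B := by
  have := hV.nonempty_symb
  have hp : ∀ k : ℕ, IsProbVec (r ((k : ℝ) + 1)) := fun k => hr.prob _ (by positivity)
  obtain ⟨κ, hκ0, K, hK0, hκ⟩ := hV.exists_rate_bounds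
  filter_upwards [ae_sum_sub_entropy hr hV h, h.ae_pos hp] with ω hω hpos ε hε
  set N : ℝ := ((Fintype.card (Finset (Fin d)) : ℕ) : ℝ) with hN
  have hN0 : 0 < N := by rw [hN]; exact_mod_cast Fintype.card_pos
  set ε' := ε * κ / (4 * N) with hε'
  have hε'0 : 0 < ε' := by positivity
  choose C hC0 hC using fun I => exists_abs_le_of_isLittleO (hω I) hε'0
  choose M hM0 hM using fun I => (hr.logPeriodic_entropy I).exists_abs_le
  set C' := ∑ I, C I
  set M' := ∑ I, M I
  have hCI : ∀ I, C I ≤ C' := fun I => Finset.single_le_sum (fun I _ => hC0 I) (Finset.mem_univ I)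
  have hMI : ∀ I, M I ≤ M' := fun I => Finset.single_le_sum (fun I _ => hM0 I) (Finset.mem_univ I)
  filter_upwards [eventually_gt_atTop 0, eventually_ge_atTop (N * (2 * (C' + M')) / (ε / 2))]
    with B hB hBlarge
  have hspec := fun i => hr.Bcoord_spec hκ0 hκ hV hB i
  have hK : ∀ i, Bcoord Φ r B i ≤ (⌈B / κ⌉₊ : ℕ) := fun i => (hspec i).2.1.trans (Nat.le_ceil _)
  have key := abs_sum_sub_integral_le (f := fun I b => Φ.entropy I (r b))
    (y := fun I k => -Real.log (Φ.cylMass I (r ((k : ℝ) + 1)) (ω k)))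
    (fun I => hr.logPeriodic_entropy I) (M := M') (C := C') (ε := ε') (T := B / κ)
    (fun I b hb => (hM I b hb).trans (hMI I)) hε'0.le
    (fun b hb => Φ.entropy_empty (hr.prob b hb))
    (fun k => by rw [Φ.cylMass_empty (hp k)]; simp)
    (fun I n => (hC I n).trans (by linarith [hCI I]))
    (t := Bcoord Φ r B) (fun i => (hspec i).1.le) (fun i => (hspec i).2.1)
    (Nat.le_ceil (B / κ)) (by positivity)
  have e1 : B * deltaRB Φ r B = ∫ b in Set.Ioi (0:ℝ),
      Φ.entropy (Finset.univ.filter fun i => b ≤ Bcoord Φ r B i) (r b) := by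
    rw [deltaRB, mul_inv_cancel_left₀ hB.ne']
  have e2 : -Real.log (μ.real (approxBox Φ r B ω)) = ∑ k ∈ Finset.range ⌈B / κ⌉₊,
      -Real.log (Φ.cylMass (Finset.univ.filter fun i => (k : ℝ) + 1 ≤ Bcoord Φ r B i)
        (r ((k : ℝ) + 1)) (ω k)) := by
    rw [real_approxBox hV h hK, Real.log_prod, Finset.sum_neg_distrib]
    exact fun k _ => ((hpos k).trans_le (Φ.le_cylMass _ (hp k) _)).ne'
  rw [e1, e2]
  refine key.trans ?_
  rw [← hN]
  rw [div_le_iff₀ (by positivity)] at hBlarge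
  have : N * (2 * (ε' * (B / κ))) = ε / 2 * B := by rw [hε']; field_simp; ring
  linarith

end ApproxBox

section Visits

variable {Φ : DiagIFS d A} {r : ℝ → Φ.Symb → ℝ} {μ : Measure (ℕ → Φ.Symb)}

theorem tendsto_sub_of_logPeriodic {f : ℝ → ℝ} (hf : LogPeriodic f) :
    Tendsto (fun j : ℕ => f (2 * j + 1) - f (2 * j + 2)) atTop (𝓝 0) := by
  rw [Metric.tendsto_atTop]
  intro ε hε
  obtain ⟨K, hK, h⟩ := hf.exists_slow hε
  refine ⟨⌈K⌉₊, fun j hj => ?_⟩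
  have hj' : K ≤ j := (Nat.le_ceil K).trans (by exact_mod_cast hj)
  rw [Real.dist_eq, sub_zero]
  exact h _ _ (by linarith) (by linarith) (by linarith)

variable (hr : IsCyclic Φ r) (hV : Φ.Valid)
  (h : IsProductMeasure Φ (fun n => r ((n : ℝ) + 1)) μ)
include hr hV h

/-- Almost surely, a two-letter word whose letters both have positive mass at a dense set of times
occurs in every long window. -/
theorem ae_exists_visit {u x : Φ.Symb}
    (hd : Set.Ioi (0 : ℝ) ⊆ closure {b | 0 < b ∧ 0 < r b u * r b x}) :
    ∀ᵐ ω ∂μ, ∀ ε > 0, ∃ n₀ : ℕ, ∀ n ≥ n₀, ∃ j ≥ n, (j : ℝ) ≤ (1 + ε) * n + 1 ∧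
      ω (2 * j) = u ∧ ω (2 * j + 1) = x := by
  have := hV.nonempty_symb
  have hp : ∀ k : ℕ, IsProbVec (r ((k : ℝ) + 1)) := fun k => hr.prob _ (by positivity)
  have hu : LogPeriodic fun b => r b u := hr.logPeriodic (continuous_apply u)
  set f : ℝ → ℝ := fun b => r (2 * b) u * r (2 * b) x with hfdef
  have hf : LogPeriodic f := by
    obtain ⟨lam, h1, h2⟩ := hr.periodic
    have hc : ContinuousOn (fun b => r (2 * b)) (Set.Ioi 0) :=
      hr.cont.comp (by fun_prop) fun b (hb : 0 < b) => show 0 < 2 * b by positivity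
    refine ⟨((continuous_apply u).comp_continuousOn hc).mul
      ((continuous_apply x).comp_continuousOn hc), lam, h1, fun b hb => ?_⟩
    simp only [hfdef]
    rw [mul_left_comm, h2 _ (by positivity)]
  have hf0 : ∀ b > 0, 0 ≤ f b := fun b hb =>
    mul_nonneg ((hr.prob _ (by positivity)).1 _) ((hr.prob _ (by positivity)).1 _)
  have hfd : Set.Ioi (0 : ℝ) ⊆ closure {b | 0 < b ∧ 0 < f b} := by
    intro b hb
    have hb' : (0 : ℝ) < b := hb
    rw [Metric.mem_closure_iff]
    intro ε hε
    obtain ⟨y, ⟨hy0, hy⟩, hyd⟩ := Metric.mem_closure_iff.1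
      (hd (show (0 : ℝ) < 2 * b by positivity)) ε hε
    refine ⟨y / 2, ⟨by positivity, ?_⟩, ?_⟩
    · simpa only [hfdef, mul_div_cancel₀ y (two_ne_zero' ℝ)] using hy
    · rw [Real.dist_eq, abs_lt] at *
      constructor <;> linarith [hyd.1, hyd.2]
  filter_upwards [h.strongLaw_pair hp u x] with ω hω ε hε
  obtain ⟨c, hc, hwin⟩ := hf.exists_window hf0 hfd hε
  have hdiff : (fun n : ℕ => ∑ j ∈ Finset.range n,
      r (((2 * j : ℕ) : ℝ) + 1) u * r (((2 * j + 1 : ℕ) : ℝ) + 1) x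
      - ∑ j ∈ Finset.range n, f ((j : ℝ) + 1)) =o[atTop] (fun n : ℕ => (n : ℝ)) := by
    have ht := (tendsto_sub_of_logPeriodic hu)
    obtain ⟨M, hM0, hM⟩ := (hr.logPeriodic (continuous_apply x)).exists_abs_le
    have ht2 : Tendsto (fun j : ℕ => r (((2 * j : ℕ) : ℝ) + 1) u *
        r (((2 * j + 1 : ℕ) : ℝ) + 1) x - f ((j : ℝ) + 1)) atTop (𝓝 0) := by
      refine squeeze_zero_norm (a := fun j : ℕ => |r (2 * j + 1) u - r (2 * j + 2) u| * M) ?_ ?_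
      · intro j
        have e : r (((2 * j : ℕ) : ℝ) + 1) u * r (((2 * j + 1 : ℕ) : ℝ) + 1) x - f ((j : ℝ) + 1)
            = (r (2 * j + 1) u - r (2 * j + 2) u) * r (2 * j + 2) x := by
          have e1 : 2 * ((j : ℝ) + 1) = 2 * j + 2 := by ring
          have e2 : ((2 * j + 1 : ℕ) : ℝ) + 1 = 2 * j + 2 := by push_cast; ring
          simp only [hfdef]
          rw [e1, e2]
          push_cast
          ring
        rw [e, Real.norm_eq_abs, abs_mul]
        exact mul_le_mul_of_nonneg_left (hM _ (by positivity)) (abs_nonneg _)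
      · simpa using ht.abs.mul_const M
    have := (isLittleO_one_iff ℝ).2 ht2
    have h3 := this.sum_range (fun _ => zero_le_one)
      (by simpa using tendsto_natCast_atTop_atTop)
    refine (h3.congr_left fun n => ?_).congr_right fun n => ?_
    · rw [Finset.sum_sub_distrib]
    · simp
  have hall := (hω.add hdiff).add hf.isLittleO_sum_sub_integral
  set ε' := c / (2 * (2 + ε)) with hε'
  obtain ⟨C, hC0, hC⟩ := exists_abs_le_of_isLittleO hall (ε := ε') (by positivity)
  refine ⟨⌊(ε' + 2 * C) / (c / 2)⌋₊ + 1, fun n hn => ?_⟩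
  by_contra hno
  push Not at hno
  have hn' : (ε' + 2 * C) / (c / 2) < n :=
    (Nat.lt_floor_add_one _).trans_le (by exact_mod_cast hn)
  have hn0 : (0 : ℝ) < n := lt_of_le_of_lt (by positivity) hn'
  rw [div_lt_iff₀ (by positivity)] at hn'
  set m := ⌈(1 + ε) * n⌉₊ with hm
  have hm1 : (1 + ε) * n ≤ m := Nat.le_ceil _
  have hm2 : (m : ℝ) < (1 + ε) * n + 1 := Nat.ceil_lt_add_one (by positivity)
  have hnm : n ≤ m := by
    have : (n : ℝ) ≤ m := le_trans (by nlinarith) hm1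
    exact_mod_cast this
  have hsum : ∑ j ∈ Finset.range m, (if ω (2 * j) = u ∧ ω (2 * j + 1) = x then (1 : ℝ) else 0)
      = ∑ j ∈ Finset.range n, (if ω (2 * j) = u ∧ ω (2 * j + 1) = x then (1 : ℝ) else 0) := by
    rw [← sub_eq_zero, ← Finset.sum_Ico_eq_sub _ hnm]
    refine Finset.sum_eq_zero fun j hj => if_neg ?_
    rw [Finset.mem_Ico] at hj
    rintro ⟨h1, h2⟩
    refine hno j hj.1 ?_ h1 h2
    have : (j : ℝ) + 1 ≤ m := by exact_mod_cast hj.2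
    linarith
  have h1 := hC n
  have h2 := hC m
  have h3 := hwin n hn0
  have h4 : ∫ b in Set.Ioc (n : ℝ) ((1 + ε) * n), f b ≤ ∫ b in Set.Ioc (n : ℝ) m, f b := by
    refine setIntegral_mono_set ?_ ?_ (Set.Ioc_subset_Ioc_right hm1).eventuallyLE
    · exact (hf.integrableOn m).mono_set (Set.Ioc_subset_Ioc_left hn0.le)
    · exact (ae_restrict_iff' measurableSet_Ioc).2
        (Eventually.of_forall fun b hb => hf0 b (hn0.trans hb.1))
  rw [hf.integral_Ioc_sub (y := m) hn0.le (by exact_mod_cast hnm)] at h4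
  have h5 : ε' * ((2 + ε) * n) = c / 2 * n := by rw [hε']; field_simp
  have h6 : ε' * m ≤ ε' * ((1 + ε) * n + 1) :=
    mul_le_mul_of_nonneg_left hm2.le (by positivity)
  rw [abs_le] at h1 h2
  rw [hsum] at h2
  nlinarith [h1.1, h1.2, h2.1, h2.2]

omit hr h in
theorem DiagIFS.Valid.edgeDist_tail_ge {K : ℝ} (hK : ∀ i (a : Φ.Symb), Φ.rate i a ≤ K)
    (i : Fin d) (ω : ℕ → Φ.Symb) (m l : ℕ) :
    Real.exp (-(K * l)) * DiagIFS.edgeDist (Φ.coding (DiagIFS.tail (m + l) ω) i)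
      ≤ DiagIFS.edgeDist (Φ.coding (DiagIFS.tail m ω) i) := by
  induction l with
  | zero => simp
  | succ l ih =>
    refine le_trans ?_ ih
    have h1 := hV.edgeDist_base_ge i ((ω (m + l)).1 i)
      (y := Φ.coding (DiagIFS.tail (m + l + 1) ω) i)
    rw [← hV.coding_tail, hV.abs_slope_eq] at h1
    have h2 : Real.exp (-K) * DiagIFS.edgeDist (Φ.coding (DiagIFS.tail (m + l + 1) ω) i)
        ≤ DiagIFS.edgeDist (Φ.coding (DiagIFS.tail (m + l) ω) i) :=
      (mul_le_mul_of_nonneg_right (Real.exp_le_exp.2 (neg_le_neg (hK i _)))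
        (DiagIFS.edgeDist_nonneg (hV.coding_mem_Icc i _))).trans h1
    calc _ = Real.exp (-(K * l)) * (Real.exp (-K) *
          DiagIFS.edgeDist (Φ.coding (DiagIFS.tail (m + l + 1) ω) i)) := by
          rw [← mul_assoc, ← Real.exp_add, ← add_assoc]
          congr 2
          push_cast
          ring
      _ ≤ _ := mul_le_mul_of_nonneg_left h2 (Real.exp_pos _).le

/-- Almost surely, the tails of a random sequence stay subexponentially far from the boundary in
every coordinate where two charged symbols have disjoint intervals. -/
theorem ae_edgeDist_ge (hnd : Set.Ioi (0:ℝ) ⊆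
      closure {b : ℝ | 0 < b ∧ ∀ a : Φ.Symb, (∃ b' > 0, 0 < r b' a) → 0 < r b a})
    {i : Fin d} {a b : Φ.Symb} (ha : ∃ b' > 0, 0 < r b' a) (hb : ∃ b' > 0, 0 < r b' b)
    (hab : Disjoint (Φ.base i (a.1 i) '' Set.Ioo (0:ℝ) 1) (Φ.base i (b.1 i) '' Set.Ioo (0:ℝ) 1)) :
    ∀ᵐ ω ∂μ, ∀ ε > 0, ∃ c > 0, ∀ n : ℕ,
      c * Real.exp (-(ε * n)) ≤ DiagIFS.edgeDist (Φ.coding (DiagIFS.tail n ω) i) := by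
  obtain ⟨κ, hκ0, K, hK0, hκ⟩ := hV.exists_rate_bounds
  obtain ⟨u, x, hu, hx, c₀, hc₀, hword⟩ := hV.exists_word hab
  have hu' : ∃ b' > 0, 0 < r b' u := by rcases hu with rfl | rfl <;> assumption
  have hx' : ∃ b' > 0, 0 < r b' x := by rcases hx with rfl | rfl <;> assumption
  have hd : Set.Ioi (0 : ℝ) ⊆ closure {b | 0 < b ∧ 0 < r b u * r b x} :=
    hnd.trans (closure_mono fun b hb => ⟨hb.1, mul_pos (hb.2 u hu') (hb.2 x hx')⟩)
  filter_upwards [ae_exists_visit hr hV h hd] with ω hω ε hε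
  set ε' := ε / K with hε'
  have hε'0 : 0 < ε' := by positivity
  obtain ⟨n₀, hn₀⟩ := hω ε' hε'0
  set D : ℝ := (1 + ε') * (1 + 2 * n₀) + 2 with hD
  refine ⟨Real.exp (-(K * D)) * c₀, by positivity, fun m => ?_⟩
  obtain ⟨j, hj, hj2, hju, hjx⟩ := hn₀ (n₀ + (m + 1) / 2) (Nat.le_add_right _ _)
  have hmj : m ≤ 2 * j := by omega
  obtain ⟨l, hl⟩ := Nat.exists_eq_add_of_le hmj
  have hlD : (l : ℝ) ≤ ε' * m + D := by
    have h1 : (2 * (j : ℝ)) = m + l := by exact_mod_cast hl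
    have h2 : (((n₀ + (m + 1) / 2 : ℕ)) : ℝ) ≤ n₀ + ((m : ℝ) + 1) / 2 := by
      push_cast
      have : (((m + 1) / 2 : ℕ) : ℝ) ≤ ((m + 1 : ℕ) : ℝ) / 2 := Nat.cast_div_le
      push_cast at this
      linarith
    have h3 := mul_le_mul_of_nonneg_left h2 (by positivity : 0 ≤ 1 + ε')
    rw [hD]
    linarith
  have h1 := hV.edgeDist_tail_ge (fun i a => (hκ i a).2) i ω m l
  have h2 : c₀ ≤ DiagIFS.edgeDist (Φ.coding (DiagIFS.tail (m + l) ω) i) := by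
    rw [← hl, hV.coding_tail, hV.coding_tail i (2 * j + 1), hju, hjx]
    exact hword _ (hV.coding_mem_Icc _ _)
  refine le_trans ?_ h1
  calc _ = Real.exp (-(K * D) + -(ε * m)) * c₀ := by rw [Real.exp_add]; ring
    _ ≤ Real.exp (-(K * l)) * c₀ := by
      gcongr
      have : K * l ≤ K * (ε' * m + D) := mul_le_mul_of_nonneg_left hlD hK0.le
      have e : K * (ε' * m + D) = ε * m + K * D := by rw [hε']; field_simp
      linarith
    _ ≤ _ := mul_le_mul_of_nonneg_left h2 (Real.exp_pos _).le

end Visits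

section Pointwise

variable {Φ : DiagIFS d A} {r : ℝ → Φ.Symb → ℝ} {ω : ℕ → Φ.Symb}

theorem approxBox_subset_preimage_ball (hr : IsCyclic Φ r) (hV : Φ.Valid)
    (hrate : ∀ i : Fin d, (fun n : ℕ => ∑ k ∈ Finset.range n, Φ.rate i (ω k) - chiInt Φ r i n)
      =o[atTop] (fun n : ℕ => (n : ℝ))) {ε : ℝ} (hε : 0 < ε) :
    ∀ᶠ B in atTop, approxBox Φ r ((1 + ε) * B) ω
      ⊆ Φ.coding ⁻¹' Metric.ball (Φ.coding ω) (Real.exp (-B)) := by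
  obtain ⟨κ, hκ0, K, hK0, hκ⟩ := hV.exists_rate_bounds
  set ε' := κ * ε / (2 * (1 + ε)) with hε'
  choose C hC0 hC using fun i => exists_abs_le_of_isLittleO (hrate i) (ε := ε') (by positivity)
  have hev : ∀ᶠ B in atTop, ∀ i, (K + C i) / (ε / 2) < B :=
    eventually_all.2 fun i => eventually_gt_atTop _
  filter_upwards [hev, eventually_gt_atTop 0] with B hB hB0 τ hτ
  rw [Set.mem_preimage, Metric.mem_ball, dist_pi_lt_iff (Real.exp_pos _)]
  intro i
  have hB' : 0 < (1 + ε) * B := by positivity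
  obtain ⟨hs1, hs2, hs3⟩ := hr.Bcoord_spec hκ0 hκ hV hB' i
  set b := Bcoord Φ r ((1 + ε) * B) i
  have hagree : ∀ k < ⌊b⌋₊, (ω k).1 i = (τ k).1 i := fun k hk => by
    refine (hτ k i ?_).symm
    have : ((k + 1 : ℕ) : ℝ) ≤ b := (Nat.le_floor_iff hs1.le).1 hk
    exact_mod_cast this
  rw [dist_comm, Real.dist_eq, hV.coding_sub_eq hagree, abs_mul, hV.abs_prod_slope]
  have h1 : |Φ.coding (DiagIFS.tail ⌊b⌋₊ ω) i - Φ.coding (DiagIFS.tail ⌊b⌋₊ τ) i| ≤ 1 := by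
    have h1 := hV.coding_mem_Icc i (DiagIFS.tail ⌊b⌋₊ ω)
    have h2 := hV.coding_mem_Icc i (DiagIFS.tail ⌊b⌋₊ τ)
    rw [abs_le]
    constructor <;> linarith [h1.1, h1.2, h2.1, h2.2]
  refine (mul_le_of_le_one_right (Real.exp_pos _).le h1).trans_lt (Real.exp_lt_exp.2 ?_)
  have h2 := (abs_le.1 (hC i ⌊b⌋₊)).1
  have h3 := (hr.chiInt_sub_mem hκ i (Nat.cast_nonneg _) (Nat.floor_le hs1.le)).2
  have h4 : K * (b - ⌊b⌋₊) ≤ K := by nlinarith [Nat.lt_floor_add_one b]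
  have h5 : ε' * (⌊b⌋₊ : ℝ) ≤ ε' * ((1 + ε) * B / κ) :=
    mul_le_mul_of_nonneg_left ((Nat.floor_le hs1.le).trans hs2) (by positivity)
  have h6 : ε' * ((1 + ε) * B / κ) = ε / 2 * B := by rw [hε']; field_simp
  have h7 := hB i
  rw [div_lt_iff₀ (by positivity)] at h7
  rw [hs3] at h3
  linarith

/-- If all the relevant coordinate sets are good and the tails of `ω` stay away from the boundary,
then nearby sequences lie in the approximate cube of `ω`. -/
theorem mem_approxBox_of_mem_ball (hr : IsCyclic Φ r) (hV : Φ.Valid)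
    (hgood : ∀ B > 0, ∀ n : ℕ, Φ.GoodIdx
      (Finset.univ.filter fun i => (n : ℝ) + 1 ≤ Bcoord Φ r B i))
    (hrate : ∀ i : Fin d, (fun n : ℕ => ∑ k ∈ Finset.range n, Φ.rate i (ω k) - chiInt Φ r i n)
      =o[atTop] (fun n : ℕ => (n : ℝ)))
    (hω : ∀ k : ℕ, 0 < r ((k : ℝ) + 1) (ω k))
    (hedge : ∀ (i : Fin d) (a b : Φ.Symb), (∃ b' > 0, 0 < r b' a) → (∃ b' > 0, 0 < r b' b) →
      Disjoint (Φ.base i (a.1 i) '' Set.Ioo (0:ℝ) 1) (Φ.base i (b.1 i) '' Set.Ioo (0:ℝ) 1) →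
      ∀ ε > 0, ∃ c > 0, ∀ n : ℕ,
        c * Real.exp (-(ε * n)) ≤ DiagIFS.edgeDist (Φ.coding (DiagIFS.tail n ω) i))
    {ε : ℝ} (hε : 0 < ε) :
    ∀ᶠ B in atTop, ∀ τ : ℕ → Φ.Symb, (∀ k : ℕ, 0 < r ((k : ℝ) + 1) (τ k)) →
      Φ.coding τ ∈ Metric.ball (Φ.coding ω) (Real.exp (-((1 + ε) * B))) →
      τ ∈ approxBox Φ r B ω := by
  obtain ⟨κ, hκ0, K, hK0, hκ⟩ := hV.exists_rate_bounds
  set ε' := ε * κ / 4 with hε'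
  have hε'0 : 0 < ε' := by positivity
  choose C hC0 hC using fun i => exists_abs_le_of_isLittleO (hrate i) hε'0
  have hedge' : ∀ i : Fin d, ∃ c > 0, ∀ a b : Φ.Symb, (∃ b' > 0, 0 < r b' a) →
      (∃ b' > 0, 0 < r b' b) →
      Disjoint (Φ.base i (a.1 i) '' Set.Ioo (0:ℝ) 1) (Φ.base i (b.1 i) '' Set.Ioo (0:ℝ) 1) →
      ∀ n : ℕ, c * Real.exp (-(ε' * n))
        ≤ DiagIFS.edgeDist (Φ.coding (DiagIFS.tail n ω) i) := by
    intro i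
    by_cases hi : ∃ a b : Φ.Symb, (∃ b' > 0, 0 < r b' a) ∧ (∃ b' > 0, 0 < r b' b) ∧
      Disjoint (Φ.base i (a.1 i) '' Set.Ioo (0:ℝ) 1) (Φ.base i (b.1 i) '' Set.Ioo (0:ℝ) 1)
    · obtain ⟨a, b, ha, hb, hab⟩ := hi
      obtain ⟨c, hc, h⟩ := hedge i a b ha hb hab ε' hε'0
      exact ⟨c, hc, fun _ _ _ _ _ => h⟩
    · exact ⟨1, one_pos, fun a b ha hb hab => absurd ⟨a, b, ha, hb, hab⟩ hi⟩
  choose c hc0 hc using hedge'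
  have hev : ∀ᶠ B in atTop, ∀ i, (C i - Real.log (c i)) / (ε / 2) < B :=
    eventually_all.2 fun i => eventually_gt_atTop _
  filter_upwards [hev, eventually_gt_atTop 0] with B hB hB0 τ hτ hball n
  rw [Metric.mem_ball, dist_pi_lt_iff (Real.exp_pos _)] at hball
  induction n using Nat.strong_induction_on with
  | _ n ih =>
  by_contra hne
  push Not at hne
  obtain ⟨j, hj, hjne⟩ := hne
  obtain ⟨i, hi, hdisj⟩ := hgood B hB0 n (ω n).1 (ω n).2 (τ n).1 (τ n).2
    ⟨j, by simpa using hj, hjne.symm⟩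
  have hi' : (n : ℝ) + 1 ≤ Bcoord Φ r B i := by simpa using hi
  have hagree : ∀ k < n, (ω k).1 i = (τ k).1 i := fun k hk => by
    refine (ih k hk i (le_trans ?_ hi')).symm
    have : (k : ℝ) < n := by exact_mod_cast hk
    linarith
  have h1 := hball i
  rw [dist_comm, Real.dist_eq, hV.coding_sub_eq hagree, abs_mul, hV.abs_prod_slope,
    hV.coding_tail i n ω, hV.coding_tail i n τ] at h1
  have h2 := hV.separation hdisj (y := Φ.coding (DiagIFS.tail (n + 1) ω) i)
    (hV.coding_mem_Icc i (DiagIFS.tail (n + 1) τ))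
  rw [hV.abs_slope_eq] at h2
  have h3 := hc i (ω n) (τ n) ⟨_, by positivity, hω n⟩ ⟨_, by positivity, hτ n⟩ hdisj (n + 1)
  have h4 : Real.exp (-∑ k ∈ Finset.range n, Φ.rate i (ω k)) * (Real.exp (-Φ.rate i (ω n)) *
      (Real.exp (Real.log (c i)) * Real.exp (-(ε' * ((n + 1 : ℕ) : ℝ)))))
      < Real.exp (-((1 + ε) * B)) := by
    refine lt_of_le_of_lt ?_ h1
    refine mul_le_mul_of_nonneg_left (le_trans ?_ h2) (Real.exp_pos _).le
    refine mul_le_mul_of_nonneg_left ?_ (Real.exp_pos _).le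
    rwa [Real.exp_log (hc0 i)]
  rw [← Real.exp_add, ← Real.exp_add, ← Real.exp_add, Real.exp_lt_exp] at h4
  have h5 := (abs_le.1 (hC i (n + 1))).2
  rw [Finset.sum_range_succ] at h5
  obtain ⟨hs1, hs2, hs3⟩ := hr.Bcoord_spec hκ0 hκ hV hB0 i
  have h6 : ((n + 1 : ℕ) : ℝ) ≤ Bcoord Φ r B i := by exact_mod_cast hi'
  have h7 := (hr.le_Bcoord_iff hV hB0 i (Nat.cast_nonneg _)).1 h6
  have h8 : ε' * ((n + 1 : ℕ) : ℝ) ≤ ε / 4 * B := by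
    have : ε' * ((n + 1 : ℕ) : ℝ) ≤ ε' * (B / κ) :=
      mul_le_mul_of_nonneg_left (h6.trans hs2) hε'0.le
    have e : ε' * (B / κ) = ε / 4 * B := by rw [hε']; field_simp
    linarith
  have h9 := hB i
  rw [div_lt_iff₀ (by positivity)] at h9
  linarith

end Pointwise

/-- An almost sure property of image points holds almost everywhere for the image measure. -/
theorem ae_map_of_ae_of_continuous {X Y : Type*} [TopologicalSpace X] [CompactSpace X]
    [MeasurableSpace X] [BorelSpace X] [TopologicalSpace Y] [T2Space Y] [MeasurableSpace Y]
    [BorelSpace Y] {μ : Measure X} [IsFiniteMeasure μ] [μ.WeaklyRegular] {f : X → Y}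
    (hf : Continuous f) {p : Y → Prop} (h : ∀ᵐ x ∂μ, p (f x)) : ∀ᵐ y ∂(μ.map f), p y := by
  obtain ⟨G, hG, hGm, hGp⟩ := exists_measurable_superset_of_null h
  refine le_antisymm (ENNReal.le_of_forall_pos_le_add fun ε hε _ => ?_) zero_le
  obtain ⟨F, hFG, hF, hμF⟩ := hGm.compl.exists_isClosed_sdiff_lt (measure_ne_top μ _)
    (ENNReal.coe_pos.2 hε).ne'
  have hK : IsClosed (f '' F) := (hF.isCompact.image hf).isClosed
  calc μ.map f {y | ¬ p y} ≤ μ.map f (f '' F)ᶜ := by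
        refine measure_mono fun y hy => ?_
        rintro ⟨x, hx, rfl⟩
        exact hFG hx (hG hy)
    _ = μ (f ⁻¹' (f '' F)ᶜ) := Measure.map_apply hf.measurable hK.measurableSet.compl
    _ ≤ μ (G ∪ Gᶜ \ F) := by
        refine measure_mono fun x hx => ?_
        by_cases hxG : x ∈ G
        · exact Or.inl hxG
        · exact Or.inr ⟨hxG, fun hxF => hx ⟨x, hxF, rfl⟩⟩
    _ ≤ μ G + μ (Gᶜ \ F) := measure_union_le _ _
    _ ≤ 0 + ε := by rw [hGp, zero_add, zero_add]; exact hμF.le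

section Dimension

variable {Φ : DiagIFS d A} {r : ℝ → Φ.Symb → ℝ} {μ : Measure (ℕ → Φ.Symb)}

theorem map_coding_ball (hV : Φ.Valid) (x : Fin d → ℝ) (ρ : ℝ) :
    (μ.map Φ.coding (Metric.ball x ρ)).toReal = μ.real (Φ.coding ⁻¹' Metric.ball x ρ) := by
  rw [Measure.map_apply hV.continuous_coding.measurable Metric.isOpen_ball.measurableSet]
  rfl

variable (hr : IsCyclic Φ r) (hV : Φ.Valid)
  (h : IsProductMeasure Φ (fun n => r ((n : ℝ) + 1)) μ)
include hr hV h

theorem ae_lowerPtDim_le {m : ℝ} (hm : 0 ≤ m)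
    (hfreq : ∀ η > 0, ∃ᶠ B in atTop, deltaRB Φ r B < m + η) :
    ∀ᵐ ω ∂μ, lowerPtDim (μ.map Φ.coding) (Φ.coding ω) ≤ ENNReal.ofReal m := by
  have := hV.nonempty_symb
  have := h.1
  have hp : ∀ k : ℕ, IsProbVec (r ((k : ℝ) + 1)) := fun k => hr.prob _ (by positivity)
  filter_upwards [ae_sum_rate_sub_chiInt hr hV h, ae_log_real_approxBox hr hV h, h.ae_pos hp]
    with ω hrate hbox hpos
  refine ENNReal.le_of_forall_pos_le_add fun η hη _ => ?_
  rw [← ENNReal.ofReal_coe_nnreal, ← ENNReal.ofReal_add hm η.coe_nonneg]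
  have hη' : (0 : ℝ) < η := hη
  set ε : ℝ := min 1 (η / (m + 4)) with hεdef
  have hε : 0 < ε := by positivity
  have hε1 : ε ≤ 1 := min_le_left _ _
  have hεη : ε * (m + 4) ≤ η := (le_div_iff₀ (by positivity)).1 (min_le_right _ _)
  refine liminf_le_of_frequently_le' ?_
  have hlim : Tendsto (fun B : ℝ => Real.exp (-(B / (1 + ε)))) atTop (𝓝[>] 0) := by
    refine tendsto_nhdsWithin_iff.2 ⟨?_, Eventually.of_forall fun _ => Real.exp_pos _⟩
    exact Real.tendsto_exp_neg_atTop_nhds_zero.comp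
      (tendsto_id.atTop_div_const (by positivity))
  refine hlim.frequently ?_
  have hsub := (tendsto_id.atTop_div_const (by positivity : 0 < 1 + ε)).eventually
    (approxBox_subset_preimage_ball hr hV hrate hε)
  refine ((hfreq ε hε).and_eventually
    ((hbox ε hε).and (hsub.and (eventually_gt_atTop 0)))).mono ?_
  rintro B ⟨hδ, hB, hBsub, hB0⟩
  refine ENNReal.ofReal_le_ofReal ?_
  rw [id, mul_div_cancel₀ B (by positivity : 1 + ε ≠ 0)] at hBsub
  rw [map_coding_ball hV, Real.log_exp, div_neg, ← neg_div, div_le_iff₀ (by positivity)]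
  have h1 : Real.log (μ.real (approxBox Φ r B ω))
      ≤ Real.log (μ.real (Φ.coding ⁻¹' Metric.ball (Φ.coding ω) (Real.exp (-(B / (1 + ε)))))) :=
    Real.log_le_log (real_approxBox_pos hr hV h hB0 hpos) (measureReal_mono hBsub)
  have h2 := (abs_le.1 hB).2
  have h3 : B * deltaRB Φ r B ≤ B * (m + ε) := mul_le_mul_of_nonneg_left hδ.le hB0.le
  have h4 : (m + 2 * ε) * (1 + ε) ≤ m + η := by nlinarith
  have h5 : (m + 2 * ε) * B ≤ (m + η) * (B / (1 + ε)) := by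
    rw [← mul_div_assoc, le_div_iff₀ (by positivity)]
    nlinarith
  linarith

theorem ae_le_lowerPtDim {m : ℝ} (hm : 0 ≤ m) (hle : ∀ B > 0, m ≤ deltaRB Φ r B)
    (hgood : ∀ B > 0, ∀ n : ℕ, Φ.GoodIdx
      (Finset.univ.filter fun i => (n : ℝ) + 1 ≤ Bcoord Φ r B i))
    (hnd : Set.Ioi (0:ℝ) ⊆
      closure {b : ℝ | 0 < b ∧ ∀ a : Φ.Symb, (∃ b' > 0, 0 < r b' a) → 0 < r b a}) :
    ∀ᵐ ω ∂μ, ENNReal.ofReal m ≤ lowerPtDim (μ.map Φ.coding) (Φ.coding ω) := by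
  have := hV.nonempty_symb
  have := h.1
  have hp : ∀ k : ℕ, IsProbVec (r ((k : ℝ) + 1)) := fun k => hr.prob _ (by positivity)
  have hedge : ∀ᵐ ω ∂μ, ∀ (i : Fin d) (a b : Φ.Symb), (∃ b' > 0, 0 < r b' a) →
      (∃ b' > 0, 0 < r b' b) →
      Disjoint (Φ.base i (a.1 i) '' Set.Ioo (0:ℝ) 1) (Φ.base i (b.1 i) '' Set.Ioo (0:ℝ) 1) →
      ∀ ε > 0, ∃ c > 0, ∀ n : ℕ,
        c * Real.exp (-(ε * n)) ≤ DiagIFS.edgeDist (Φ.coding (DiagIFS.tail n ω) i) := by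
    simp only [ae_all_iff]
    exact fun i a b ha hb hab => ae_edgeDist_ge hr hV h hnd ha hb hab
  filter_upwards [ae_sum_rate_sub_chiInt hr hV h, ae_log_real_approxBox hr hV h, h.ae_pos hp,
    hedge] with ω hrate hbox hpos hedge
  refine ENNReal.le_of_forall_pos_le_add fun η hη _ => ?_
  rw [← tsub_le_iff_right, ← ENNReal.ofReal_coe_nnreal, ← ENNReal.ofReal_sub _ η.coe_nonneg]
  have hη' : (0 : ℝ) < η := hη
  set ε : ℝ := η / (1 + m) with hεdef
  have hε : 0 < ε := by positivity
  have hεη : ε * (1 + m) = η := by rw [hεdef]; field_simp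
  have hε1 : 0 < 1 + ε := by positivity
  have hsub := (approxBox_subset_preimage_ball hr hV hrate one_pos)
  have hsup := (tendsto_id.atTop_div_const hε1).eventually
    ((mem_approxBox_of_mem_ball hr hV hgood hrate hpos hedge hε).and
      ((hbox ε hε).and (eventually_gt_atTop 0)))
  have hlog : Tendsto (fun ρ : ℝ => -Real.log ρ) (𝓝[>] 0) atTop :=
    tendsto_neg_atBot_atTop.comp Real.tendsto_log_nhdsGT_zero
  refine le_liminf_of_le (by isBoundedDefault) ?_
  filter_upwards [hlog.eventually (hsub.and hsup), self_mem_nhdsWithin] with ρ hρ hρ0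
  have hρ0' : (0 : ℝ) < ρ := hρ0
  obtain ⟨hBsub, hBsup, hB, hB0⟩ := hρ
  set B := -Real.log ρ / (1 + ε) with hBdef
  have hBρ : Real.log ρ = -((1 + ε) * B) := by rw [hBdef]; field_simp
  refine ENNReal.ofReal_le_ofReal ?_
  rw [neg_neg, Real.exp_log hρ0'] at hBsub
  simp only [id] at hBsup hB hB0
  rw [← hBdef] at hBsup hB hB0
  rw [← hBρ, Real.exp_log hρ0'] at hBsup
  rw [map_coding_ball hV, hBρ, div_neg, ← neg_div, le_div_iff₀ (by positivity)]
  have hlogpos : 0 < -Real.log ρ := by rw [hBρ, neg_neg]; positivity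
  have hpos1 : 0 < μ.real (Φ.coding ⁻¹' Metric.ball (Φ.coding ω) ρ) :=
    (real_approxBox_pos hr hV h (by positivity) hpos).trans_le (measureReal_mono hBsub)
  have hle1 : μ.real (Φ.coding ⁻¹' Metric.ball (Φ.coding ω) ρ)
      ≤ μ.real (approxBox Φ r B ω) := by
    refine ENNReal.toReal_mono (measure_ne_top _ _) (measure_mono_ae ?_)
    filter_upwards [h.ae_pos hp] with τ hτ hτball
    exact hBsup τ hτ hτball
  have h1 := Real.log_le_log hpos1 hle1
  have h2 := (abs_le.1 hB).1
  have h3 : B * m ≤ B * deltaRB Φ r B := mul_le_mul_of_nonneg_left (hle B hB0) hB0.le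
  have h4 : (m - η) * (1 + ε) ≤ m - ε := by nlinarith
  have h5 : (m - η) * ((1 + ε) * B) ≤ (m - ε) * B := by
    rw [← mul_assoc]
    exact mul_le_mul_of_nonneg_right h4 hB0.le
  linarith

theorem measDim_le {m : ℝ} (hm : 0 ≤ m)
    (hfreq : ∀ η > 0, ∃ᶠ B in atTop, deltaRB Φ r B < m + η) :
    measDim (μ.map Φ.coding) ≤ ENNReal.ofReal m := by
  have := h.1
  exact essSup_le_of_ae_le _ (ae_map_of_ae_of_continuous hV.continuous_coding
    (ae_lowerPtDim_le hr hV h hm hfreq))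

theorem le_measDim {m : ℝ} (hm : 0 ≤ m) (hle : ∀ B > 0, m ≤ deltaRB Φ r B)
    (hgood : ∀ B > 0, ∀ n : ℕ, Φ.GoodIdx
      (Finset.univ.filter fun i => (n : ℝ) + 1 ≤ Bcoord Φ r B i))
    (hnd : Set.Ioi (0:ℝ) ⊆
      closure {b : ℝ | 0 < b ∧ ∀ a : Φ.Symb, (∃ b' > 0, 0 < r b' a) → 0 < r b a}) :
    ENNReal.ofReal m ≤ measDim (μ.map Φ.coding) := by
  have := h.1
  have h1 := ae_of_ae_map hV.continuous_coding.measurable.aemeasurable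
    (ENNReal.ae_le_essSup (μ := μ.map Φ.coding) (lowerPtDim (μ.map Φ.coding)))
  obtain ⟨ω, h1, h2⟩ := (h1.and (ae_le_lowerPtDim hr hV h hm hle hgood hnd)).exists
  exact h2.trans h1

end Dimension

namespace Cycle

variable {Φ : DiagIFS d A} (c : Cycle Φ)

theorem isCyclic : IsCyclic Φ c.r where
  prob := c.prob
  cont := c.cont
  periodic := by
    rcases c.one_le_lam.eq_or_lt with h | h
    · exact ⟨2, one_lt_two, fun b hb => c.const_of_lam_eq_one h.symm _ (by positivity) _ hb⟩
    · exact ⟨c.lam, h, c.periodic⟩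

theorem r_zpow_mul (n : ℤ) : ∀ b > 0, c.r (c.lam ^ n * b) = c.r b := by
  have h0 : 0 < c.lam := one_pos.trans_le c.one_le_lam
  have hnat : ∀ (n : ℕ), ∀ b > 0, c.r (c.lam ^ n * b) = c.r b := by
    intro n
    induction n with
    | zero => simp
    | succ n ih =>
      intro b hb
      rw [pow_succ', mul_assoc, c.periodic _ (by positivity), ih b hb]
  intro b hb
  obtain ⟨k, rfl | rfl⟩ := n.eq_nat_or_neg
  · rw [zpow_natCast, hnat k b hb]
  · rw [← hnat k (c.lam ^ (-(k : ℤ)) * b) (by positivity), ← mul_assoc, zpow_neg, zpow_natCast,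
      mul_inv_cancel₀ (pow_ne_zero _ h0.ne'), one_mul]

theorem bddBelow_deltaRB : BddBelow (deltaRB Φ c.r '' Set.Icc 1 c.lam) := by
  refine ⟨0, ?_⟩
  rintro _ ⟨B, hB, rfl⟩
  exact c.isCyclic.deltaRB_nonneg (one_pos.trans_le hB.1)

theorem delta_nonneg : 0 ≤ c.delta := by
  refine Real.sInf_nonneg ?_
  rintro _ ⟨B, hB, rfl⟩
  exact c.isCyclic.deltaRB_nonneg (one_pos.trans_le hB.1)

variable (hV : Φ.Valid)
include hV

theorem delta_le_deltaRB {B : ℝ} (hB : 0 < B) : c.delta ≤ deltaRB Φ c.r B := by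
  have h0 : 0 < c.lam := one_pos.trans_le c.one_le_lam
  suffices h : ∃ s > 0, ∃ B' ∈ Set.Icc 1 c.lam, B = s * B' ∧ ∀ b > 0, c.r (s * b) = c.r b by
    obtain ⟨s, hs, B', hB', rfl, hp⟩ := h
    rw [c.isCyclic.deltaRB_mul hV hs hp (one_pos.trans_le hB'.1)]
    exact csInf_le c.bddBelow_deltaRB ⟨B', hB', rfl⟩
  rcases c.one_le_lam.eq_or_lt with h | h
  · exact ⟨B, hB, 1, ⟨le_rfl, c.one_le_lam⟩, (mul_one B).symm,
      fun b hb => c.const_of_lam_eq_one h.symm _ (by positivity) _ hb⟩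
  · obtain ⟨n, hn1, hn2⟩ := exists_mem_Ico_zpow hB h
    have hs : 0 < c.lam ^ n := zpow_pos h0 n
    refine ⟨c.lam ^ n, hs, B / c.lam ^ n, ⟨(one_le_div hs).2 hn1, ?_⟩, by field_simp,
      c.r_zpow_mul n⟩
    rw [div_le_iff₀ hs, ← zpow_one_add₀ h0.ne', add_comm]
    exact hn2.le

theorem frequently_deltaRB_lt {η : ℝ} (hη : 0 < η) :
    ∃ᶠ B in atTop, deltaRB Φ c.r B < c.delta + η := by
  obtain ⟨_, ⟨B₀, hB₀, rfl⟩, hlt⟩ := exists_lt_of_csInf_lt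
    ((Set.nonempty_Icc.2 c.one_le_lam).image _) (lt_add_of_pos_right c.delta hη)
  have hB₀' := one_pos.trans_le hB₀.1
  rw [frequently_atTop]
  intro b
  suffices h : ∃ s > 0, b ≤ s * B₀ ∧ ∀ b > 0, c.r (s * b) = c.r b by
    obtain ⟨s, hs, hb, hp⟩ := h
    exact ⟨s * B₀, hb, by rwa [c.isCyclic.deltaRB_mul hV hs hp hB₀']⟩
  rcases c.one_le_lam.eq_or_lt with h | h
  · refine ⟨max b 1, by positivity, ?_, fun b hb =>
      c.const_of_lam_eq_one h.symm _ (by positivity) _ hb⟩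
    exact (le_max_left b 1).trans (le_mul_of_one_le_right (by positivity) hB₀.1)
  · obtain ⟨n, hn⟩ := pow_unbounded_of_one_lt b h
    have hs : 0 < c.lam ^ n := pow_pos (one_pos.trans h) n
    refine ⟨c.lam ^ n, hs, hn.le.trans (le_mul_of_one_le_right hs.le hB₀.1), ?_⟩
    simpa using c.r_zpow_mul n

omit hV in
theorem chi_cycleAvg (i : Fin d) (B : ℝ) :
    Φ.chi i (cycleAvg c B) = B⁻¹ * chiInt Φ c.r i B := by
  simp only [chiInt, Φ.chi_eq, cycleAvg]
  rw [integral_finsetSum _ fun a _ =>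
    ((c.isCyclic.logPeriodic (continuous_apply a)).integrableOn B).mul_const _, Finset.mul_sum]
  refine Finset.sum_congr rfl fun a _ => ?_
  rw [integral_mul_const, mul_assoc]

theorem Good.goodIdx (hc : c.Good) {B : ℝ} (hB : 0 < B) (n : ℕ) : Φ.GoodIdx
    (Finset.univ.filter fun i => (n : ℝ) + 1 ≤ Bcoord Φ c.r B i) := by
  have hn : (0 : ℝ) < (n : ℝ) + 1 := by positivity
  have e : (Finset.univ.filter fun i => (n : ℝ) + 1 ≤ Bcoord Φ c.r B i)
      = Finset.univ.filter fun i => Φ.chi i (cycleAvg c ((n : ℝ) + 1)) ≤ B / ((n : ℝ) + 1) := by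
    refine Finset.filter_congr fun i _ => ?_
    rw [c.isCyclic.le_Bcoord_iff hV hB i hn.le, c.chi_cycleAvg, inv_mul_eq_div,
      div_le_div_iff_of_pos_right hn]
  rw [e]
  exact hc _ hn _ (by positivity)

theorem measDim_le_delta {μ : Measure (ℕ → Φ.Symb)}
    (h : IsProductMeasure Φ (fun n => c.r ((n : ℝ) + 1)) μ) :
    measDim (Measure.map Φ.coding μ) ≤ ENNReal.ofReal c.delta :=
  measDim_le c.isCyclic hV h c.delta_nonneg fun _ hη => c.frequently_deltaRB_lt hV hη

theorem measDim_eq_delta {μ : Measure (ℕ → Φ.Symb)}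
    (h : IsProductMeasure Φ (fun n => c.r ((n : ℝ) + 1)) μ) (hg : c.Good) (hnd : c.Nondeg) :
    measDim (Measure.map Φ.coding μ) = ENNReal.ofReal c.delta :=
  le_antisymm (c.measDim_le_delta hV h) <|
    le_measDim c.isCyclic hV h c.delta_nonneg (fun _ hB => c.delta_le_deltaRB hV hB)
      (fun _ hB n => Good.goodIdx c hV hg hB n) hnd

omit hV

/-- the constant cycle -/
def const {p : Φ.Symb → ℝ} (hp : IsProbVec p) : Cycle Φ where
  lam := 1
  one_le_lam := le_rfl
  r := fun _ => p
  prob := fun _ _ => hp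
  cont := continuousOn_const
  periodic := fun _ _ => rfl
  const_of_lam_eq_one := fun _ _ _ _ _ => rfl

theorem nondeg_const {p : Φ.Symb → ℝ} (hp : IsProbVec p) : (const hp).Nondeg := fun _ hb =>
  subset_closure ⟨hb, fun _ ⟨_, _, h⟩ => h⟩

theorem good_const {p : Φ.Symb → ℝ} (hp : IsProbVec p) (hg : Φ.GoodVec p) : (const hp).Good := by
  intro B hB
  have : cycleAvg (const hp) B = p := by
    funext a
    simp [cycleAvg, const, hB.le, hB.ne']
  rwa [this]

theorem delta_const {p : Φ.Symb → ℝ} (hp : IsProbVec p) (hV : Φ.Valid) :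
    (const hp).delta = deltaP Φ p := by
  have hr : IsCyclic Φ fun _ => p := (const hp).isCyclic
  have hB : ∀ i, Bcoord Φ (fun _ => p) 1 i = (Φ.chi i p)⁻¹ := by
    intro i
    obtain ⟨κ, hκ0, K, -, hκ⟩ := hV.exists_rate_bounds
    have hchi : 0 < Φ.chi i p := hκ0.trans_le (DiagIFS.chi_mem hκ i hp).1
    refine (hr.chiInt_strictMonoOn hV i).injOn (hr.Bcoord_pos hV one_pos i).le
      (inv_pos.2 hchi).le ?_
    rw [hr.chiInt_Bcoord hV one_pos]
    simp [chiInt, hchi.le, hchi.ne']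
  have h1 : (const hp).delta = deltaRB Φ (fun _ => p) 1 := by
    simp [delta, const]
  rw [h1, deltaRB, deltaP]
  simp only [hB, inv_one, one_mul]

end Cycle

end

/-- For an arbitrary self-affine sponge: `HD(ν_r) ≤ δ(r)` for every cycle `r`, with
equality if `r` is good and nondegenerate; in particular `HD(ν_p) ≤ δ(p)` for every
`p ∈ P`, with equality if `p` is good. -/
theorem measDim_le_delta {d : ℕ} {A : Fin d → Type} [∀ i, Fintype (A i)]
    (Φ : DiagIFS d A) (hV : Φ.Valid) :
    (∀ (c : Cycle Φ) (μ : Measure (ℕ → Φ.Symb)),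
      IsProductMeasure Φ (fun n => c.r ((n : ℝ) + 1)) μ →
        measDim (Measure.map Φ.coding μ) ≤ ENNReal.ofReal c.delta ∧
        (c.Good → c.Nondeg →
          measDim (Measure.map Φ.coding μ) = ENNReal.ofReal c.delta)) ∧
    (∀ p : Φ.Symb → ℝ, IsProbVec p → ∀ μ : Measure (ℕ → Φ.Symb),
      IsProductMeasure Φ (fun _ => p) μ →
        measDim (Measure.map Φ.coding μ) ≤ ENNReal.ofReal (deltaP Φ p) ∧
        (Φ.GoodVec p →
          measDim (Measure.map Φ.coding μ) = ENNReal.ofReal (deltaP Φ p))) := by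
  refine ⟨fun c μ h => ⟨c.measDim_le_delta hV h, c.measDim_eq_delta hV h⟩, fun p hp μ h => ?_⟩
  rw [← Cycle.delta_const hp hV]
  exact ⟨(Cycle.const hp).measDim_le_delta hV h, fun hg =>
    (Cycle.const hp).measDim_eq_delta hV h (Cycle.good_const hp hg) (Cycle.nondeg_const hp)⟩

end SelfAffineSponge
end
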